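/- arXiv:1408.4282 — 2 statements merged into one kernel-verified Lean document; each statement's English description precedes it below -/
import Mathlib

section
/- (Step 3 of the proof of Theorem 3.1) Assume (H0)-(H5) and let (\bar v^{ij})_{(i,j)\in\Gamma^1\times\Gamma^2} be the unique continuous viscosity solution of polynomial growth of the min-max system of PDEs with bilateral inter-connected obstacles. Then for every (i,j)\in\Gamma^1\times\Gamma^2 and every (t_0,x_0)\in[0,T]\times\mathbb{R}^k one has L^{ij}(\vec{\bar v})(t_0,x_0)\le\bar v^{ij}(t_0,x_0)\le U^{ij}(\vec{\bar v})(t_0,x_0); that is, the solution lies between the two inter-connected barriers. -/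
open Set Matrix

noncomputable section

abbrev Euc (k : ℕ) : Type := EuclideanSpace ℝ (Fin k)

/-- Partial derivative in the `i`-th coordinate direction. -/
noncomputable def pd {k : ℕ} (i : Fin k) (ψ : Euc k → ℝ) (x : Euc k) : ℝ :=
  fderiv ℝ ψ x (EuclideanSpace.single i 1)

/-- Time derivative of `φ(t,x)` in `t`. -/
noncomputable def timeDeriv {k : ℕ} (φ : ℝ → Euc k → ℝ) (t : ℝ) (x : Euc k) : ℝ :=
  deriv (fun s => φ s x) t

/-- The second order generator
`𝓛^X φ(t,x) = ½ Tr[σσᵀ(t,x) D²_{xx} φ(t,x)] + b(t,x)ᵀ D_x φ(t,x)`. -/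
noncomputable def genL {k d : ℕ} (b : ℝ → Euc k → Fin k → ℝ)
    (σm : ℝ → Euc k → Matrix (Fin k) (Fin d) ℝ) (φ : ℝ → Euc k → ℝ)
    (t : ℝ) (x : Euc k) : ℝ :=
  (1 / 2) * ∑ i, ∑ j, (σm t x * (σm t x)ᵀ) i j * pd i (fun y => pd j (φ t) y) x
    + ∑ i, b t x i * pd i (φ t) x

/-- `σ(t,x)ᵀ D_x φ(t,x)` as a vector of `ℝ^d`. -/
noncomputable def sigGrad {k d : ℕ} (σm : ℝ → Euc k → Matrix (Fin k) (Fin d) ℝ)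
    (φ : ℝ → Euc k → ℝ) (t : ℝ) (x : Euc k) : Fin d → ℝ :=
  fun l => ∑ i, σm t x i l * pd i (φ t) x

/-- `φ` is of class `C^{1,2}`: once differentiable in `t`, twice in `x`,
with (jointly) continuous derivatives. -/
def IsC12 {k : ℕ} (φ : ℝ → Euc k → ℝ) : Prop :=
  (∀ x, Differentiable ℝ fun s => φ s x) ∧
  Continuous (fun p : ℝ × Euc k => deriv (fun s => φ s p.2) p.1) ∧
  (∀ t, ContDiff ℝ 2 (φ t)) ∧
  Continuous (fun p : ℝ × Euc k => fderiv ℝ (φ p.1) p.2) ∧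
  Continuous (fun p : ℝ × Euc k => fderiv ℝ (fderiv ℝ (φ p.1)) p.2)

/-- Polynomial growth on `[0,T] × ℝ^k`. -/
def PolyGrowth {k : ℕ} (T : ℝ) (Φ : ℝ → Euc k → ℝ) : Prop :=
  ∃ C γ : ℝ, 0 ≤ C ∧ 0 ≤ γ ∧ ∀ t ∈ Icc (0 : ℝ) T, ∀ x : Euc k, |Φ t x| ≤ C * (1 + ‖x‖ ^ γ)

/-- (H0): `b` and `σ` are jointly continuous and Lipschitz in `x` uniformly in `t`. -/
def H0 {k d : ℕ} (T : ℝ) (b : ℝ → Euc k → Fin k → ℝ)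
    (σm : ℝ → Euc k → Matrix (Fin k) (Fin d) ℝ) : Prop :=
  Continuous (fun p : ℝ × Euc k => b p.1 p.2) ∧
  Continuous (fun p : ℝ × Euc k => σm p.1 p.2) ∧
  ∃ C : ℝ, ∀ t ∈ Icc (0 : ℝ) T, ∀ x x' : Euc k,
    (∀ i, |b t x i - b t x' i| ≤ C * ‖x - x'‖) ∧
    (∀ i l, |σm t x i l - σm t x' i l| ≤ C * ‖x - x'‖)


/-- The lower inter-connected obstacle
`L^{ij}(\vec v)(t,x) = max_{kk ∈ Γ¹, kk ≠ i} ( v^{kk j}(t,x) - \underline g_{i kk}(t,x) )`,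
evaluated on the vector `vv = (v^{kl}(t,x))_{(k,l)}` of current values. -/
noncomputable def lowerObst {k : ℕ} {Γ1 Γ2 : Type} [Fintype Γ1] [DecidableEq Γ1]
    [Nontrivial Γ1] (gLow : Γ1 → Γ1 → ℝ → Euc k → ℝ) (i : Γ1) (j : Γ2)
    (t : ℝ) (x : Euc k) (vv : Γ1 × Γ2 → ℝ) : ℝ :=
  Finset.sup' (Finset.univ.erase i)
    (by
      obtain ⟨kk, hkk⟩ := exists_ne i
      exact ⟨kk, Finset.mem_erase.mpr ⟨hkk, Finset.mem_univ kk⟩⟩)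
    (fun kk => vv (kk, j) - gLow i kk t x)

/-- The upper inter-connected obstacle
`U^{ij}(\vec v)(t,x) = min_{l ∈ Γ², l ≠ j} ( v^{il}(t,x) + \bar g_{jl}(t,x) )`. -/
noncomputable def upperObst {k : ℕ} {Γ1 Γ2 : Type} [Fintype Γ2] [DecidableEq Γ2]
    [Nontrivial Γ2] (gUp : Γ2 → Γ2 → ℝ → Euc k → ℝ) (i : Γ1) (j : Γ2)
    (t : ℝ) (x : Euc k) (vv : Γ1 × Γ2 → ℝ) : ℝ :=
  Finset.inf' (Finset.univ.erase j)
    (by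
      obtain ⟨l, hl⟩ := exists_ne j
      exact ⟨l, Finset.mem_erase.mpr ⟨hl, Finset.mem_univ l⟩⟩)
    (fun l => vv (i, l) + gUp j l t x)

/-- Viscosity subsolution of the system of terminal value problems
`F^{ij}(t, x, (v^{kl})_{kl}, ∂_t v^{ij}, 𝓛^X v^{ij}, σᵀ D_x v^{ij}) = 0` on `(0,T) × ℝ^k`
with terminal data `v^{ij}(T,·) = h^{ij}`, in the sense of `C^{1,2}` test functions. -/
def IsViscSubsolSys {k d : ℕ} {Γ : Type} (T : ℝ) (b : ℝ → Euc k → Fin k → ℝ)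
    (σm : ℝ → Euc k → Matrix (Fin k) (Fin d) ℝ) (hterm : Γ → Euc k → ℝ)
    (F : Γ → ℝ → Euc k → (Γ → ℝ) → ℝ → ℝ → (Fin d → ℝ) → ℝ)
    (v : Γ → ℝ → Euc k → ℝ) : Prop :=
  (∀ ij x, v ij T x ≤ hterm ij x) ∧
  ∀ (ij : Γ) (t : ℝ) (x : Euc k), t ∈ Ioo (0 : ℝ) T →
    ∀ φ : ℝ → Euc k → ℝ, IsC12 φ →
      IsLocalMax (fun p : ℝ × Euc k => v ij p.1 p.2 - φ p.1 p.2) (t, x) →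
      v ij t x = φ t x →
      F ij t x (fun kl => v kl t x) (timeDeriv φ t x) (genL b σm φ t x)
        (sigGrad σm φ t x) ≤ 0

/-- Viscosity supersolution of the system. -/
def IsViscSupersolSys {k d : ℕ} {Γ : Type} (T : ℝ) (b : ℝ → Euc k → Fin k → ℝ)
    (σm : ℝ → Euc k → Matrix (Fin k) (Fin d) ℝ) (hterm : Γ → Euc k → ℝ)
    (F : Γ → ℝ → Euc k → (Γ → ℝ) → ℝ → ℝ → (Fin d → ℝ) → ℝ)
    (v : Γ → ℝ → Euc k → ℝ) : Prop :=
  (∀ ij x, hterm ij x ≤ v ij T x) ∧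
  ∀ (ij : Γ) (t : ℝ) (x : Euc k), t ∈ Ioo (0 : ℝ) T →
    ∀ φ : ℝ → Euc k → ℝ, IsC12 φ →
      IsLocalMin (fun p : ℝ × Euc k => v ij p.1 p.2 - φ p.1 p.2) (t, x) →
      v ij t x = φ t x →
      0 ≤ F ij t x (fun kl => v kl t x) (timeDeriv φ t x) (genL b σm φ t x)
        (sigGrad σm φ t x)

/-- Viscosity solution of the system: both a subsolution and a supersolution. -/
def IsViscSolSys {k d : ℕ} {Γ : Type} (T : ℝ) (b : ℝ → Euc k → Fin k → ℝ)
    (σm : ℝ → Euc k → Matrix (Fin k) (Fin d) ℝ) (hterm : Γ → Euc k → ℝ)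
    (F : Γ → ℝ → Euc k → (Γ → ℝ) → ℝ → ℝ → (Fin d → ℝ) → ℝ)
    (v : Γ → ℝ → Euc k → ℝ) : Prop :=
  IsViscSubsolSys T b σm hterm F v ∧ IsViscSupersolSys T b σm hterm F v

/-- The min-max expression of system (1.1):
`min{ v^{ij} - L^{ij}(\vec v) ; max{ v^{ij} - U^{ij}(\vec v) ;
  -∂_t v^{ij} - 𝓛^X v^{ij} - f^{ij}(t,x,\vec v, σᵀ D_x v^{ij}) } }`. -/
noncomputable def FminMax {k d : ℕ} {Γ1 Γ2 : Type} [Fintype Γ1] [Fintype Γ2]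
    [DecidableEq Γ1] [DecidableEq Γ2] [Nontrivial Γ1] [Nontrivial Γ2]
    (f : Γ1 → Γ2 → ℝ → Euc k → ((Γ1 × Γ2) → ℝ) → (Fin d → ℝ) → ℝ)
    (gLow : Γ1 → Γ1 → ℝ → Euc k → ℝ) (gUp : Γ2 → Γ2 → ℝ → Euc k → ℝ) :
    Γ1 × Γ2 → ℝ → Euc k → ((Γ1 × Γ2) → ℝ) → ℝ → ℝ → (Fin d → ℝ) → ℝ :=
  fun ij t x vv dtφ Lφ zφ =>
    min (vv ij - lowerObst gLow ij.1 ij.2 t x vv)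
      (max (vv ij - upperObst gUp ij.1 ij.2 t x vv)
        (-dtφ - Lφ - f ij.1 ij.2 t x vv zφ))

/-- The max-min expression of system (1.2):
`max{ v^{ij} - U^{ij}(\vec v) ; min{ v^{ij} - L^{ij}(\vec v) ;
  -∂_t v^{ij} - 𝓛^X v^{ij} - f^{ij}(t,x,\vec v, σᵀ D_x v^{ij}) } }`. -/
noncomputable def FmaxMin {k d : ℕ} {Γ1 Γ2 : Type} [Fintype Γ1] [Fintype Γ2]
    [DecidableEq Γ1] [DecidableEq Γ2] [Nontrivial Γ1] [Nontrivial Γ2]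
    (f : Γ1 → Γ2 → ℝ → Euc k → ((Γ1 × Γ2) → ℝ) → (Fin d → ℝ) → ℝ)
    (gLow : Γ1 → Γ1 → ℝ → Euc k → ℝ) (gUp : Γ2 → Γ2 → ℝ → Euc k → ℝ) :
    Γ1 × Γ2 → ℝ → Euc k → ((Γ1 × Γ2) → ℝ) → ℝ → ℝ → (Fin d → ℝ) → ℝ :=
  fun ij t x vv dtφ Lφ zφ =>
    max (vv ij - upperObst gUp ij.1 ij.2 t x vv)
      (min (vv ij - lowerObst gLow ij.1 ij.2 t x vv)
        (-dtφ - Lφ - f ij.1 ij.2 t x vv zφ))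

/-- (H4), the non-free-loop property: for every loop in `Γ¹ × Γ²` (a sequence of
pairs `p 0, p 1, …, p M` with `p M = p 0`, the first `M` pairs pairwise distinct,
`M ≥ 2`, and each step leaving at least one coordinate unchanged), the sum
`∑_q φ_{i_q j_q}(t,x)` does not vanish, where
`φ_{i_q j_q} = -\underline g_{i_q i_{q+1}} 1_{i_q ≠ i_{q+1}} + \bar g_{j_q j_{q+1}} 1_{j_q ≠ j_{q+1}}`. -/
def NoFreeLoop {k : ℕ} {Γ1 Γ2 : Type} [DecidableEq Γ1] [DecidableEq Γ2]
    (T : ℝ) (gLow : Γ1 → Γ1 → ℝ → Euc k → ℝ) (gUp : Γ2 → Γ2 → ℝ → Euc k → ℝ) : Prop :=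
  ∀ M : ℕ, 2 ≤ M → ∀ p : ℕ → Γ1 × Γ2,
    p M = p 0 →
    (∀ q q', q < M → q' < M → p q = p q' → q = q') →
    (∀ q < M, (p q).1 = (p (q + 1)).1 ∨ (p q).2 = (p (q + 1)).2) →
    ∀ t ∈ Icc (0 : ℝ) T, ∀ x : Euc k,
      (∑ q ∈ Finset.range M,
        ((if (p q).1 = (p (q + 1)).1 then 0 else -gLow (p q).1 (p (q + 1)).1 t x) +
          (if (p q).2 = (p (q + 1)).2 then 0 else gUp (p q).2 (p (q + 1)).2 t x))) ≠ 0

/-- Paraboloids in `(t,x)` are of class `C^{1,2}`. -/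
theorem isC12_paraboloid {k : ℕ} (c N t₀ : ℝ) (x₀ : Euc k) :
    IsC12 fun t (x : Euc k) => c + N * ((t - t₀) ^ 2 + ‖x - x₀‖ ^ 2) := by
  have ht : ∀ (t : ℝ) (x : Euc k), HasDerivAt
      (fun s => c + N * ((s - t₀) ^ 2 + ‖x - x₀‖ ^ 2)) (N * (2 * (t - t₀))) t := by
    intro t x
    have h := ((((hasDerivAt_id t).sub_const t₀).pow 2).add_const
      (‖x - x₀‖ ^ 2)).const_mul N |>.const_add c
    exact h.congr_deriv (by simp)
  have hsmooth : ∀ t : ℝ, ContDiff ℝ 2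
      (fun x : Euc k => c + N * ((t - t₀) ^ 2 + ‖x - x₀‖ ^ 2)) := fun t =>
    contDiff_const.add (contDiff_const.mul
      (contDiff_const.add ((contDiff_id.sub contDiff_const).norm_sq ℝ)))
  have hx : ∀ t : ℝ, fderiv ℝ (fun x : Euc k => c + N * ((t - t₀) ^ 2 + ‖x - x₀‖ ^ 2)) =
      fun x => N • (2 : ℝ) • innerSL ℝ (x - x₀) := by
    intro t
    funext x
    have h := (((hasFDerivAt_id x).sub_const x₀).norm_sq.const_add
      ((t - t₀) ^ 2)).const_mul N |>.const_add c
    exact (h.congr_fderiv (by ext y; simp)).fderiv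
  have hxx : ∀ x : Euc k, fderiv ℝ (fun x : Euc k => N • (2 : ℝ) • innerSL ℝ (x - x₀)) x =
      N • (2 : ℝ) • innerSL ℝ := by
    intro x
    have h := (((innerSL ℝ (E := Euc k)).hasFDerivAt (x := x - x₀)).comp x
      ((hasFDerivAt_id x).sub_const x₀)).const_smul (2 : ℝ) |>.const_smul N
    exact (h.congr_fderiv (by ext y z; simp)).fderiv
  refine ⟨fun x t => (ht t x).differentiableAt, ?_, hsmooth, ?_, ?_⟩
  · simp only [(ht _ _).deriv]
    fun_prop
  · simp only [hx]
    exact (((innerSL ℝ (E := Euc k)).continuous.comp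
      (continuous_snd.sub continuous_const)).const_smul (2 : ℝ)).const_smul N
  · simp only [hx, hxx]
    exact continuous_const

/-- Near every point, a continuous function is touched from above by a paraboloid. -/
theorem exists_isLocalMax_sub_paraboloid {k : ℕ} {u : ℝ × Euc k → ℝ} (hu : Continuous u)
    (p₀ : ℝ × Euc k) {U : Set (ℝ × Euc k)} (hU : U ∈ nhds p₀) :
    ∃ p ∈ U, ∃ φ : ℝ → Euc k → ℝ, IsC12 φ ∧
      IsLocalMax (fun q : ℝ × Euc k => u q - φ q.1 q.2) p ∧ u p = φ p.1 p.2 := by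
  obtain ⟨r, hr, hrU⟩ := Metric.nhds_basis_closedBall.mem_iff.mp hU
  have hK : IsCompact (Metric.closedBall p₀ r) := isCompact_closedBall p₀ r
  obtain ⟨B, hB⟩ := hK.bddAbove_image hu.continuousOn
  have hB' : ∀ q ∈ Metric.closedBall p₀ r, u q ≤ B := fun q hq => hB ⟨q, hq, rfl⟩
  set N : ℝ := (B - u p₀ + 1) / r ^ 2
  have hNr : N * r ^ 2 = B - u p₀ + 1 := div_mul_cancel₀ _ (by positivity)
  have hN : 0 ≤ N :=
    div_nonneg (by linarith [hB' p₀ (Metric.mem_closedBall_self hr.le)]) (by positivity)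
  set Q : ℝ × Euc k → ℝ := fun q => (q.1 - p₀.1) ^ 2 + ‖q.2 - p₀.2‖ ^ 2 with hQ
  have hQc : Continuous Q := by
    simp only [hQ]
    fun_prop
  have hdist : ∀ q, dist q p₀ ^ 2 ≤ Q q := by
    intro q
    rw [Prod.dist_eq, Real.dist_eq, dist_eq_norm]
    rcases max_choice |q.1 - p₀.1| ‖q.2 - p₀.2‖ with h | h <;> rw [h] <;> simp only [hQ]
    · rw [sq_abs]
      nlinarith [sq_nonneg ‖q.2 - p₀.2‖]
    · nlinarith [sq_nonneg (q.1 - p₀.1)]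
  obtain ⟨p, hp, hmax⟩ := hK.exists_isMaxOn ⟨p₀, Metric.mem_closedBall_self hr.le⟩
    (hu.sub (hQc.const_mul N)).continuousOn
  have hmax' : ∀ q ∈ Metric.closedBall p₀ r, u q - N * Q q ≤ u p - N * Q p :=
    fun q hq => hmax hq
  have hball : p ∈ Metric.ball p₀ r := by
    by_contra h
    have hle : r ≤ dist p p₀ := not_lt.mp h
    have h1 : r ^ 2 ≤ Q p := (pow_le_pow_left₀ hr.le hle 2).trans (hdist p)
    have h2 := mul_le_mul_of_nonneg_left h1 hN
    have h3 := hmax' p₀ (Metric.mem_closedBall_self hr.le)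
    have h4 : Q p₀ = 0 := by simp [hQ]
    rw [h4] at h3
    linarith [hB' p hp]
  refine ⟨p, hrU hp, _, isC12_paraboloid (u p - N * Q p) N p₀.1 p₀.2, ?_, ?_⟩
  · filter_upwards [Metric.isOpen_ball.mem_nhds hball] with q hq
    have := hmax' q (Metric.ball_subset_closedBall hq)
    simp only [hQ] at this ⊢
    linarith
  · simp only [hQ]
    ring

/-- Near every point, a continuous function is touched from below by a paraboloid. -/
theorem exists_isLocalMin_sub_paraboloid {k : ℕ} {u : ℝ × Euc k → ℝ} (hu : Continuous u)
    (p₀ : ℝ × Euc k) {U : Set (ℝ × Euc k)} (hU : U ∈ nhds p₀) :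
    ∃ p ∈ U, ∃ φ : ℝ → Euc k → ℝ, IsC12 φ ∧
      IsLocalMin (fun q : ℝ × Euc k => u q - φ q.1 q.2) p ∧ u p = φ p.1 p.2 := by
  obtain ⟨p, hp, φ, ⟨h1, h2, h3, h4, h5⟩, hmax, heq⟩ :=
    exists_isLocalMax_sub_paraboloid hu.neg p₀ hU
  simp only [Pi.neg_apply] at hmax heq
  have hfd : ∀ t, fderiv ℝ (fun x => -φ t x) = fun x => -fderiv ℝ (φ t) x :=
    fun t => funext fun x => fderiv_fun_neg
  refine ⟨p, hp, fun t x => -φ t x, ⟨fun x => (h1 x).neg, ?_, fun t => (h3 t).neg, ?_, ?_⟩,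
    ?_, by linarith⟩
  · simp only [deriv.fun_neg]
    exact h2.neg
  · simp only [hfd]
    exact h4.neg
  · simp only [hfd, fderiv_fun_neg]
    exact h5.neg
  · filter_upwards [hmax] with q hq
    linarith

/-- A closed set meeting every neighbourhood of every point of `(0,T) × ℝ^k` inside
`(0,T) × ℝ^k` contains `[0,T] × ℝ^k`. -/
theorem mem_of_isClosed_of_forall_nhds {k : ℕ} {T : ℝ} (hT : 0 < T) {C : Set (ℝ × Euc k)}
    (hC : IsClosed C)
    (h : ∀ p : ℝ × Euc k, ∀ U ∈ nhds p, ∃ q ∈ U, q.1 ∈ Ioo (0 : ℝ) T → q ∈ C)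
    {t : ℝ} (ht : t ∈ Icc (0 : ℝ) T) (x : Euc k) : (t, x) ∈ C := by
  have hsub : Ioo (0 : ℝ) T ×ˢ (univ : Set (Euc k)) ⊆ C := by
    intro p hp
    rw [← hC.closure_eq, mem_closure_iff_nhds]
    intro U hU
    obtain ⟨q, ⟨hqU, hq⟩, hqC⟩ :=
      h p _ (Filter.inter_mem hU ((isOpen_Ioo.prod isOpen_univ).mem_nhds hp))
    exact ⟨q, hqU, hqC hq.1⟩
  refine closure_minimal hsub hC ?_
  rw [closure_prod_eq, closure_Ioo hT.ne, closure_univ]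
  exact ⟨ht, mem_univ x⟩

/-- A sequence with values in a finite type contains a simple loop. -/
theorem exists_simple_loop {α : Type*} [Finite α] (s : ℕ → α) :
    ∃ m M : ℕ, 0 < M ∧ s (m + M) = s m ∧
      ∀ q q', q < M → q' < M → s (m + q) = s (m + q') → q = q' := by
  classical
  have hex : ∃ M, 0 < M ∧ ∃ m, s (m + M) = s m := by
    obtain ⟨a, b, hab, he⟩ := Finite.exists_ne_map_eq_of_infinite s
    rcases lt_or_gt_of_ne hab with h | h
    · exact ⟨b - a, by omega, a, by rw [Nat.add_sub_cancel' h.le, he]⟩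
    · exact ⟨a - b, by omega, b, by rw [Nat.add_sub_cancel' h.le, he]⟩
  obtain ⟨hpos, m, hm⟩ := Nat.find_spec hex
  refine ⟨m, Nat.find hex, hpos, hm, ?_⟩
  have key : ∀ q q', q < q' → q' < Nat.find hex → s (m + q) ≠ s (m + q') := by
    intro q q' hlt hq' he
    refine Nat.find_min hex (m := q' - q) (by omega) ⟨by omega, m + q, ?_⟩
    rw [he]
    congr 1
    omega
  intro q q' hq hq' he
  rcases lt_trichotomy q q' with h | h | h
  · exact absurd he (key q q' h hq')
  · exact h
  · exact absurd he.symm (key q' q h hq)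

theorem continuous_lowerObst {k : ℕ} {Γ1 Γ2 : Type} [Fintype Γ1] [DecidableEq Γ1]
    [Nontrivial Γ1] {gLow : Γ1 → Γ1 → ℝ → Euc k → ℝ} {v : Γ1 × Γ2 → ℝ → Euc k → ℝ}
    (hg : ∀ i i' : Γ1, Continuous fun p : ℝ × Euc k => gLow i i' p.1 p.2)
    (hv : ∀ ij, Continuous fun p : ℝ × Euc k => v ij p.1 p.2) (i : Γ1) (j : Γ2) :
    Continuous fun p : ℝ × Euc k => lowerObst gLow i j p.1 p.2 (fun kl => v kl p.1 p.2) := by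
  unfold lowerObst
  exact Continuous.finset_sup'_apply _ fun kk _ => (hv (kk, j)).sub (hg i kk)

theorem continuous_upperObst {k : ℕ} {Γ1 Γ2 : Type} [Fintype Γ2] [DecidableEq Γ2]
    [Nontrivial Γ2] {gUp : Γ2 → Γ2 → ℝ → Euc k → ℝ} {v : Γ1 × Γ2 → ℝ → Euc k → ℝ}
    (hg : ∀ j j' : Γ2, Continuous fun p : ℝ × Euc k => gUp j j' p.1 p.2)
    (hv : ∀ ij, Continuous fun p : ℝ × Euc k => v ij p.1 p.2) (i : Γ1) (j : Γ2) :
    Continuous fun p : ℝ × Euc k => upperObst gUp i j p.1 p.2 (fun kl => v kl p.1 p.2) := by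
  unfold upperObst
  exact Continuous.finset_inf'_apply _ fun l _ => (hv (i, l)).add (hg j l)

/-- If the lower barrier holds everywhere and each component either touches its lower barrier
or is below its upper barrier, then absence of free loops in the first index gives the upper
barrier. -/
theorem le_upperObst_of_noFreeLoop {k : ℕ} {Γ1 Γ2 : Type} [Fintype Γ1] [Fintype Γ2]
    [DecidableEq Γ1] [DecidableEq Γ2] [Nontrivial Γ1] [Nontrivial Γ2] {T : ℝ}
    {gLow : Γ1 → Γ1 → ℝ → Euc k → ℝ} {gUp : Γ2 → Γ2 → ℝ → Euc k → ℝ}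
    (hnfl : NoFreeLoop T gLow gUp) {t : ℝ} (ht : t ∈ Icc (0 : ℝ) T) (x : Euc k)
    {y : Γ1 × Γ2 → ℝ} (hlow : ∀ i j, lowerObst gLow i j t x y ≤ y (i, j))
    (hor : ∀ i j, y (i, j) ≤ lowerObst gLow i j t x y ∨ y (i, j) ≤ upperObst gUp i j t x y)
    (i : Γ1) (j : Γ2) : y (i, j) ≤ upperObst gUp i j t x y := by
  have hlow' : ∀ i j kk, kk ≠ i → y (kk, j) - gLow i kk t x ≤ y (i, j) := fun i j kk hkk =>
    (Finset.le_sup' (fun kk => y (kk, j) - gLow i kk t x)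
      (Finset.mem_erase.mpr ⟨hkk, Finset.mem_univ kk⟩)).trans (hlow i j)
  refine Finset.le_inf' _ _ fun l hl => ?_
  by_contra hcon
  let Bad : Γ1 → Prop := fun i => y (i, l) + gUp j l t x < y (i, j)
  have hstep : ∀ a : {i // Bad i}, ∃ a' : {i // Bad i},
      a'.1 ≠ a.1 ∧ y (a.1, j) = y (a'.1, j) - gLow a.1 a'.1 t x := by
    rintro ⟨a, ha⟩
    have hupper : upperObst gUp a j t x y ≤ y (a, l) + gUp j l t x :=
      Finset.inf'_le (fun l => y (a, l) + gUp j l t x) hl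
    have hle : y (a, j) ≤ lowerObst gLow a j t x y :=
      (hor a j).resolve_right fun h => absurd (h.trans hupper) (not_le.mpr ha)
    obtain ⟨a', ha', heq⟩ := Finset.exists_mem_eq_sup' (s := Finset.univ.erase a)
      ((exists_ne a).imp fun _ h => Finset.mem_erase.mpr ⟨h, Finset.mem_univ _⟩)
      (fun kk => y (kk, j) - gLow a kk t x)
    have hne : a' ≠ a := (Finset.mem_erase.mp ha').1
    have heq' : y (a, j) = y (a', j) - gLow a a' t x :=
      le_antisymm (hle.trans heq.le) (hlow' a j a' hne)
    refine ⟨⟨a', ?_⟩, hne, heq'⟩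
    have := hlow' a l a' hne
    simp only [Bad] at ha ⊢
    linarith
  choose next hnext hval using hstep
  let s : ℕ → {i // Bad i} := fun n => next^[n] ⟨i, not_le.mp hcon⟩
  have hs : ∀ n, s (n + 1) = next (s n) := fun n => Function.iterate_succ_apply' _ _ _
  obtain ⟨m, M, hM, hloop, hinj⟩ := exists_simple_loop s
  have hM2 : 2 ≤ M := by
    by_contra h
    obtain rfl : M = 1 := by omega
    rw [hs] at hloop
    exact hnext _ (congrArg Subtype.val hloop)
  refine hnfl M hM2 (fun q => ((s (m + q)).1, j)) ?_ ?_ (fun _ _ => Or.inr rfl) t ht x ?_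
  · simp [hloop]
  · intro q q' hq hq' he
    exact hinj q q' hq hq' (Subtype.ext (congrArg Prod.fst he))
  · have hterm : ∀ q, ((if (s (m + q)).1 = (s (m + (q + 1))).1 then 0
          else -gLow (s (m + q)).1 (s (m + (q + 1))).1 t x) +
        (if j = j then 0 else gUp j j t x)) =
        y ((s (m + q)).1, j) - y ((s (m + (q + 1))).1, j) := by
      intro q
      have hq : s (m + (q + 1)) = next (s (m + q)) := hs (m + q)
      rw [hq, if_neg (hnext _).symm, if_pos rfl, hval (s (m + q))]
      ring
    rw [Finset.sum_congr rfl fun q _ => hterm q,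
      Finset.sum_range_sub' (fun q => y ((s (m + q)).1, j)) M, hloop, add_zero, sub_self]

/-- **Step 3 of the proof of Theorem 3.1**: under (H0)-(H5), the unique continuous
polynomial-growth viscosity solution `\bar v` of the min-max system lies between the two
inter-connected barriers: for every `(i,j)` and every `(t₀,x₀) ∈ [0,T] × ℝ^k`,
`L^{ij}(\vec{\bar v})(t₀,x₀) ≤ \bar v^{ij}(t₀,x₀) ≤ U^{ij}(\vec{\bar v})(t₀,x₀)`. -/
theorem minmax_solution_between_barriers
    {k d : ℕ} (hk : 1 ≤ k) (hd : 1 ≤ d) {Γ1 Γ2 : Type}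
    [Fintype Γ1] [Fintype Γ2] [DecidableEq Γ1] [DecidableEq Γ2]
    [Nontrivial Γ1] [Nontrivial Γ2]
    (T : ℝ) (hT : 0 < T)
    (b : ℝ → Euc k → Fin k → ℝ) (σm : ℝ → Euc k → Matrix (Fin k) (Fin d) ℝ)
    (f : Γ1 → Γ2 → ℝ → Euc k → ((Γ1 × Γ2) → ℝ) → (Fin d → ℝ) → ℝ)
    (hfun : Γ1 → Γ2 → Euc k → ℝ)
    (gLow : Γ1 → Γ1 → ℝ → Euc k → ℝ) (gUp : Γ2 → Γ2 → ℝ → Euc k → ℝ)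
    -- (H0): `b`, `σ` jointly continuous, Lipschitz in `x` uniformly in `t`
    (H0b : Continuous fun p : ℝ × Euc k => b p.1 p.2)
    (H0s : Continuous fun p : ℝ × Euc k => σm p.1 p.2)
    (H0lip : ∃ C : ℝ, ∀ t ∈ Icc (0 : ℝ) T, ∀ x x' : Euc k,
      (∀ i, |b t x i - b t x' i| ≤ C * ‖x - x'‖) ∧
      (∀ i l, |σm t x i l - σm t x' i l| ≤ C * ‖x - x'‖))
    -- (H1)(i): each `f^{ij}` is continuous in `(t,x)` uniformly w.r.t. `(y,z)`,
    -- and `(t,x) ↦ f^{ij}(t,x,0,0)` is of polynomial growth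
    (H1cont : ∀ (i : Γ1) (j : Γ2), ∀ t ∈ Icc (0 : ℝ) T, ∀ x : Euc k, ∀ ε > (0 : ℝ),
      ∃ η > (0 : ℝ), ∀ t' ∈ Icc (0 : ℝ) T, ∀ x' : Euc k, |t' - t| + ‖x' - x‖ < η →
        ∀ (y : (Γ1 × Γ2) → ℝ) (z : Fin d → ℝ), |f i j t' x' y z - f i j t x y z| < ε)
    (H1growth : ∀ (i : Γ1) (j : Γ2), PolyGrowth T fun t x => f i j t x 0 0)
    -- (H1)(ii): Lipschitz continuity in `(\vec y, z)` uniformly in `(t,x)`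
    (H1lip : ∃ C : ℝ, ∀ (i : Γ1) (j : Γ2) (t : ℝ) (x : Euc k)
      (y y' : (Γ1 × Γ2) → ℝ) (z z' : Fin d → ℝ),
      |f i j t x y z - f i j t x y' z'| ≤ C * (‖y - y'‖ + ‖z - z'‖))
    -- (H2): monotonicity: `f^{ij}` is nondecreasing in `y^{kl}` for `(k,l) ≠ (i,j)`
    (H2 : ∀ (i : Γ1) (j : Γ2) (kl : Γ1 × Γ2), kl ≠ (i, j) →
      ∀ (t : ℝ) (x : Euc k) (z : Fin d → ℝ) (y y' : (Γ1 × Γ2) → ℝ),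
      (∀ ab, ab ≠ kl → y ab = y' ab) → y kl ≤ y' kl → f i j t x y z ≤ f i j t x y' z)
    -- (H3): the terminal data are continuous, of polynomial growth and consistent
    (H3cont : ∀ (i : Γ1) (j : Γ2), Continuous (hfun i j))
    (H3growth : ∀ (i : Γ1) (j : Γ2), ∃ C γ : ℝ, 0 ≤ C ∧ 0 ≤ γ ∧
      ∀ x : Euc k, |hfun i j x| ≤ C * (1 + ‖x‖ ^ γ))
    (H3consist : ∀ (i : Γ1) (j : Γ2) (x : Euc k),
      (∀ kk, kk ≠ i → hfun kk j x - gLow i kk T x ≤ hfun i j x) ∧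
      (∀ l, l ≠ j → hfun i j x ≤ hfun i l x + gUp j l T x))
    -- (H4): switching costs: nonnegative, jointly continuous, polynomial growth,
    -- vanishing on the diagonal, and the non-free-loop property
    (H4lnn : ∀ (i i' : Γ1), ∀ t ∈ Icc (0 : ℝ) T, ∀ x : Euc k, 0 ≤ gLow i i' t x)
    (H4unn : ∀ (j j' : Γ2), ∀ t ∈ Icc (0 : ℝ) T, ∀ x : Euc k, 0 ≤ gUp j j' t x)
    (H4lcont : ∀ i i' : Γ1, Continuous fun p : ℝ × Euc k => gLow i i' p.1 p.2)
    (H4ucont : ∀ j j' : Γ2, Continuous fun p : ℝ × Euc k => gUp j j' p.1 p.2)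
    (H4lgrowth : ∀ i i' : Γ1, PolyGrowth T (gLow i i'))
    (H4ugrowth : ∀ j j' : Γ2, PolyGrowth T (gUp j j'))
    (H4lzero : ∀ (i : Γ1) (t : ℝ) (x : Euc k), gLow i i t x = 0)
    (H4uzero : ∀ (j : Γ2) (t : ℝ) (x : Euc k), gUp j j t x = 0)
    (H4nfl : NoFreeLoop T gLow gUp)
    -- (H5)(i): the costs `\bar g_{jl}` are `C^{1,2}` with space derivatives of
    -- polynomial growth, and satisfy the strict triangle inequality
    (H5reg : ∀ j l : Γ2, IsC12 (gUp j l))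
    (H5d1 : ∀ j l : Γ2, PolyGrowth T fun t x => ‖fderiv ℝ (gUp j l t) x‖)
    (H5d2 : ∀ j l : Γ2, PolyGrowth T fun t x => ‖fderiv ℝ (fderiv ℝ (gUp j l t)) x‖)
    (H5tri : ∀ j1 j2 j3 : Γ2, j1 ≠ j2 → j2 ≠ j3 → j1 ≠ j3 →
      ∀ t ∈ Icc (0 : ℝ) T, ∀ x : Euc k, gUp j1 j3 t x < gUp j1 j2 t x + gUp j2 j3 t x)
    -- (H5)(ii): each `f^{ij}` is bounded by `C (1 + |x|^p)`
    (H5bound : ∃ C p : ℝ, 0 ≤ C ∧ 0 ≤ p ∧ ∀ (i : Γ1) (j : Γ2), ∀ t ∈ Icc (0 : ℝ) T,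
      ∀ (x : Euc k) (y : (Γ1 × Γ2) → ℝ) (z : Fin d → ℝ),
      |f i j t x y z| ≤ C * (1 + ‖x‖ ^ p))
    -- the solution of the min-max system
    (vbar : Γ1 × Γ2 → ℝ → Euc k → ℝ)
    (hvbar : (∀ ij, Continuous fun p : ℝ × Euc k => vbar ij p.1 p.2) ∧
      (∀ ij, PolyGrowth T (vbar ij)) ∧
      IsViscSolSys T b σm (fun ij => hfun ij.1 ij.2) (FminMax f gLow gUp) vbar) :
    ∀ (i : Γ1) (j : Γ2), ∀ t0 ∈ Icc (0 : ℝ) T, ∀ x0 : Euc k,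
      lowerObst gLow i j t0 x0 (fun kl => vbar kl t0 x0) ≤ vbar (i, j) t0 x0 ∧
      vbar (i, j) t0 x0 ≤ upperObst gUp i j t0 x0 (fun kl => vbar kl t0 x0) := by
  obtain ⟨hcont, -, hsub, hsuper⟩ := hvbar
  have hlow : ∀ t ∈ Icc (0 : ℝ) T, ∀ x i j,
      lowerObst gLow i j t x (fun kl => vbar kl t x) ≤ vbar (i, j) t x := by
    intro t ht x i j
    refine mem_of_isClosed_of_forall_nhds hT
      (isClosed_le (continuous_lowerObst H4lcont hcont i j) (hcont (i, j))) ?_ ht x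
    intro p U hU
    obtain ⟨q, hqU, φ, hφ, hmin, heq⟩ := exists_isLocalMin_sub_paraboloid (hcont (i, j)) p hU
    refine ⟨q, hqU, fun hq => ?_⟩
    have h := hsuper.2 (i, j) q.1 q.2 hq φ hφ hmin heq
    exact sub_nonneg.mp (le_min_iff.mp h).1
  have hor : ∀ t ∈ Icc (0 : ℝ) T, ∀ x i j,
      vbar (i, j) t x ≤ lowerObst gLow i j t x (fun kl => vbar kl t x) ∨
        vbar (i, j) t x ≤ upperObst gUp i j t x (fun kl => vbar kl t x) := by
    intro t ht x i j
    refine mem_of_isClosed_of_forall_nhds hT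
      ((isClosed_le (hcont (i, j)) (continuous_lowerObst H4lcont hcont i j)).union
        (isClosed_le (hcont (i, j)) (continuous_upperObst H4ucont hcont i j))) ?_ ht x
    intro p U hU
    obtain ⟨q, hqU, φ, hφ, hmax, heq⟩ := exists_isLocalMax_sub_paraboloid (hcont (i, j)) p hU
    refine ⟨q, hqU, fun hq => ?_⟩
    have h := hsub.2 (i, j) q.1 q.2 hq φ hφ hmax heq
    exact (min_le_iff.mp h).imp sub_nonpos.mp fun h' => sub_nonpos.mp (max_le_iff.mp h').1
  intro i j t ht x
  exact ⟨hlow t ht x i j,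
    le_upperObst_of_noFreeLoop H4nfl ht x (hlow t ht x) (hor t ht x) i j⟩

end
end

section
/- (Theorem 5.2(ii)) Assume (H0), (A1) and (A2). The unique continuous polynomial-growth viscosity solution u of the min-max two-obstacle problem min{ u-L ; max[ u-H ; -\partial_t u-\mathcal{L}^X u-f(t,x,u,\sigma^\top D_x u) ] } = 0, u(T,\cdot)=g, is also the unique continuous polynomial-growth viscosity solution of the max-min problem max{ u-H ; min[ u-L ; -\partial_t u-\mathcal{L}^X u-f(t,x,u,\sigma^\top D_x u) ] } = 0, u(T,\cdot)=g. -/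
/- Scalar PDE with two obstacles of min-max type (Theorem 5.2(i) / Theorem `existence` (A2)).

Setting: `T > 0`, `k, d ≥ 1`.  `b, σ` satisfy (H0); data `g, f, H, L` are continuous and
satisfy (A1), (A2).  Conclusion: there exists a unique continuous viscosity solution of
polynomial growth of
  min{ u - L ; max[ u - H ; -∂_t u - 𝓛^X u - f(t,x,u,σᵀ D_x u) ] } = 0 on (0,T)×ℝ^k,
  u(T,·) = g. -/

open Set Matrix

noncomputable section

/-- Viscosity subsolution of the terminal value problem
`F(t, x, u, ∂_t u, 𝓛^X u, σᵀ D_x u) = 0` on `(0,T) × ℝ^k`, `u(T,·) = gT`. -/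
def IsViscSubsol {k d : ℕ} (T : ℝ) (b : ℝ → Euc k → Fin k → ℝ)
    (σm : ℝ → Euc k → Matrix (Fin k) (Fin d) ℝ) (gT : Euc k → ℝ)
    (F : ℝ → Euc k → ℝ → ℝ → ℝ → (Fin d → ℝ) → ℝ) (u : ℝ → Euc k → ℝ) : Prop :=
  (∀ x, u T x ≤ gT x) ∧
  ∀ t x, t ∈ Ioo (0 : ℝ) T → ∀ φ : ℝ → Euc k → ℝ, IsC12 φ →
    IsLocalMax (fun p : ℝ × Euc k => u p.1 p.2 - φ p.1 p.2) (t, x) →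
    u t x = φ t x →
    F t x (u t x) (timeDeriv φ t x) (genL b σm φ t x) (sigGrad σm φ t x) ≤ 0

/-- Viscosity supersolution. -/
def IsViscSupersol {k d : ℕ} (T : ℝ) (b : ℝ → Euc k → Fin k → ℝ)
    (σm : ℝ → Euc k → Matrix (Fin k) (Fin d) ℝ) (gT : Euc k → ℝ)
    (F : ℝ → Euc k → ℝ → ℝ → ℝ → (Fin d → ℝ) → ℝ) (u : ℝ → Euc k → ℝ) : Prop :=
  (∀ x, gT x ≤ u T x) ∧
  ∀ t x, t ∈ Ioo (0 : ℝ) T → ∀ φ : ℝ → Euc k → ℝ, IsC12 φ →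
    IsLocalMin (fun p : ℝ × Euc k => u p.1 p.2 - φ p.1 p.2) (t, x) →
    u t x = φ t x →
    0 ≤ F t x (u t x) (timeDeriv φ t x) (genL b σm φ t x) (sigGrad σm φ t x)

/-- Viscosity solution: both a subsolution and a supersolution. -/
def IsViscSol {k d : ℕ} (T : ℝ) (b : ℝ → Euc k → Fin k → ℝ)
    (σm : ℝ → Euc k → Matrix (Fin k) (Fin d) ℝ) (gT : Euc k → ℝ)
    (F : ℝ → Euc k → ℝ → ℝ → ℝ → (Fin d → ℝ) → ℝ) (u : ℝ → Euc k → ℝ) : Prop :=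
  IsViscSubsol T b σm gT F u ∧ IsViscSupersol T b σm gT F u

/-- The min-max two obstacles expression
`min{ u - L ; max[ u - H ; -∂_t u - 𝓛^X u - f(t,x,u,σᵀD_x u) ] }`. -/
noncomputable def Fmm {k d : ℕ} (f : ℝ → Euc k → ℝ → (Fin d → ℝ) → ℝ)
    (Lf Hf : ℝ → Euc k → ℝ) : ℝ → Euc k → ℝ → ℝ → ℝ → (Fin d → ℝ) → ℝ :=
  fun t x uv dtφ Lφ zφ =>
    min (uv - Lf t x) (max (uv - Hf t x) (-dtφ - Lφ - f t x uv zφ))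

/-- The max-min two obstacles expression
`max{ u - H ; min[ u - L ; -∂_t u - 𝓛^X u - f(t,x,u,σᵀD_x u) ] }`. -/
noncomputable def FMm {k d : ℕ} (f : ℝ → Euc k → ℝ → (Fin d → ℝ) → ℝ)
    (Lf Hf : ℝ → Euc k → ℝ) : ℝ → Euc k → ℝ → ℝ → ℝ → (Fin d → ℝ) → ℝ :=
  fun t x uv dtφ Lφ zφ =>
    max (uv - Hf t x) (min (uv - Lf t x) (-dtφ - Lφ - f t x uv zφ))

section ContactSets

open Filter Topology MeasureTheory InnerProductSpace

variable {E : Type*} [NormedAddCommGroup E] [InnerProductSpace ℝ E]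

/-- On `K`, the function `φ` lies between two paraboloids of opening `C` with gradient `p`. -/
def IsParaboloidTouched (φ : E → ℝ) (C : ℝ) (K : Set E) (p : E → E) : Prop :=
  ∀ z ∈ K, ∀ z', |φ z' - φ z - inner ℝ (p z) (z' - z)| ≤ C * ‖z' - z‖ ^ 2

theorem IsParaboloidTouched.lipschitzOnWith {φ : E → ℝ} {C : ℝ} {K : Set E} {p : E → E}
    (h : IsParaboloidTouched φ C K p) (hC : 0 < C) : LipschitzOnWith (6 * C).toNNReal p K := by
  refine LipschitzOnWith.of_dist_le_mul fun z₁ h₁ z₂ h₂ => ?_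
  rw [Real.coe_toNNReal _ (by positivity), dist_eq_norm, dist_eq_norm]
  set s : ℝ := (6 * C)⁻¹ with hs
  have hsC : s * C = 1 / 6 := by rw [hs]; field_simp
  have hspos : 0 < s := by positivity
  set Δ := p z₁ - p z₂ with hΔ
  set e := z₁ - z₂ with he
  have a1 := abs_le.1 (h z₂ h₂ (z₂ + s • Δ))
  have a2 := abs_le.1 (h z₁ h₁ (z₂ + s • Δ))
  have a3 := abs_le.1 (h z₁ h₁ z₂)
  have e1 : z₂ + s • Δ - z₂ = s • Δ := by abel
  have e2 : z₂ + s • Δ - z₁ = s • Δ - e := by rw [he]; abel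
  have e3 : z₂ - z₁ = -e := by rw [he]; abel
  rw [e1] at a1
  rw [e2] at a2
  rw [e3] at a3
  rw [inner_sub_right, inner_smul_right] at a2
  rw [inner_smul_right] at a1
  rw [inner_neg_right, norm_neg] at a3
  have n1 : ‖s • Δ‖ ^ 2 = s ^ 2 * ‖Δ‖ ^ 2 := by
    rw [norm_smul, mul_pow, Real.norm_eq_abs, sq_abs]
  have n2 : ‖s • Δ - e‖ ^ 2 ≤ 2 * (s ^ 2 * ‖Δ‖ ^ 2) + 2 * ‖e‖ ^ 2 := by
    rw [← n1]
    have := parallelogram_law_with_norm ℝ (s • Δ) e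
    nlinarith [sq_nonneg ‖s • Δ + e‖]
  have n3 : inner ℝ (p z₁) Δ - inner ℝ (p z₂) Δ = ‖Δ‖ ^ 2 := by
    rw [← inner_sub_left, ← hΔ, real_inner_self_eq_norm_sq]
  rw [n1] at a1
  have key : s * ‖Δ‖ ^ 2 ≤ 3 * C * (s ^ 2 * ‖Δ‖ ^ 2 + ‖e‖ ^ 2) := by
    have := mul_le_mul_of_nonneg_left n2 hC.le
    have n4 : s * ‖Δ‖ ^ 2 = s * inner ℝ (p z₁) Δ - s * inner ℝ (p z₂) Δ := by
      rw [← n3, mul_sub]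
    nlinarith [a1.1, a1.2, a2.1, a2.2, a3.1, a3.2]
  have h6 : ‖Δ‖ ^ 2 ≤ (6 * C * ‖e‖) ^ 2 := by
    have e4 : 3 * C * (s ^ 2 * ‖Δ‖ ^ 2) = s * ‖Δ‖ ^ 2 / 2 := by
      calc _ = 3 * (s * C) * s * ‖Δ‖ ^ 2 := by ring
        _ = _ := by rw [hsC]; ring
    have e5 : s * ‖Δ‖ ^ 2 ≤ 6 * C * ‖e‖ ^ 2 := by nlinarith
    have := mul_le_mul_of_nonneg_left e5 (show (0:ℝ) ≤ 6 * C by positivity)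
    calc ‖Δ‖ ^ 2 = 6 * (s * C) * ‖Δ‖ ^ 2 := by rw [hsC]; ring
      _ = 6 * C * (s * ‖Δ‖ ^ 2) := by ring
      _ ≤ _ := this
      _ = _ := by ring
  exact le_of_sq_le_sq h6 (by positivity)

theorem measure_ne_zero_of_lipschitzOnWith [FiniteDimensional ℝ E] [MeasurableSpace E]
    [BorelSpace E] {K : Set E} {p : E → E} {C : NNReal} (h : LipschitzOnWith C p K)
    {δ : ℝ} (hδ : 0 < δ) (hs : Metric.ball 0 δ ⊆ p '' K) :
    μH[Module.finrank ℝ E] K ≠ 0 := by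
  intro h0
  have h1 := h.hausdorffMeasure_image_le (d := Module.finrank ℝ E) (by positivity)
  rw [h0, mul_zero] at h1
  have h2 : μH[Module.finrank ℝ E] (Metric.ball (0 : E) δ) = 0 :=
    le_antisymm ((measure_mono hs).trans h1) bot_le
  exact (Metric.measure_ball_pos _ _ hδ).ne' h2

/-- Near a density point of `K`, the set `K` is asymptotically dense at every scale. -/
theorem eventually_exists_mem_of_density [FiniteDimensional ℝ E] [MeasurableSpace E]
    [BorelSpace E] (μ : Measure E) [μ.IsAddHaarMeasure] {K : Set E} {z : E}
    (hz : Tendsto (fun r => μ (K ∩ Metric.closedBall z r) / μ (Metric.closedBall z r))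
      (𝓝[>] 0) (𝓝 1)) {η : ℝ} (hη : 0 < η) :
    ∀ᶠ r in 𝓝[>] (0 : ℝ), ∀ y, ‖y - z‖ ≤ r → ∃ k ∈ K, ‖k - y‖ ≤ η * r := by
  set c : ℝ := (1 + η)⁻¹ * η with hc
  have hcpos : 0 < c := by positivity
  set n := Module.finrank ℝ E
  set q : ENNReal := ENNReal.ofReal (c ^ n) with hq
  have hq0 : q ≠ 0 := by rw [hq]; simpa using pow_pos hcpos n
  have hlt : 1 - q < 1 := ENNReal.sub_lt_self (by simp) (by simp) hq0
  have hlim : Tendsto (fun r : ℝ => (1 + η) * r) (𝓝[>] 0) (𝓝[>] 0) := by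
    refine tendsto_nhdsWithin_iff.2 ⟨?_, ?_⟩
    · have : Tendsto (fun r : ℝ => (1 + η) * r) (𝓝 0) (𝓝 ((1 + η) * 0)) :=
        (continuous_const.mul continuous_id : Continuous fun r : ℝ => (1 + η) * r).tendsto 0
      rw [mul_zero] at this
      exact this.mono_left nhdsWithin_le_nhds
    · filter_upwards [self_mem_nhdsWithin] with r hr
      exact mul_pos (show 0 < 1 + η by positivity) (mem_Ioi.1 hr)
  filter_upwards [(hz.comp hlim).eventually (lt_mem_nhds hlt), self_mem_nhdsWithin] with r hr hr0 y hy
  have hr0 : 0 < r := hr0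
  by_contra! hcon
  have hR : 0 < (1 + η) * r := by positivity
  have hsub : K ∩ Metric.closedBall z ((1 + η) * r) ⊆
      Metric.closedBall z ((1 + η) * r) \ Metric.closedBall y (η * r) := by
    rintro k ⟨hk, hk'⟩
    refine ⟨hk', fun hk2 => ?_⟩
    rw [Metric.mem_closedBall, dist_eq_norm] at hk2
    exact absurd hk2 (not_le.2 (hcon k hk))
  have hsub2 : Metric.closedBall y (η * r) ⊆ Metric.closedBall z ((1 + η) * r) := by
    refine Metric.closedBall_subset_closedBall' ?_
    rw [dist_eq_norm]; linarith
  have hfin : μ (Metric.closedBall z ((1 + η) * r)) ≠ ⊤ := measure_closedBall_lt_top.ne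
  have hpos : μ (Metric.closedBall z ((1 + η) * r)) ≠ 0 :=
    (Metric.measure_closedBall_pos _ _ hR).ne'
  have hy' : μ (Metric.closedBall y (η * r)) = q * μ (Metric.closedBall z ((1 + η) * r)) := by
    rw [Measure.addHaar_closedBall' μ y (by positivity),
      Measure.addHaar_closedBall' μ z (by positivity), ← mul_assoc, hq,
      ← ENNReal.ofReal_mul (by positivity), ← mul_pow]
    congr 3
    rw [hc]; field_simp
  have hle : μ (K ∩ Metric.closedBall z ((1 + η) * r)) ≤
      (1 - q) * μ (Metric.closedBall z ((1 + η) * r)) := by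
    refine (measure_mono hsub).trans ?_
    rw [measure_sdiff hsub2 measurableSet_closedBall.nullMeasurableSet
      measure_closedBall_lt_top.ne, hy', ENNReal.sub_mul (fun _ _ => hfin), one_mul]
  have := ENNReal.div_le_of_le_mul hle
  exact absurd hr (not_lt.2 this)


/-- A function touched by paraboloids on `K` has a second order expansion at every density point
of `K` at which the gradient is differentiable relative to `K`. -/
theorem IsParaboloidTouched.second_order [FiniteDimensional ℝ E] [MeasurableSpace E]
    [BorelSpace E] (μ : Measure E) [μ.IsAddHaarMeasure] {φ : E → ℝ} {C : ℝ} (hC : 0 < C)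
    {K : Set E} {p : E → E} (h : IsParaboloidTouched φ C K p) {z : E} {A : E →L[ℝ] E}
    (hz : Tendsto (fun r => μ (K ∩ Metric.closedBall z r) / μ (Metric.closedBall z r))
      (𝓝[>] 0) (𝓝 1)) (hA : HasFDerivWithinAt p A K z) {ε : ℝ} (hε : 0 < ε) :
    ∀ᶠ v in 𝓝 (0 : E),
      |φ (z + v) - φ z - inner ℝ (p z) v - inner ℝ (A v) v / 2| ≤ ε * ‖v‖ ^ 2 := by
  obtain ⟨m, hm⟩ := exists_nat_gt ((2 * ‖A‖ + 8 * C) / (ε / 2))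
  have hm0 : (0 : ℝ) < m := lt_of_le_of_lt (by positivity) hm
  have hm1 : (1 : ℝ) ≤ m := by exact_mod_cast Nat.one_le_iff_ne_zero.2 (by rintro rfl; simp at hm0)
  set η : ℝ := 1 / m with hη
  have hηpos : 0 < η := by positivity
  have hη1 : η ≤ 1 := by rw [hη, div_le_one hm0]; exact hm1
  have hdens := eventually_exists_mem_of_density μ hz hηpos
  rw [hasFDerivWithinAt_iff_isLittleO] at hA
  have hA' := hA.def (show 0 < ε / 4 by positivity)
  rw [eventually_nhdsWithin_iff, Metric.eventually_nhds_iff] at hA'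
  obtain ⟨r₁, hr₁, hA'⟩ := hA'
  rw [eventually_nhdsWithin_iff, Metric.eventually_nhds_iff] at hdens
  obtain ⟨r₂, hr₂, hdens⟩ := hdens
  rw [Metric.eventually_nhds_iff]
  refine ⟨min (r₁ / 2) r₂, by positivity, fun v hv => ?_⟩
  rw [dist_zero_right] at hv
  rcases eq_or_ne v 0 with rfl | hv0
  · simp
  have hvpos : 0 < ‖v‖ := norm_pos_iff.2 hv0
  have hv1 : ‖v‖ < r₁ / 2 := hv.trans_le (min_le_left _ _)
  have hv2 : ‖v‖ < r₂ := hv.trans_le (min_le_right _ _)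
  have hd := hdens (y := ‖v‖) (by rw [dist_zero_right, norm_norm]; exact hv2) hvpos
  set G : ℝ → ℝ := fun t => φ (z + t • v) - t * inner ℝ (p z) v - t ^ 2 * (inner ℝ (A v) v / 2)
    with hG
  have hstep : ∀ t, 0 ≤ t → t + η ≤ 1 →
      |G (t + η) - G t| ≤ η * (ε / 2 + (2 * ‖A‖ + 8 * C) * η) * ‖v‖ ^ 2 := by
    intro t ht ht1
    have hty : ‖z + t • v - z‖ ≤ ‖v‖ := by
      rw [add_sub_cancel_left, norm_smul, Real.norm_eq_abs, abs_of_nonneg ht]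
      nlinarith
    obtain ⟨k, hkK, hk⟩ := hd (z + t • v) hty
    set e := k - (z + t • v) with he
    have hkz : k - z = t • v + e := by rw [he]; abel
    have hkz' : ‖k - z‖ ≤ 2 * ‖v‖ := by
      calc ‖k - z‖ = ‖e + (z + t • v - z)‖ := by rw [he]; congr 1; abel
        _ ≤ ‖e‖ + ‖z + t • v - z‖ := norm_add_le _ _
        _ ≤ 1 * ‖v‖ + ‖v‖ := add_le_add (hk.trans (by gcongr)) hty
        _ = _ := by ring
    have hpk := hA' (y := k) (by rw [dist_eq_norm]; linarith) hkK
    rw [hkz, map_add, map_smul, ← hkz] at hpk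
    set R := p k - p z - (t • A v + A e) with hR
    have hpk' : p k = p z + t • A v + A e + R := by rw [hR]; abel
    have hRle : ‖R‖ ≤ ε / 2 * ‖v‖ := by nlinarith [norm_nonneg R]
    have hAe : ‖A e‖ ≤ ‖A‖ * (η * ‖v‖) :=
      (A.le_opNorm e).trans (mul_le_mul_of_nonneg_left hk (norm_nonneg _))
    have b1 := h k hkK (z + t • v)
    have b2 := h k hkK (z + (t + η) • v)
    have e1 : z + t • v - k = -e := by rw [he]; abel
    have e2 : z + (t + η) • v - k = η • v - e := by rw [he, add_smul]; abel
    rw [e1, norm_neg, inner_neg_right] at b1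
    rw [e2, inner_sub_right, inner_smul_right] at b2
    have n1 : ‖e‖ ^ 2 ≤ η ^ 2 * ‖v‖ ^ 2 := by
      rw [← mul_pow]; exact pow_le_pow_left₀ (norm_nonneg _) hk 2
    have n2 : ‖η • v - e‖ ^ 2 ≤ 4 * (η ^ 2 * ‖v‖ ^ 2) := by
      have : ‖η • v - e‖ ≤ 2 * (η * ‖v‖) := by
        refine (norm_sub_le _ _).trans ?_
        rw [norm_smul, Real.norm_eq_abs, abs_of_pos hηpos]; linarith
      calc _ ≤ (2 * (η * ‖v‖)) ^ 2 := pow_le_pow_left₀ (norm_nonneg _) this 2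
        _ = _ := by ring
    have i1 : inner ℝ (p k) v = inner ℝ (p z) v + t * inner ℝ (A v) v + inner ℝ (A e) v +
        inner ℝ R v := by
      rw [hpk', inner_add_left, inner_add_left, inner_add_left, real_inner_smul_left]
    have i2 : |inner ℝ (A e) v| ≤ ‖A‖ * η * ‖v‖ ^ 2 := by
      refine (abs_real_inner_le_norm _ _).trans ?_
      nlinarith [mul_le_mul_of_nonneg_right hAe hvpos.le]
    have i3 : |inner ℝ R v| ≤ ε / 2 * ‖v‖ ^ 2 := by
      refine (abs_real_inner_le_norm _ _).trans ?_
      nlinarith [mul_le_mul_of_nonneg_right hRle hvpos.le]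
    have i4 : |inner ℝ (A v) v| ≤ ‖A‖ * ‖v‖ ^ 2 := by
      refine (abs_real_inner_le_norm _ _).trans ?_
      nlinarith [mul_le_mul_of_nonneg_right (A.le_opNorm v) hvpos.le]
    have hC1 := mul_le_mul_of_nonneg_left n1 hC.le
    have hC2 := mul_le_mul_of_nonneg_left n2 hC.le
    have key : G (t + η) - G t =
        (φ (z + (t + η) • v) - φ k - (η * inner ℝ (p k) v - inner ℝ (p k) e))
        - (φ (z + t • v) - φ k - -inner ℝ (p k) e)
        + η * inner ℝ (A e) v + η * inner ℝ R v - η ^ 2 * (inner ℝ (A v) v / 2) := by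
      simp only [hG]
      rw [i1]; ring
    rw [key]
    have j2 : |η * inner ℝ (A e) v| ≤ η * (‖A‖ * η * ‖v‖ ^ 2) := by
      rw [abs_mul, abs_of_pos hηpos]; gcongr
    have j3 : |η * inner ℝ R v| ≤ η * (ε / 2 * ‖v‖ ^ 2) := by
      rw [abs_mul, abs_of_pos hηpos]; gcongr
    have j4 : |η ^ 2 * (inner ℝ (A v) v / 2)| ≤ η ^ 2 * (‖A‖ * ‖v‖ ^ 2) := by
      rw [abs_mul, abs_of_pos (by positivity : 0 < η ^ 2), abs_div, abs_two]
      gcongr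
      linarith [abs_nonneg (inner ℝ (A v) v)]
    have hslack : 0 ≤ C * (η ^ 2 * ‖v‖ ^ 2) := by positivity
    rw [abs_le] at b1 b2 j2 j3 j4 ⊢
    constructor
    · linarith [b1.1, b1.2, b2.1, b2.2, j2.1, j3.1, j4.2]
    · linarith [b1.1, b1.2, b2.1, b2.2, j2.2, j3.2, j4.1]
  have hmη : (m : ℝ) * η = 1 := by rw [hη]; field_simp
  have htel : G 1 - G 0 = ∑ i ∈ Finset.range m, (G (i * η + η) - G (i * η)) := by
    have := Finset.sum_range_sub (fun i : ℕ => G (i * η)) m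
    simp only [hmη, Nat.cast_zero, zero_mul] at this
    rw [← this]
    refine Finset.sum_congr rfl fun i _ => ?_
    push_cast
    ring_nf
  have hsum : |G 1 - G 0| ≤ (ε / 2 + (2 * ‖A‖ + 8 * C) * η) * ‖v‖ ^ 2 := by
    rw [htel]
    refine (Finset.abs_sum_le_sum_abs _ _).trans ?_
    refine (Finset.sum_le_sum (fun (i : ℕ) hi =>
      hstep ((i : ℝ) * η) (by positivity) ?_)).trans ?_
    · have : (i : ℝ) + 1 ≤ m := by exact_mod_cast Finset.mem_range.1 hi
      nlinarith
    · rw [Finset.sum_const, Finset.card_range, nsmul_eq_mul]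
      calc (m : ℝ) * (η * (ε / 2 + (2 * ‖A‖ + 8 * C) * η) * ‖v‖ ^ 2)
          = (m * η) * ((ε / 2 + (2 * ‖A‖ + 8 * C) * η) * ‖v‖ ^ 2) := by ring
        _ ≤ _ := by rw [hmη, one_mul]
  have hfin : (2 * ‖A‖ + 8 * C) * η ≤ ε / 2 := by
    rw [div_lt_iff₀ (by positivity)] at hm
    rw [hη, mul_one_div, div_le_iff₀ hm0]; linarith
  have hG10 : G 1 - G 0 = φ (z + v) - φ z - inner ℝ (p z) v - inner ℝ (A v) v / 2 := by
    simp only [hG, one_smul, zero_smul, add_zero]; ring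
  rw [← hG10]
  refine hsum.trans ?_
  gcongr
  linarith

end ContactSets

section TheoremOnSums

open Filter Topology MeasureTheory

variable {E : Type*} [NormedAddCommGroup E] [InnerProductSpace ℝ E]

theorem eq_zero_of_forall_inner_add_sq_nonneg {v : E} {C : ℝ} (hC : 0 < C)
    (h : ∀ e, 0 ≤ inner ℝ v e + C * ‖e‖ ^ 2) : v = 0 := by
  have h1 := h (-(2 * C)⁻¹ • v)
  rw [inner_smul_right, real_inner_self_eq_norm_sq, norm_smul, mul_pow, Real.norm_eq_abs,
    sq_abs] at h1
  have h2 : -(2 * C)⁻¹ * ‖v‖ ^ 2 + C * ((-(2 * C)⁻¹) ^ 2 * ‖v‖ ^ 2) = -((4 * C)⁻¹ * ‖v‖ ^ 2) := by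
    field_simp; ring
  rw [h2] at h1
  by_contra hv
  have : 0 < (4 * C)⁻¹ * ‖v‖ ^ 2 := by have := norm_pos_iff.2 hv; positivity
  linarith

theorem inner_apply_self_le_of_eventually {A : E →L[ℝ] E} {C : ℝ}
    (h : ∀ᶠ v in 𝓝 (0 : E), inner ℝ (A v) v ≤ C * ‖v‖ ^ 2) (v : E) :
    inner ℝ (A v) v ≤ C * ‖v‖ ^ 2 := by
  have h1 : Tendsto (fun t : ℝ => t • v) (𝓝[>] 0) (𝓝 0) := by
    have : Tendsto (fun t : ℝ => t • v) (𝓝 0) (𝓝 ((0 : ℝ) • v)) :=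
      (by fun_prop : Continuous fun t : ℝ => t • v).tendsto 0
    rw [zero_smul] at this
    exact this.mono_left nhdsWithin_le_nhds
  obtain ⟨t, ht, ht0⟩ := ((h1.eventually h).and self_mem_nhdsWithin).exists
  have ht0 : 0 < t := ht0
  rw [map_smul, real_inner_smul_left, inner_smul_right, norm_smul, mul_pow, Real.norm_eq_abs,
    sq_abs] at ht
  have : t ^ 2 * inner ℝ (A v) v ≤ t ^ 2 * (C * ‖v‖ ^ 2) := by nlinarith
  exact le_of_mul_le_mul_left this (by positivity)

/-- The infimal convolution of a quadratic form with `‖·‖ ^ 2` is attained along a linear map. -/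
theorem exists_optimal_infConvolution [FiniteDimensional ℝ E] {X : E →L[ℝ] E}
    (hs : ∀ a b, inner ℝ (X a) b = inner ℝ a (X b)) {c : ℝ} (hc : 0 < c)
    (hX : ∀ h, (c - 2) * ‖h‖ ^ 2 ≤ inner ℝ (X h) h) :
    ∃ S : E →L[ℝ] E, (∀ a b, inner ℝ (S a) b = inner ℝ a (S b)) ∧
      (∀ a, inner ℝ (X (S a)) (S a) / 2 + ‖a - S a‖ ^ 2 = ‖a‖ ^ 2 - inner ℝ (S a) a) ∧
      ∀ a h, ‖a‖ ^ 2 - inner ℝ (S a) a ≤ inner ℝ (X h) h / 2 + ‖a - h‖ ^ 2 := by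
  set T : E →L[ℝ] E := X + (2 : ℝ) • ContinuousLinearMap.id ℝ E with hT
  have hTa : ∀ a, T a = X a + (2 : ℝ) • a := fun a => by simp [hT]
  have hTpos : ∀ h, c * ‖h‖ ^ 2 ≤ inner ℝ (T h) h := fun h => by
    rw [hTa, inner_add_left, real_inner_smul_left, real_inner_self_eq_norm_sq]
    linarith [hX h]
  have hTs : ∀ a b, inner ℝ (T a) b = inner ℝ a (T b) := fun a b => by
    rw [hTa, hTa, inner_add_left, inner_add_right, hs, real_inner_smul_left, inner_smul_right]
  have hinj : Function.Injective (T : E →ₗ[ℝ] E) := by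
    rw [← LinearMap.ker_eq_bot, LinearMap.ker_eq_bot']
    intro h hh
    have h1 := hTpos h
    have hh' : T h = 0 := hh
    rw [hh', inner_zero_left] at h1
    by_contra hne
    have : 0 < c * ‖h‖ ^ 2 := by have := norm_pos_iff.2 hne; positivity
    linarith
  set e := LinearEquiv.ofInjectiveEndo (T : E →ₗ[ℝ] E) hinj with he
  set S : E →L[ℝ] E := (2 : ℝ) • LinearMap.toContinuousLinearMap (e.symm : E →ₗ[ℝ] E) with hS
  have hTS : ∀ a, T (S a) = (2 : ℝ) • a := fun a => by
    have h1 : T (e.symm a) = a := e.apply_symm_apply a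
    simp [hS, h1]
  have hSs : ∀ a b, inner ℝ (S a) b = inner ℝ a (S b) := fun a b => by
    have h1 : inner ℝ (T (S a)) (S b) = inner ℝ (S a) (T (S b)) := hTs _ _
    rw [hTS, hTS, real_inner_smul_left, inner_smul_right] at h1
    linarith
  have hQ : ∀ a h, inner ℝ (X h) h / 2 + ‖a - h‖ ^ 2 =
      inner ℝ (T h) h / 2 - 2 * inner ℝ a h + ‖a‖ ^ 2 := fun a h => by
    rw [hTa, inner_add_left, real_inner_smul_left, real_inner_self_eq_norm_sq,
      norm_sub_sq_real]
    ring
  refine ⟨S, hSs, fun a => ?_, fun a h => ?_⟩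
  · rw [hQ, hTS, real_inner_smul_left, ← hSs a a]
    linarith [real_inner_comm a (S a), hSs a a]
  · have h1 := hTpos (h - S a)
    have h2 : inner ℝ (T (h - S a)) (h - S a) =
        inner ℝ (T h) h - 4 * inner ℝ a h + 2 * inner ℝ (S a) a := by
      rw [map_sub, hTS, inner_sub_left, inner_sub_right, inner_sub_right, hTs h (S a), hTS,
        real_inner_smul_left, real_inner_smul_left, inner_smul_right, ← hSs a a,
        real_inner_comm a h]
      ring
    rw [h2] at h1
    rw [hQ]
    nlinarith [mul_nonneg hc.le (sq_nonneg ‖h - S a‖)]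

/-- Transfer of a second order upper expansion of a sup-convolution to the original function. -/
theorem exists_upper_jet_of_supConvolution [FiniteDimensional ℝ E] {U us : E → ℝ} {x z : E}
    {X : E →L[ℝ] E} (hle : ∀ᶠ x' in 𝓝 x, ∀ z', U x' ≤ us z' + ‖x' - z'‖ ^ 2)
    (heq : U x = us z + ‖x - z‖ ^ 2)
    (hexp : ∀ᶠ h in 𝓝 (0 : E),
      us (z + h) ≤ us z + inner ℝ ((2 : ℝ) • (x - z)) h + inner ℝ (X h) h / 2)
    (hs : ∀ a b, inner ℝ (X a) b = inner ℝ a (X b)) {c : ℝ} (hc : 0 < c)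
    (hX : ∀ h, (c - 2) * ‖h‖ ^ 2 ≤ inner ℝ (X h) h) :
    ∃ X' : E →L[ℝ] E, (∀ a b, inner ℝ (X' a) b = inner ℝ a (X' b)) ∧
      (∀ᶠ x' in 𝓝 x, U x' ≤ U x + inner ℝ ((2 : ℝ) • (x - z)) (x' - x) +
        inner ℝ (X' (x' - x)) (x' - x) / 2) ∧
      ∀ a h, inner ℝ (X' a) a / 2 ≤ inner ℝ (X h) h / 2 + ‖a - h‖ ^ 2 := by
  obtain ⟨S, hSs, hS1, hS2⟩ := exists_optimal_infConvolution hs hc hX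
  set X' : E →L[ℝ] E := (2 : ℝ) • (ContinuousLinearMap.id ℝ E - S) with hX'
  have hXa : ∀ a, X' a = (2 : ℝ) • (a - S a) := fun a => by simp [hX']
  have hXX : ∀ a, inner ℝ (X' a) a / 2 = ‖a‖ ^ 2 - inner ℝ (S a) a := fun a => by
    rw [hXa, real_inner_smul_left, inner_sub_left, real_inner_self_eq_norm_sq]; ring
  refine ⟨X', fun a b => ?_, ?_, fun a h => ?_⟩
  · rw [hXa, hXa, real_inner_smul_left, inner_smul_right, inner_sub_left, inner_sub_right, hSs]
  · have hlim : Tendsto (fun x' => S (x' - x)) (𝓝 x) (𝓝 0) := by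
      have : Continuous fun x' => S (x' - x) := by fun_prop
      have := this.tendsto x
      rwa [sub_self, map_zero] at this
    filter_upwards [hle, hlim.eventually hexp] with x' h1 h2
    have h3 := h1 (z + S (x' - x))
    set a := x' - x with ha
    have e1 : x' - (z + S a) = (x - z) + (a - S a) := by rw [ha]; abel
    rw [e1, norm_add_sq_real, inner_sub_right] at h3
    rw [heq, hXX, ← hS1]
    rw [real_inner_smul_left] at h2 ⊢
    linarith
  · rw [hXX]; exact hS2 a h

/-- Jensen type lemma: if `us` is semiconvex, `vs` is semiconcave and `us - vs` has a maximum point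
for every small linear perturbation, then at one of these points `us` has a second order
expansion. -/
theorem exists_second_order_at_tilted_max [FiniteDimensional ℝ E] {us vs : E → ℝ} {P Q : E → E}
    (hul : ∀ z z', us z + inner ℝ (P z) (z' - z) - ‖z' - z‖ ^ 2 ≤ us z')
    (hvl : ∀ z z', vs z' ≤ vs z + inner ℝ (Q z) (z' - z) + ‖z' - z‖ ^ 2)
    {δ : ℝ} (hδpos : 0 < δ)
    (htilt : ∀ ζ₀ : E, ‖ζ₀‖ < δ → ∃ z, ∀ z', us z' - vs z' ≤ us z - vs z + inner ℝ ζ₀ (z' - z))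
    {ε : ℝ} (hε : 0 < ε) :
    ∃ (z ζ : E) (A : E →L[ℝ] E), ‖ζ‖ ≤ δ ∧
      (∀ z', us z' - vs z' ≤ us z - vs z + inner ℝ ζ (z' - z)) ∧ P z = ζ + Q z ∧
      (∀ a b, inner ℝ (A a) b = inner ℝ a (A b)) ∧ ∀ᶠ h in 𝓝 (0 : E),
        |us (z + h) - us z - inner ℝ (P z) h - inner ℝ (A h) h / 2| ≤ ε * ‖h‖ ^ 2 := by
  let _ : MeasurableSpace E := borel E
  have _ : BorelSpace E := ⟨rfl⟩
  set K : Set E := {z | ∃ ζ : E, ‖ζ‖ ≤ δ ∧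
    ∀ z', us z' - vs z' ≤ us z - vs z + inner ℝ ζ (z' - z)} with hK
  choose! ζ hζδ hζ using (fun z (hz : z ∈ K) => hz)
  have hgrad : ∀ z ∈ K, P z = ζ z + Q z := fun z hz => by
    have h0 : ζ z + Q z - P z = 0 := by
      refine eq_zero_of_forall_inner_add_sq_nonneg (C := 2) two_pos fun e => ?_
      have h1 := hul z (z + e)
      have h2 := hvl z (z + e)
      have h3 := hζ z hz (z + e)
      rw [add_sub_cancel_left] at h1 h2 h3
      rw [inner_sub_left, inner_add_left]
      linarith
    exact (sub_eq_zero.1 h0).symm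
  have hut : IsParaboloidTouched us 1 K P := fun z hz z' => by
    have h1 := hul z z'
    have h2 := hvl z z'
    have h3 := hζ z hz z'
    have h4 : inner ℝ (P z) (z' - z) = inner ℝ (ζ z) (z' - z) + inner ℝ (Q z) (z' - z) := by
      rw [hgrad z hz, inner_add_left]
    rw [abs_le]
    constructor <;> linarith
  have hwt : IsParaboloidTouched (fun z => us z - vs z) 2 K ζ := fun z hz z' => by
    have h1 := hul z z'
    have h2 := hvl z z'
    have h3 := hζ z hz z'
    have h4 : inner ℝ (P z) (z' - z) = inner ℝ (ζ z) (z' - z) + inner ℝ (Q z) (z' - z) := by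
      rw [hgrad z hz, inner_add_left]
    have h5 := sq_nonneg ‖z' - z‖
    rw [abs_le]
    constructor <;> linarith
  have hball : Metric.ball 0 δ ⊆ ζ '' K := by
    intro ζ₀ hζ₀
    have hζ₀' : ‖ζ₀‖ < δ := by simpa using hζ₀
    obtain ⟨z, hzmax⟩ := htilt ζ₀ hζ₀'
    have hzK : z ∈ K := ⟨ζ₀, hζ₀'.le, hzmax⟩
    refine ⟨z, hzK, ?_⟩
    have h0 : ζ₀ - ζ z = 0 := by
      refine eq_zero_of_forall_inner_add_sq_nonneg (C := 2) two_pos fun e => ?_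
      have h1 := (abs_le.1 (hwt z hzK (z + e))).1
      have h2 := hzmax (z + e)
      rw [add_sub_cancel_left] at h1 h2
      rw [inner_sub_left]
      linarith
    exact (sub_eq_zero.1 h0).symm
  have hKpos := measure_ne_zero_of_lipschitzOnWith (hwt.lipschitzOnWith two_pos) hδpos hball
  set μ : Measure E := μH[Module.finrank ℝ E] with hμ
  suffices ∃ z ∈ K, ∃ A : E →L[ℝ] E, (∀ a b, inner ℝ (A a) b = inner ℝ a (A b)) ∧ ∀ᶠ h in 𝓝 (0 : E),
        |us (z + h) - us z - inner ℝ (P z) h - inner ℝ (A h) h / 2|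
          ≤ ε * ‖h‖ ^ 2 by
    obtain ⟨z, hzK, A, hA, hexp⟩ := this
    exact ⟨z, ζ z, A, hζδ z hzK, hζ z hzK, hgrad z hzK, hA, hexp⟩
  have h1 := Besicovitch.ae_tendsto_measure_inter_div μ K
  have h2 := ae_restrict_of_ae (s := K)
    ((hut.lipschitzOnWith one_pos).ae_differentiableWithinAt_of_mem (μ := μ))
  rw [← μ.restrict_apply_self, ← frequently_ae_mem_iff] at hKpos
  obtain ⟨z, hzK, hz1, hz2⟩ := (hKpos.and_eventually (h1.and h2)).exists
  obtain ⟨A, hA⟩ := hz2 hzK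
  refine ⟨z, hzK, (1 / 2 : ℝ) • (A + ContinuousLinearMap.adjoint A), fun a b => ?_, ?_⟩
  · simp only [_root_.smul_apply, _root_.add_apply,
      real_inner_smul_left, inner_smul_right, inner_add_left, inner_add_right,
      ContinuousLinearMap.adjoint_inner_left, ContinuousLinearMap.adjoint_inner_right]
    ring
  · filter_upwards [hut.second_order μ one_pos hz1 hA hε] with h hh
    have : inner ℝ (((1 / 2 : ℝ) • (A + ContinuousLinearMap.adjoint A)) h) h =
        inner ℝ (A h) h := by
      simp only [_root_.smul_apply, _root_.add_apply,
        real_inner_smul_left, inner_add_left, ContinuousLinearMap.adjoint_inner_left]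
      rw [real_inner_comm (A h) h]; ring
    rw [this]; exact hh

set_option maxHeartbeats 1000000 in
/-- Crandall–Ishii type lemma: near a maximum point of `U x - V y - ‖x - y‖ ^ 2 / 2`, there are
points where `U` and `V` have one-sided second order expansions with comparable Hessians. -/
theorem exists_jets_of_doubled_max [FiniteDimensional ℝ E] {U V : E → ℝ} {x₀ y₀ : E} {r : ℝ}
    (hr : 0 < r) (hU : ContinuousOn U (Metric.closedBall x₀ r))
    (hV : ContinuousOn V (Metric.closedBall y₀ r))
    (hmax : ∀ x ∈ Metric.closedBall x₀ r, ∀ y ∈ Metric.closedBall y₀ r,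
      U x - V y - ‖x - y‖ ^ 2 / 2 ≤ U x₀ - V y₀ - ‖x₀ - y₀‖ ^ 2 / 2) {κ : ℝ} (hκ : 0 < κ) :
    ∃ (x y p q : E) (X Y : E →L[ℝ] E), ‖x - x₀‖ ≤ κ ∧ ‖y - y₀‖ ≤ κ ∧
      ‖p - (x₀ - y₀)‖ ≤ κ ∧ ‖q - (x₀ - y₀)‖ ≤ κ ∧
      (∀ a b, inner ℝ (X a) b = inner ℝ a (X b)) ∧ (∀ a b, inner ℝ (Y a) b = inner ℝ a (Y b)) ∧
      (∀ᶠ x' in 𝓝 x, U x' ≤ U x + inner ℝ p (x' - x) + inner ℝ (X (x' - x)) (x' - x) / 2) ∧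
      (∀ᶠ y' in 𝓝 y, V y + inner ℝ q (y' - y) + inner ℝ (Y (y' - y)) (y' - y) / 2 ≤ V y') ∧
      ∀ a b, inner ℝ (X a) a - inner ℝ (Y b) b ≤ ‖a - b‖ ^ 2 + κ * (‖a‖ ^ 2 + ‖b‖ ^ 2) := by
  set ε : ℝ := min κ 1 / 4 with hε
  have hεpos : 0 < ε := by positivity
  have hεκ : 4 * ε ≤ κ := by rw [hε]; linarith [min_le_left κ 1]
  have hε1 : 4 * ε ≤ 1 := by rw [hε]; linarith [min_le_right κ 1]
  set ρ : ℝ := min (κ / 4) (r / 2) with hρ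
  have hρpos : 0 < ρ := by positivity
  set δ : ℝ := ε * ρ / 3 with hδ
  have hδpos : 0 < δ := by positivity
  set Bx := Metric.closedBall x₀ r
  set By := Metric.closedBall y₀ r
  have hx₀ : x₀ ∈ Bx := Metric.mem_closedBall_self hr.le
  have hy₀ : y₀ ∈ By := Metric.mem_closedBall_self hr.le
  have cBx : IsCompact Bx := isCompact_closedBall _ _
  have cBy : IsCompact By := isCompact_closedBall _ _
  set U' : E → ℝ := fun x => U x - ε * ‖x - x₀‖ ^ 2 with hU'
  set V' : E → ℝ := fun y => V y + ε * ‖y - y₀‖ ^ 2 with hV'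
  have cU' : ContinuousOn U' Bx := hU.sub (by fun_prop)
  have cV' : ContinuousOn V' By := hV.add (by fun_prop)
  have hξ : ∀ z, ∃ x ∈ Bx, ∀ x' ∈ Bx, U' x' - ‖x' - z‖ ^ 2 ≤ U' x - ‖x - z‖ ^ 2 := fun z => by
    obtain ⟨x, hx, hm⟩ := cBx.exists_isMaxOn ⟨x₀, hx₀⟩
      (cU'.sub (by fun_prop : ContinuousOn (fun x => ‖x - z‖ ^ 2) Bx))
    exact ⟨x, hx, fun x' hx' => hm hx'⟩
  have hυ : ∀ z, ∃ y ∈ By, ∀ y' ∈ By, V' y + ‖y - z‖ ^ 2 ≤ V' y' + ‖y' - z‖ ^ 2 := fun z => by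
    obtain ⟨y, hy, hm⟩ := cBy.exists_isMinOn ⟨y₀, hy₀⟩
      (cV'.add (by fun_prop : ContinuousOn (fun y => ‖y - z‖ ^ 2) By))
    exact ⟨y, hy, fun y' hy' => hm hy'⟩
  choose ξ hξB hξm using hξ
  choose υ hυB hυm using hυ
  set us : E → ℝ := fun z => U' (ξ z) - ‖ξ z - z‖ ^ 2 with hus
  set vs : E → ℝ := fun z => V' (υ z) + ‖υ z - z‖ ^ 2 with hvs
  have hus_le : ∀ x ∈ Bx, ∀ z, U' x - ‖x - z‖ ^ 2 ≤ us z := fun x hx z => hξm z x hx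
  have hvs_le : ∀ y ∈ By, ∀ z, vs z ≤ V' y + ‖y - z‖ ^ 2 := fun y hy z => hυm z y hy
  have hsq : ∀ a z z' : E, ‖a - z'‖ ^ 2 =
      ‖a - z‖ ^ 2 - inner ℝ ((2 : ℝ) • (a - z)) (z' - z) + ‖z' - z‖ ^ 2 := fun a z z' => by
    have e : a - z' = (a - z) - (z' - z) := by abel
    rw [e, norm_sub_sq_real, real_inner_smul_left]
  have hpar : ∀ x y z : E, ‖x - z‖ ^ 2 + ‖y - z‖ ^ 2 =
      ‖x - y‖ ^ 2 / 2 + 2 * ‖z - (1 / 2 : ℝ) • (x + y)‖ ^ 2 := fun x y z => by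
    have h1 := parallelogram_law_with_norm ℝ (x - z) (y - z)
    have e1 : (x - z) - (y - z) = x - y := by abel
    have e2 : (x - z) + (y - z) = -((2 : ℝ) • (z - (1 / 2 : ℝ) • (x + y))) := by
      module
    rw [e1, e2, norm_neg, norm_smul, Real.norm_eq_abs, abs_two] at h1
    nlinarith
  have hul : ∀ z z', us z + inner ℝ ((2 : ℝ) • (ξ z - z)) (z' - z) - ‖z' - z‖ ^ 2 ≤ us z' :=
    fun z z' => by
      have h1 := hus_le (ξ z) (hξB z) z'
      rw [hsq _ z z'] at h1
      simp only [hus] at h1 ⊢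
      linarith
  have hvl : ∀ z z', vs z' ≤ vs z + inner ℝ (-((2 : ℝ) • (υ z - z))) (z' - z) + ‖z' - z‖ ^ 2 :=
    fun z z' => by
      rw [inner_neg_left]
      have h1 := hvs_le (υ z) (hυB z) z'
      rw [hsq _ z z'] at h1
      simp only [hvs] at h1 ⊢
      linarith
  have htilt : ∀ ζ₀ : E, ‖ζ₀‖ < δ →
      ∃ z, ∀ z', us z' - vs z' ≤ us z - vs z + inner ℝ ζ₀ (z' - z) := by
    intro ζ₀ _
    have cF : ContinuousOn (fun w : E × E => U' w.1 - V' w.2 - ‖w.1 - w.2‖ ^ 2 / 2 -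
        inner ℝ ζ₀ ((1 / 2 : ℝ) • (w.1 + w.2))) (Bx ×ˢ By) := by
      refine (((cU'.comp continuousOn_fst fun w hw => hw.1).sub
        (cV'.comp continuousOn_snd fun w hw => hw.2)).sub ?_).sub ?_
      · fun_prop
      · fun_prop
    obtain ⟨⟨x, y⟩, ⟨hx, hy⟩, hm⟩ := (cBx.prod cBy).exists_isMaxOn ⟨(x₀, y₀), hx₀, hy₀⟩ cF
    set z := (1 / 2 : ℝ) • (x + y) - (1 / 4 : ℝ) • ζ₀ with hz
    refine ⟨z, fun z' => ?_⟩
    have h1 := isMaxOn_iff.1 hm (ξ z', υ z') ⟨hξB z', hυB z'⟩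
    have h2 := hus_le x hx z
    have h3 := hvs_le y hy z
    have h4 := hpar x y z
    have h5 := hpar (ξ z') (υ z') z'
    have e1 : z - (1 / 2 : ℝ) • (x + y) = -((1 / 4 : ℝ) • ζ₀) := by rw [hz]; abel
    set n := z' - (1 / 2 : ℝ) • (ξ z' + υ z') with hn
    have e2 : inner ℝ ζ₀ z' = inner ℝ ζ₀ n + inner ℝ ζ₀ ((1 / 2 : ℝ) • (ξ z' + υ z')) := by
      rw [← inner_add_right, hn]; congr 1; abel
    have e3 : inner ℝ ζ₀ z = inner ℝ ζ₀ ((1 / 2 : ℝ) • (x + y)) - 1 / 4 * ‖ζ₀‖ ^ 2 := by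
      rw [hz, inner_sub_right, inner_smul_right (r := (1 / 4 : ℝ)), real_inner_self_eq_norm_sq]
    rw [e1, norm_neg, norm_smul, mul_pow, Real.norm_eq_abs, sq_abs] at h4
    have h6 : 0 ≤ 2 * ‖n‖ ^ 2 + inner ℝ ζ₀ n + 1 / 8 * ‖ζ₀‖ ^ 2 := by
      have := sq_nonneg ‖(4 : ℝ) • n + ζ₀‖
      rw [norm_add_sq_real, norm_smul, real_inner_smul_left, Real.norm_eq_abs, mul_pow,
        sq_abs, real_inner_comm] at this
      linarith
    rw [inner_sub_right, e2, e3]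
    simp only [hus, hvs] at h2 h3 ⊢
    simp only at h1
    linarith
  obtain ⟨z, ζ, A, hζδ, hζ, hgrad, hA, hexp⟩ := exists_second_order_at_tilted_max hul hvl hδpos htilt
    (half_pos hεpos)
  set x := ξ z with hx
  set y := υ z with hy
  set m := (1 / 2 : ℝ) • (x + y) with hm
  have hloc : ‖x - x₀‖ + ‖y - y₀‖ + ‖z - m‖ ≤ ρ := by
    have h1 := hζ ((1 / 2 : ℝ) • (x₀ + y₀))
    have h2 := hus_le x₀ hx₀ ((1 / 2 : ℝ) • (x₀ + y₀))
    have h3 := hvs_le y₀ hy₀ ((1 / 2 : ℝ) • (x₀ + y₀))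
    have h4 := hpar x₀ y₀ ((1 / 2 : ℝ) • (x₀ + y₀))
    have h5 := hpar x y z
    have h6 := hmax x (hξB z) y (hυB z)
    rw [← hm] at h5
    have h7 : inner ℝ ζ ((1 / 2 : ℝ) • (x₀ + y₀) - z) ≤
        δ * (‖x - x₀‖ + ‖y - y₀‖ + ‖z - m‖) := by
      refine (real_inner_le_norm _ _).trans (mul_le_mul (hζδ) ?_ (norm_nonneg _) hδpos.le)
      have e1 : (1 / 2 : ℝ) • (x₀ + y₀) - z =
          -((1 / 2 : ℝ) • (x - x₀) + (1 / 2 : ℝ) • (y - y₀) + (z - m)) := by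
        rw [hm]; module
      rw [e1, norm_neg]
      refine (norm_add₃_le).trans ?_
      rw [norm_smul, norm_smul, Real.norm_eq_abs, abs_of_pos (by norm_num)]
      linarith [norm_nonneg (x - x₀), norm_nonneg (y - y₀)]
    simp only [sub_self, norm_zero] at h4
    simp only [hus, hvs, hU', hV', sub_self, norm_zero] at h1 h2 h3
    rw [← hx, ← hy] at h1
    set a := ‖x - x₀‖
    set b := ‖y - y₀‖
    set c := ‖z - m‖
    have ha : 0 ≤ a := norm_nonneg _
    have hb : 0 ≤ b := norm_nonneg _
    have hc : 0 ≤ c := norm_nonneg _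
    have h8 : ε * (a ^ 2 + b ^ 2 + c ^ 2) ≤ δ * (a + b + c) := by nlinarith [sq_nonneg c]
    have h9 : (a + b + c) ^ 2 ≤ 3 * (a ^ 2 + b ^ 2 + c ^ 2) := by
      nlinarith [sq_nonneg (a - b), sq_nonneg (b - c), sq_nonneg (a - c)]
    by_contra! hcon
    have h10 : ε * (a + b + c) ^ 2 ≤ ε * ρ * (a + b + c) := by
      have := mul_le_mul_of_nonneg_left h9 hεpos.le
      rw [hδ] at h8
      nlinarith
    have h11 : ε * ρ * (a + b + c) < ε * (a + b + c) * (a + b + c) := by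
      have : 0 < a + b + c := hρpos.trans hcon
      gcongr
    nlinarith
  have hρκ : ρ ≤ κ / 4 := min_le_left _ _
  have hρr : ρ ≤ r / 2 := min_le_right _ _
  have ha0 : 0 ≤ ‖x - x₀‖ := norm_nonneg _
  have hb0 : 0 ≤ ‖y - y₀‖ := norm_nonneg _
  have hc0 : 0 ≤ ‖z - m‖ := norm_nonneg _
  have hxnhds : Bx ∈ 𝓝 x := by
    refine Filter.mem_of_superset (Metric.ball_mem_nhds x (half_pos hr)) fun x' hx' => ?_
    rw [Metric.mem_closedBall]
    have h1 : dist x' x < r / 2 := hx'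
    have h2 : dist x x₀ ≤ r / 2 := by rw [dist_eq_norm]; linarith
    linarith [dist_triangle x' x x₀]
  have hynhds : By ∈ 𝓝 y := by
    refine Filter.mem_of_superset (Metric.ball_mem_nhds y (half_pos hr)) fun y' hy' => ?_
    rw [Metric.mem_closedBall]
    have h1 : dist y' y < r / 2 := hy'
    have h2 : dist y y₀ ≤ r / 2 := by rw [dist_eq_norm]; linarith
    linarith [dist_triangle y' y y₀]
  have hAle : ∀ h, inner ℝ (A h) h ≤ (2 + ε) * ‖h‖ ^ 2 := by
    refine inner_apply_self_le_of_eventually ?_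
    filter_upwards [hexp] with h hh
    have h1 := (abs_le.1 hh).1
    have h2 := hvl z (z + h)
    have h3 := hζ (z + h)
    have h4 : inner ℝ ((2 : ℝ) • (ξ z - z)) h = _ := congrArg (fun w => inner ℝ w h) hgrad
    rw [inner_add_left] at h4
    rw [add_sub_cancel_left] at h2 h3
    linarith
  have hAge : ∀ h, -((2 + ε) * ‖h‖ ^ 2) ≤ inner ℝ (A h) h := by
    have : ∀ h, inner ℝ ((-A) h) h ≤ (2 + ε) * ‖h‖ ^ 2 := by
      refine inner_apply_self_le_of_eventually ?_
      filter_upwards [hexp] with h hh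
      have h1 := (abs_le.1 hh).2
      have h2 := hul z (z + h)
      rw [add_sub_cancel_left] at h2
      rw [_root_.neg_apply, inner_neg_left]
      linarith
    intro h
    have := this h
    rw [_root_.neg_apply, inner_neg_left] at this
    linarith
  set I := ContinuousLinearMap.id ℝ E with hI
  obtain ⟨X, hXs, hXj, hXo⟩ := exists_upper_jet_of_supConvolution (U := U') (us := us) (x := x)
    (z := z) (X := A + (2 * ε) • I)
    (by filter_upwards [hxnhds] with x' hx' z'; linarith [hus_le x' hx' z'])
    (by simp only [hus, ← hx]; ring)
    (by
      filter_upwards [hexp] with h hh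
      have := (abs_le.1 hh).2
      simp only [_root_.add_apply, _root_.smul_apply, hI,
        ContinuousLinearMap.id_apply, inner_add_left, real_inner_smul_left,
        real_inner_self_eq_norm_sq] at this ⊢
      nlinarith [mul_nonneg hεpos.le (sq_nonneg ‖h‖)])
    (fun a b => by
      simp only [_root_.add_apply, _root_.smul_apply, hI,
        ContinuousLinearMap.id_apply, inner_add_left, real_inner_smul_left, inner_add_right,
        inner_smul_right, hA])
    hεpos
    (fun h => by
      have := hAge h
      simp only [_root_.add_apply, _root_.smul_apply, hI,
        ContinuousLinearMap.id_apply, inner_add_left, real_inner_smul_left,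
        real_inner_self_eq_norm_sq]
      linarith)
  obtain ⟨Y, hYs, hYj, hYo⟩ := exists_upper_jet_of_supConvolution (U := fun y => -V' y)
    (us := fun z => -vs z) (x := y)
    (z := z) (X := -A + (2 * ε) • I)
    (by filter_upwards [hynhds] with y' hy' z'; linarith [hvs_le y' hy' z'])
    (by simp only [hvs, ← hy]; ring)
    (by
      filter_upwards [hexp] with h hh
      have h1 := (abs_le.1 hh).1
      have h2 := hζ (z + h)
      rw [hgrad, inner_add_left] at h1
      rw [add_sub_cancel_left] at h2
      simp only [_root_.add_apply, _root_.smul_apply, hI,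
        ContinuousLinearMap.id_apply, inner_add_left, real_inner_smul_left,
        real_inner_self_eq_norm_sq, _root_.neg_apply, inner_neg_left] at h1 ⊢
      nlinarith [mul_nonneg hεpos.le (sq_nonneg ‖h‖)])
    (fun a b => by
      simp only [_root_.add_apply, _root_.smul_apply, hI,
        ContinuousLinearMap.id_apply, inner_add_left, real_inner_smul_left, inner_add_right,
        inner_smul_right, hA, _root_.neg_apply, inner_neg_left, inner_neg_right])
    hεpos
    (fun h => by
      have := hAle h
      simp only [_root_.add_apply, _root_.smul_apply, hI,
        ContinuousLinearMap.id_apply, inner_add_left, real_inner_smul_left,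
        real_inner_self_eq_norm_sq, _root_.neg_apply, inner_neg_left]
      linarith)
  have hsum : ∀ c₁ c₂ c₃ : ℝ, |c₁| ≤ 2 → |c₂| ≤ 2 → |c₃| ≤ 2 →
      ‖c₁ • (x - x₀) + c₂ • (y - y₀) + c₃ • (z - m)‖ ≤ κ := fun c₁ c₂ c₃ h₁ h₂ h₃ => by
    refine (norm_add₃_le).trans ?_
    rw [norm_smul, norm_smul, norm_smul]
    simp only [Real.norm_eq_abs]
    have := mul_le_mul_of_nonneg_right h₁ ha0
    have := mul_le_mul_of_nonneg_right h₂ hb0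
    have := mul_le_mul_of_nonneg_right h₃ hc0
    linarith
  refine ⟨x, y, (2 : ℝ) • (x - z) + (2 * ε) • (x - x₀),
    -((2 : ℝ) • (y - z)) - (2 * ε) • (y - y₀), X + (2 * ε) • I, -Y - (2 * ε) • I,
    by linarith, by linarith, ?_, ?_, ?_, ?_, ?_, ?_, ?_⟩
  · have e : (2 : ℝ) • (x - z) + (2 * ε) • (x - x₀) - (x₀ - y₀) =
        (1 + 2 * ε) • (x - x₀) + (-1 : ℝ) • (y - y₀) + (-2 : ℝ) • (z - m) := by
      rw [hm]; module
    rw [e]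
    refine hsum _ _ _ ?_ ?_ ?_
    · rw [abs_of_pos (by positivity)]; linarith
    · norm_num
    · norm_num
  · have e : -((2 : ℝ) • (y - z)) - (2 * ε) • (y - y₀) - (x₀ - y₀) =
        (1 : ℝ) • (x - x₀) + (-(1 + 2 * ε)) • (y - y₀) + (2 : ℝ) • (z - m) := by
      rw [hm]; module
    rw [e]
    refine hsum _ _ _ ?_ ?_ ?_
    · norm_num
    · rw [abs_neg, abs_of_pos (by positivity)]; linarith
    · norm_num
  · intro a b
    simp only [_root_.add_apply, _root_.smul_apply, hI,
        ContinuousLinearMap.id_apply, inner_add_left, real_inner_smul_left, inner_add_right,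
        inner_smul_right, hXs]
  · intro a b
    simp only [_root_.sub_apply, _root_.smul_apply, hI,
        ContinuousLinearMap.id_apply, inner_sub_left, real_inner_smul_left, inner_sub_right,
        inner_smul_right, hYs, _root_.neg_apply, inner_neg_left, inner_neg_right]
  · filter_upwards [hXj] with x' hx'
    have e : x' - x₀ = (x - x₀) + (x' - x) := by abel
    simp only [hU'] at hx'
    rw [e, norm_add_sq_real] at hx'
    simp only [_root_.add_apply, _root_.smul_apply, hI,
        ContinuousLinearMap.id_apply, inner_add_left, real_inner_smul_left,
        real_inner_self_eq_norm_sq] at hx' ⊢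
    linarith
  · filter_upwards [hYj] with y' hy'
    have e : y' - y₀ = (y - y₀) + (y' - y) := by abel
    simp only [hV'] at hy'
    rw [e, norm_add_sq_real] at hy'
    clear e
    generalize y' - y = w at hy' ⊢
    simp only [_root_.sub_apply, _root_.smul_apply, hI,
        ContinuousLinearMap.id_apply, inner_sub_left, real_inner_smul_left,
        real_inner_self_eq_norm_sq, _root_.neg_apply, inner_neg_left] at hy' ⊢
    linarith
  · intro a b
    have h1 := hXo a ((1 / 2 : ℝ) • (a + b))
    have h2 := hYo b ((1 / 2 : ℝ) • (a + b))
    have h3 := hpar a b ((1 / 2 : ℝ) • (a + b))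
    have h4 : ‖(1 / 2 : ℝ) • (a + b)‖ ^ 2 ≤ 1 / 2 * (‖a‖ ^ 2 + ‖b‖ ^ 2) := by
      have := parallelogram_law_with_norm ℝ a b
      rw [norm_smul, mul_pow, Real.norm_eq_abs, sq_abs]
      nlinarith [sq_nonneg ‖a - b‖]
    simp only [sub_self, norm_zero] at h3
    generalize (1 / 2 : ℝ) • (a + b) = w at h1 h2 h3 h4
    simp only [_root_.add_apply, _root_.sub_apply, _root_.smul_apply, hI,
        ContinuousLinearMap.id_apply, inner_add_left, inner_sub_left, real_inner_smul_left,
        real_inner_self_eq_norm_sq, _root_.neg_apply, inner_neg_left] at h1 h2 ⊢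
    have h5 := mul_le_mul_of_nonneg_left h4 hεpos.le
    have h6 := mul_le_mul_of_nonneg_right hεκ (add_nonneg (sq_nonneg ‖a‖) (sq_nonneg ‖b‖))
    linarith

end TheoremOnSums

section ParabolicJets

open Filter Topology

variable {k d : ℕ}

/-- Jointly `C²` functions are of class `C^{1,2}`. -/
theorem isC12_of_contDiff {φ : ℝ → Euc k → ℝ}
    (h : ContDiff ℝ 2 fun p : ℝ × Euc k => φ p.1 p.2) : IsC12 φ := by
  have hx : ContDiff ℝ 1 fun p : ℝ × Euc k => fderiv ℝ (φ p.1) p.2 := by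
    refine ContDiff.fderiv (f := fun p : ℝ × Euc k => φ p.1) (n := 1) (m := 2) ?_ contDiff_snd (by norm_num)
    exact h.comp (contDiff_fst.fst.prodMk contDiff_snd)
  have hxx : ContDiff ℝ 0 fun p : ℝ × Euc k => fderiv ℝ (fderiv ℝ (φ p.1)) p.2 := by
    refine ContDiff.fderiv (f := fun p : ℝ × Euc k => fderiv ℝ (φ p.1)) (n := 0) (m := 1) ?_
      contDiff_snd (by norm_num)
    exact hx.comp (contDiff_fst.fst.prodMk contDiff_snd)
  have ht : ContDiff ℝ 1 fun p : ℝ × Euc k => fderiv ℝ (fun s => φ s p.2) p.1 := by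
    refine ContDiff.fderiv (f := fun (p : ℝ × Euc k) s => φ s p.2) (n := 1) (m := 2) ?_ contDiff_fst
      (by norm_num)
    exact h.comp (contDiff_snd.prodMk contDiff_fst.snd)
  refine ⟨fun x => ?_, ?_, fun t => ?_, hx.continuous, hxx.continuous⟩
  · exact (h.comp (contDiff_id.prodMk contDiff_const)).differentiable (by norm_num)
  · simpa only [← fderiv_apply_one_eq_deriv] using ht.continuous.clm_apply continuous_const
  · exact h.comp (contDiff_const.prodMk contDiff_id)

/-- `ψ` is jointly `C²` with time derivative `τ`, spatial gradient `p` and spatial Hessian `X`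
at `(t, x)`. -/
structure HasParabolicJet (ψ : ℝ → Euc k → ℝ) (t : ℝ) (x : Euc k) (τ : ℝ)
    (p : Euc k →L[ℝ] ℝ) (X : Euc k →L[ℝ] Euc k →L[ℝ] ℝ) : Prop where
  contDiff : ContDiff ℝ 2 fun P : ℝ × Euc k => ψ P.1 P.2
  time : timeDeriv ψ t x = τ
  grad : fderiv ℝ (ψ t) x = p
  hess : fderiv ℝ (fderiv ℝ (ψ t)) x = X

namespace HasParabolicJet

variable {ψ φ : ℝ → Euc k → ℝ} {t : ℝ} {x : Euc k} {τ τ' : ℝ}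
  {p p' : Euc k →L[ℝ] ℝ} {X X' : Euc k →L[ℝ] Euc k →L[ℝ] ℝ}

theorem contDiff_slice (h : HasParabolicJet ψ t x τ p X) (s : ℝ) : ContDiff ℝ 2 (ψ s) :=
  h.contDiff.comp (contDiff_const.prodMk contDiff_id)

theorem contDiff_time (h : HasParabolicJet ψ t x τ p X) (y : Euc k) :
    ContDiff ℝ 2 fun s => ψ s y :=
  h.contDiff.comp (contDiff_id.prodMk contDiff_const)

theorem add (h : HasParabolicJet ψ t x τ p X) (h' : HasParabolicJet φ t x τ' p' X') :
    HasParabolicJet (fun s y => ψ s y + φ s y) t x (τ + τ') (p + p') (X + X') where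
  contDiff := h.contDiff.add h'.contDiff
  time := by
    rw [← h.time, ← h'.time]
    exact deriv_add ((h.contDiff_time x).differentiable (by norm_num) t)
      ((h'.contDiff_time x).differentiable (by norm_num) t)
  grad := by
    rw [← h.grad, ← h'.grad]
    exact fderiv_add ((h.contDiff_slice t).differentiable (by norm_num) x)
      ((h'.contDiff_slice t).differentiable (by norm_num) x)
  hess := by
    have e : fderiv ℝ (fun y => ψ t y + φ t y) = fderiv ℝ (ψ t) + fderiv ℝ (φ t) := by
      ext1 y
      exact fderiv_add ((h.contDiff_slice t).differentiable (by norm_num) y)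
        ((h'.contDiff_slice t).differentiable (by norm_num) y)
    rw [← h.hess, ← h'.hess, e]
    exact fderiv_add
      (((h.contDiff_slice t).fderiv_right (m := 1) (by norm_num)).differentiable (by norm_num) x)
      (((h'.contDiff_slice t).fderiv_right (m := 1) (by norm_num)).differentiable (by norm_num) x)

theorem const_mul (h : HasParabolicJet ψ t x τ p X) (c : ℝ) :
    HasParabolicJet (fun s y => c * ψ s y) t x (c * τ) (c • p) (c • X) where
  contDiff := contDiff_const.mul h.contDiff
  time := by
    rw [← h.time]
    exact deriv_const_mul c ((h.contDiff_time x).differentiable (by norm_num) t)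
  grad := by
    rw [← h.grad]
    exact fderiv_const_mul ((h.contDiff_slice t).differentiable (by norm_num) x) c
  hess := by
    have e : fderiv ℝ (fun y => c * ψ t y) = fun y => c • fderiv ℝ (ψ t) y := by
      ext1 y
      exact fderiv_const_mul ((h.contDiff_slice t).differentiable (by norm_num) y) c
    rw [← h.hess, e]
    exact fderiv_fun_const_smul
      (((h.contDiff_slice t).fderiv_right (m := 1) (by norm_num)).differentiable (by norm_num) x) c

end HasParabolicJet

/-- The drift as a vector of Euclidean space. -/
def driftVec (b : ℝ → Euc k → Fin k → ℝ) (t : ℝ) (x : Euc k) : Euc k := WithLp.toLp 2 (b t x)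

/-- The `l`-th column of the diffusion matrix as a vector of Euclidean space. -/
def diffCol (σm : ℝ → Euc k → Matrix (Fin k) (Fin d) ℝ) (l : Fin d) (t : ℝ) (x : Euc k) : Euc k :=
  WithLp.toLp 2 fun i => σm t x i l

theorem sum_mul_clm_single (v : Euc k) (p : Euc k →L[ℝ] ℝ) :
    ∑ i, v i * p (EuclideanSpace.single i 1) = p v := by
  conv_rhs => rw [← (EuclideanSpace.basisFun (Fin k) ℝ).sum_repr v]
  simp

theorem HasParabolicJet.sigGrad_eq {ψ : ℝ → Euc k → ℝ} {t : ℝ} {x : Euc k} {τ : ℝ}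
    {p : Euc k →L[ℝ] ℝ} {X : Euc k →L[ℝ] Euc k →L[ℝ] ℝ} (h : HasParabolicJet ψ t x τ p X)
    (σm : ℝ → Euc k → Matrix (Fin k) (Fin d) ℝ) :
    sigGrad σm ψ t x = fun l => p (diffCol σm l t x) := by
  ext l
  rw [← sum_mul_clm_single, ← h.grad]
  rfl

theorem HasParabolicJet.genL_eq {ψ : ℝ → Euc k → ℝ} {t : ℝ} {x : Euc k} {τ : ℝ}
    {p : Euc k →L[ℝ] ℝ} {X : Euc k →L[ℝ] Euc k →L[ℝ] ℝ} (h : HasParabolicJet ψ t x τ p X)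
    (b : ℝ → Euc k → Fin k → ℝ) (σm : ℝ → Euc k → Matrix (Fin k) (Fin d) ℝ) :
    genL b σm ψ t x = (1 / 2) * ∑ l, X (diffCol σm l t x) (diffCol σm l t x) +
      p (driftVec b t x) := by
  have hpd : ∀ i j, pd i (fun y => pd j (ψ t) y) x =
      X (EuclideanSpace.single i 1) (EuclideanSpace.single j 1) := fun i j => by
    have hd : DifferentiableAt ℝ (fderiv ℝ (ψ t)) x :=
      ((h.contDiff_slice t).fderiv_right (m := 1) (by norm_num)).differentiable (by norm_num) x
    have := (hd.hasFDerivAt.clm_apply (hasFDerivAt_const (EuclideanSpace.single j (1 : ℝ)) x)).fderiv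
    rw [← h.hess]
    unfold pd
    rw [this]
    simp
  have hX : ∀ v : Euc k, X v v = ∑ i, ∑ j, v i * v j *
      X (EuclideanSpace.single i 1) (EuclideanSpace.single j 1) := fun v => by
    rw [← sum_mul_clm_single v (X v)]
    have e : ∀ j, X v (EuclideanSpace.single j 1) =
        ∑ i, v i * X (EuclideanSpace.single i 1) (EuclideanSpace.single j 1) := fun j =>
      (sum_mul_clm_single v (X.flip (EuclideanSpace.single j 1))).symm
    simp only [e, Finset.mul_sum]
    rw [Finset.sum_comm]
    exact Finset.sum_congr rfl fun i _ => Finset.sum_congr rfl fun j _ => by ring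
  unfold genL
  congr 1
  · congr 1
    simp only [hpd, hX, Matrix.mul_apply, Matrix.transpose_apply, Finset.sum_mul]
    rw [Finset.sum_comm (γ := Fin d)]
    refine Finset.sum_congr rfl fun i _ => ?_
    rw [Finset.sum_comm]
    rfl
  · rw [← sum_mul_clm_single, ← h.grad]
    rfl

end ParabolicJets

section TestFunctions

open Filter Topology

variable {k d : ℕ}

/-- The jet of a quadratic polynomial of a linear image of `(t, x)`. -/
theorem hasParabolicJet_quadratic {E : Type*} [NormedAddCommGroup E] [InnerProductSpace ℝ E]
    (Z : ℝ × Euc k →L[ℝ] E) (c : ℝ) (P : E) {X : E →L[ℝ] E}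
    (hX : ∀ a b, inner ℝ (X a) b = inner ℝ a (X b)) (t : ℝ) (x : Euc k) :
    HasParabolicJet (fun s y => c + inner ℝ P (Z (s - t, y - x)) +
        inner ℝ (X (Z (s - t, y - x))) (Z (s - t, y - x)) / 2) t x (inner ℝ P (Z (1, 0)))
      ((innerSL ℝ P).comp (Z.comp (ContinuousLinearMap.inr ℝ ℝ (Euc k))))
      ((innerSL ℝ).bilinearComp (X.comp (Z.comp (ContinuousLinearMap.inr ℝ ℝ (Euc k))))
        (Z.comp (ContinuousLinearMap.inr ℝ ℝ (Euc k)))) := by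
  set Zr := Z.comp (ContinuousLinearMap.inr ℝ ℝ (Euc k)) with hZr
  have hZ0 : ∀ y, Z (t - t, y - x) = Zr (y - x) := fun y => by simp [hZr]
  have hg : ∀ y, fderiv ℝ (fun y => c + inner ℝ P (Z (t - t, y - x)) +
        inner ℝ (X (Z (t - t, y - x))) (Z (t - t, y - x)) / 2) y =
      (innerSL ℝ P).comp Zr + (innerSL ℝ).bilinearComp (X.comp Zr) Zr (y - x) := fun y => by
    simp only [hZ0]
    have h0 : HasFDerivAt (fun y : Euc k => Zr (y - x)) Zr y :=
      Zr.hasFDerivAt.comp y ((hasFDerivAt_id y).sub_const x)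
    have h1 := ((innerSL ℝ P).hasFDerivAt.comp y h0).const_add c
    have h2 := ((X.hasFDerivAt.comp y h0).inner ℝ h0).mul_const (2⁻¹ : ℝ)
    refine ((h1.add h2).congr_fderiv ?_).fderiv
    ext w
    simp [fderivInnerCLM_apply, hX]
    rw [real_inner_comm (X (Zr y) - X (Zr x)) (Zr w), inner_sub_left, hX, hX]
    ring
  refine ⟨?_, ?_, ?_, ?_⟩
  · have hZ : ContDiff ℝ 2 fun p : ℝ × Euc k => Z (p.1 - t, p.2 - x) :=
      Z.contDiff.comp ((contDiff_fst.sub contDiff_const).prodMk (contDiff_snd.sub contDiff_const))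
    exact (contDiff_const.add (contDiff_const.inner ℝ hZ)).add
      (((X.contDiff.comp hZ).inner ℝ hZ).div_const 2)
  · have hZ : HasDerivAt (fun s : ℝ => Z (s - t, x - x)) (Z (1, 0)) t := by
      refine Z.hasFDerivAt.comp_hasDerivAt t ?_
      simpa using ((hasDerivAt_id t).sub_const t).prodMk (hasDerivAt_const t (0 : Euc k))
    have h1 := ((hasDerivAt_const t P).inner ℝ hZ).const_add c
    have h2 := ((X.hasFDerivAt.comp_hasDerivAt t hZ).inner ℝ hZ).div_const 2
    refine ((h1.add h2).congr_deriv ?_).deriv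
    have h0 : Z (0, 0) = 0 := map_zero Z
    simp [h0]
  · rw [hg]; simp
  · rw [funext hg]
    have hs : HasFDerivAt (fun y : Euc k => y - x) (.id ℝ (Euc k)) x :=
      (hasFDerivAt_id x).sub_const x
    refine (((((innerSL ℝ).bilinearComp (X.comp Zr) Zr).hasFDerivAt.comp x hs).const_add
      _).congr_fderiv ?_).fderiv
    ext
    simp

theorem hasParabolicJet_mul {h : ℝ → ℝ} {ρ : Euc k → ℝ} (hh : ContDiff ℝ 2 h)
    (hρ : ContDiff ℝ 2 ρ) (t : ℝ) (x : Euc k) :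
    HasParabolicJet (fun s y => h s * ρ y) t x (deriv h t * ρ x) (h t • fderiv ℝ ρ x)
      (h t • fderiv ℝ (fderiv ℝ ρ) x) where
  contDiff := (hh.comp contDiff_fst).mul (hρ.comp contDiff_snd)
  time := deriv_mul_const (hh.differentiable (by norm_num) t) _
  grad := fderiv_const_mul (hρ.differentiable (by norm_num) x) _
  hess := by
    have e : fderiv ℝ (fun y => h t * ρ y) = fun y => h t • fderiv ℝ ρ y := by
      ext1 y
      exact fderiv_const_mul (hρ.differentiable (by norm_num) y) _
    rw [e]
    exact fderiv_fun_const_smul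
      ((hρ.fderiv_right (m := 1) (by norm_num)).differentiable (by norm_num) x) _

/-- Near a positive time, a negative power agrees with a globally smooth function. -/
theorem exists_contDiff_eventuallyEq_inv_pow (m : ℕ) {t : ℝ} (ht : 0 < t) :
    ∃ h : ℝ → ℝ, ContDiff ℝ 2 h ∧ h =ᶠ[𝓝 t] fun s => (s ^ m)⁻¹ := by
  let f : ContDiffBump t := ⟨t / 4, t / 2, by linarith, by linarith⟩
  refine ⟨fun s => f s * (s ^ m)⁻¹, contDiff_iff_contDiffAt.2 fun s => ?_, ?_⟩
  · rcases eq_or_ne s 0 with rfl | hs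
    · refine (contDiffAt_const (c := (0 : ℝ))).congr_of_eventuallyEq ?_
      filter_upwards [Iio_mem_nhds (show (0 : ℝ) < t / 2 by linarith)] with s hs
      rw [f.zero_of_le_dist, zero_mul]
      change t / 2 ≤ dist s t
      rw [Real.dist_eq, abs_sub_comm]
      exact le_trans (by linarith [mem_Iio.1 hs]) (le_abs_self _)
    · exact f.contDiffAt.mul ((contDiffAt_id.pow m).inv (pow_ne_zero m hs))
  · filter_upwards [f.eventuallyEq_one] with s hs
    rw [hs, Pi.one_apply, one_mul]

theorem deriv_inv_pow (m : ℕ) {t : ℝ} (ht : 0 < t) :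
    deriv (fun s : ℝ => (s ^ m)⁻¹) t = -(m / t) * (t ^ m)⁻¹ := by
  rw [((hasDerivAt_pow m t).fun_inv (pow_ne_zero m ht.ne')).deriv]
  rcases m with _ | m
  · simp
  · have := ht.ne'
    simp only [Nat.add_sub_cancel]
    field_simp
    ring

/-- A smooth weight of polynomial growth. -/
def polyWeight (q : ℕ) (x : Euc k) : ℝ := (1 + ‖x‖ ^ 2) ^ q

theorem one_le_polyWeight (q : ℕ) (x : Euc k) : 1 ≤ polyWeight q x :=
  one_le_pow₀ (by nlinarith [sq_nonneg ‖x‖])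

theorem contDiff_polyWeight (q : ℕ) : ContDiff ℝ 2 (polyWeight q : Euc k → ℝ) :=
  (contDiff_const.add (contDiff_norm_sq ℝ)).pow q

theorem hasFDerivAt_polyWeight (q : ℕ) (x : Euc k) :
    HasFDerivAt (polyWeight q) ((2 * q * polyWeight (q - 1) x) • innerSL ℝ x) x := by
  have h := (((hasStrictFDerivAt_norm_sq x).hasFDerivAt.const_add 1).pow q)
  refine h.congr_fderiv ?_
  ext w
  simp [polyWeight]
  ring

theorem fderiv_polyWeight_apply (q : ℕ) (x w : Euc k) :
    fderiv ℝ (polyWeight q) x w = 2 * q * polyWeight (q - 1) x * inner ℝ x w := by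
  rw [(hasFDerivAt_polyWeight q x).fderiv]
  simp

theorem fderiv_fderiv_polyWeight_apply (q : ℕ) (x w : Euc k) :
    fderiv ℝ (fderiv ℝ (polyWeight q)) x w w =
      4 * q * (q - 1 : ℕ) * polyWeight (q - 1 - 1) x * inner ℝ x w ^ 2 +
        2 * q * polyWeight (q - 1) x * ‖w‖ ^ 2 := by
  have e : fderiv ℝ (polyWeight q) =
      fun x : Euc k => (2 * q * polyWeight (q - 1) x) • innerSL ℝ x :=
    funext fun x => (hasFDerivAt_polyWeight q x).fderiv
  have h := ((hasFDerivAt_polyWeight (q - 1) x).const_mul (2 * q : ℝ)).fun_smul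
    (innerSL ℝ (E := Euc k)).hasFDerivAt
  rw [e, h.fderiv]
  change 2 * q * polyWeight (q - 1) x * inner ℝ w w +
    2 * q * (2 * (q - 1 : ℕ) * polyWeight (q - 1 - 1) x * inner ℝ x w) * inner ℝ x w = _
  rw [real_inner_self_eq_norm_sq]
  ring

/-- Derivatives of the weight along vectors of linear growth are controlled by the weight. -/
theorem abs_fderiv_polyWeight_le {q : ℕ} {C : ℝ} (hC : 0 ≤ C) {x w : Euc k}
    (hw : ‖w‖ ≤ C * (1 + ‖x‖)) :
    |fderiv ℝ (polyWeight q) x w| ≤ 4 * q * C * polyWeight q x := by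
  rcases q with _ | q
  · simp [fderiv_polyWeight_apply]
  have h0 := one_le_polyWeight q x
  have hxw : |inner ℝ x w| ≤ 2 * C * (1 + ‖x‖ ^ 2) := by
    have := (abs_real_inner_le_norm x w).trans (mul_le_mul_of_nonneg_left hw (norm_nonneg x))
    nlinarith [mul_nonneg hC (sq_nonneg (1 - ‖x‖))]
  have hN : polyWeight (q + 1) x = polyWeight q x * (1 + ‖x‖ ^ 2) := pow_succ _ _
  rw [fderiv_polyWeight_apply, abs_mul, abs_of_nonneg (by positivity), Nat.add_sub_cancel, hN]
  calc _ ≤ 2 * ((q + 1 : ℕ) : ℝ) * polyWeight q x * (2 * C * (1 + ‖x‖ ^ 2)) := by gcongr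
    _ = _ := by ring

theorem fderiv_fderiv_polyWeight_le {q : ℕ} {C : ℝ} (hC : 0 ≤ C) {x w : Euc k}
    (hw : ‖w‖ ≤ C * (1 + ‖x‖)) :
    fderiv ℝ (fderiv ℝ (polyWeight (q + 2))) x w w ≤
      (16 * (q + 2) ^ 2 + 4 * (q + 2)) * C ^ 2 * polyWeight (q + 2) x := by
  have h0 := one_le_polyWeight q x
  set N := 1 + ‖x‖ ^ 2 with hN
  have hN0 : 0 < N := by positivity
  have hxw : |inner ℝ x w| ≤ 2 * C * N := by
    have := (abs_real_inner_le_norm x w).trans (mul_le_mul_of_nonneg_left hw (norm_nonneg x))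
    nlinarith [mul_nonneg hC (sq_nonneg (1 - ‖x‖))]
  have hxw2 : inner ℝ x w ^ 2 ≤ 4 * C ^ 2 * N ^ 2 := by
    rw [← sq_abs]
    calc |inner ℝ x w| ^ 2 ≤ (2 * C * N) ^ 2 := by gcongr
      _ = _ := by ring
  have hw2 : ‖w‖ ^ 2 ≤ 2 * C ^ 2 * N := by
    calc ‖w‖ ^ 2 ≤ (C * (1 + ‖x‖)) ^ 2 := by gcongr
      _ ≤ _ := by nlinarith [mul_nonneg (sq_nonneg C) (sq_nonneg (1 - ‖x‖))]
  have h1 : polyWeight (q + 1) x = polyWeight q x * N := pow_succ _ _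
  have h2 : polyWeight (q + 2) x = polyWeight q x * N ^ 2 := pow_add _ _ _
  rw [fderiv_fderiv_polyWeight_apply, show q + 2 - 1 = q + 1 from rfl, Nat.add_sub_cancel, h1, h2]
  push_cast
  calc _ ≤ 4 * ((q : ℝ) + 2) * (q + 1) * polyWeight q x * (4 * C ^ 2 * N ^ 2) +
        2 * (q + 2) * (polyWeight q x * N) * (2 * C ^ 2 * N) := by gcongr
    _ ≤ 4 * ((q : ℝ) + 2) * (q + 2) * polyWeight q x * (4 * C ^ 2 * N ^ 2) +
        2 * (q + 2) * (polyWeight q x * N) * (2 * C ^ 2 * N) := by gcongr; norm_num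
    _ = _ := by ring

end TestFunctions

section Doubling

open Filter Topology

/-- Doubling of variables near a strict zero maximum of `W - V`, with independent penalization
parameters in time and space. -/
theorem exists_doubled_max {E : Type*} [NormedAddCommGroup E] [ProperSpace E] {W V : ℝ × E → ℝ}
    {P₀ : ℝ × E} {r κ : ℝ} (hr : 0 < r) (hκ : 0 < κ) (hW : ContinuousOn W (Metric.closedBall P₀ r))
    (hV : ContinuousOn V (Metric.closedBall P₀ r)) (h₀ : W P₀ = V P₀)
    (hle : ∀ P ∈ Metric.closedBall P₀ r, W P - V P ≤ -(κ * ‖P - P₀‖ ^ 2)) {ε : ℝ} (hε : 0 < ε) :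
    ∃ a : ℝ, 1 ≤ a ∧ ∀ δ > 0, ∃ c : ℝ, 1 ≤ c ∧ ∃ P Q : ℝ × E,
      ‖P - P₀‖ < ε ∧ ‖Q - P₀‖ < ε ∧ |P.1 - Q.1| < δ ∧ a * ‖P.2 - Q.2‖ < ε ∧
      ∀ P' ∈ Metric.closedBall P₀ r, ∀ Q' ∈ Metric.closedBall P₀ r,
        W P' - V Q' - (c ^ 2 * (P'.1 - Q'.1) ^ 2 + a ^ 2 * ‖P'.2 - Q'.2‖ ^ 2) / 2 ≤
          W P - V Q - (c ^ 2 * (P.1 - Q.1) ^ 2 + a ^ 2 * ‖P.2 - Q.2‖ ^ 2) / 2 := by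
  have hN : IsCompact (Metric.closedBall P₀ r) := isCompact_closedBall _ _
  have hmem : P₀ ∈ Metric.closedBall P₀ r := Metric.mem_closedBall_self hr.le
  obtain ⟨M₀, hM₀⟩ := hN.exists_bound_of_continuousOn hV
  set M := max M₀ 1 with hM
  have hM1 : 1 ≤ M := le_max_right _ _
  have hVM : ∀ P ∈ Metric.closedBall P₀ r, |V P| ≤ M := fun P hP => (hM₀ P hP).trans (le_max_left _ _)
  obtain ⟨e, he, he1, he2⟩ : ∃ e > 0, e ≤ ε ^ 2 / 2 ∧ e ≤ κ * ε ^ 2 / 4 :=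
    ⟨min (ε ^ 2 / 2) (κ * ε ^ 2 / 4), by positivity, min_le_left _ _, min_le_right _ _⟩
  obtain ⟨η₀, hη₀, huc⟩ := Metric.uniformContinuousOn_iff.1
    (hN.uniformContinuousOn_of_continuous hV) e he
  obtain ⟨η, hη, hη1, hη2⟩ : ∃ η > 0, η ≤ η₀ ∧ η ≤ ε / 2 :=
    ⟨min η₀ (ε / 2), by positivity, min_le_left _ _, min_le_right _ _⟩
  have key : ∀ {a d ρ : ℝ}, 0 < ρ → 2 * M < a * ρ → (a * d) ^ 2 / 2 ≤ 2 * M → 0 ≤ a → |d| < ρ := by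
    intro a d ρ hρ ha h ha0
    by_contra! hd
    have h1 : 2 * M < a * |d| := ha.trans_le (mul_le_mul_of_nonneg_left hd ha0)
    have h2 : (a * d) ^ 2 = (a * |d|) ^ 2 := by rw [mul_pow, mul_pow, sq_abs]
    nlinarith
  have haη : 2 * M < (1 + 2 * M / η) * η := by
    rw [add_mul, div_mul_cancel₀ _ hη.ne']; linarith
  refine ⟨1 + 2 * M / η, le_add_of_nonneg_right (by positivity), fun δ hδ => ?_⟩
  set a := 1 + 2 * M / η with ha
  have ha0 : 0 < a := by positivity
  refine ⟨a + 2 * M / δ, (le_add_of_nonneg_right (by positivity : 0 ≤ 2 * M / η)).trans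
    (le_add_of_nonneg_right (by positivity)), ?_⟩
  set c := a + 2 * M / δ with hc
  have hac : a ≤ c := le_add_of_nonneg_right (by positivity)
  have hcδ : 2 * M < c * δ := by
    rw [hc, add_mul, div_mul_cancel₀ _ hδ.ne']; nlinarith [mul_pos ha0 hδ]
  have hcη : 2 * M < c * η := haη.trans_le (mul_le_mul_of_nonneg_right hac hη.le)
  have hcont : ContinuousOn (fun R : (ℝ × E) × (ℝ × E) => W R.1 - V R.2 -
      (c ^ 2 * (R.1.1 - R.2.1) ^ 2 + a ^ 2 * ‖R.1.2 - R.2.2‖ ^ 2) / 2)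
      (Metric.closedBall P₀ r ×ˢ Metric.closedBall P₀ r) := by
    refine ((hW.comp continuousOn_fst fun R hR => hR.1).sub
      (hV.comp continuousOn_snd fun R hR => hR.2)).sub (Continuous.continuousOn ?_)
    fun_prop
  obtain ⟨⟨P, Q⟩, ⟨hP, hQ⟩, hmax⟩ := (hN.prod hN).exists_isMaxOn ⟨(P₀, P₀), hmem, hmem⟩ hcont
  refine ⟨P, Q, ?_⟩
  have h1 := hmax (show (P₀, P₀) ∈ _ from ⟨hmem, hmem⟩)
  simp only [mem_ofPred_eq, h₀, sub_self, norm_zero, ne_eq, OfNat.ofNat_ne_zero, not_false_eq_true,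
    zero_pow, mul_zero, add_zero, zero_div] at h1
  have h2 := hle P hP
  have hp0 : 0 ≤ κ * ‖P - P₀‖ ^ 2 := by positivity
  have hp1 := sq_nonneg (c * (P.1 - Q.1))
  have hp2 := sq_nonneg (a * ‖P.2 - Q.2‖)
  have e1 : c ^ 2 * (P.1 - Q.1) ^ 2 = (c * (P.1 - Q.1)) ^ 2 := (mul_pow _ _ _).symm
  have e2 : a ^ 2 * ‖P.2 - Q.2‖ ^ 2 = (a * ‖P.2 - Q.2‖) ^ 2 := (mul_pow _ _ _).symm
  rw [e1, e2] at h1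
  have h3 : V P - V Q ≤ 2 * M := by
    linarith [(abs_le.1 (hVM P hP)).2, (abs_le.1 (hVM Q hQ)).1]
  have ht : |P.1 - Q.1| < η := key hη hcη (by linarith) (ha0.le.trans hac)
  have htδ : |P.1 - Q.1| < δ := key hδ hcδ (by linarith) (ha0.le.trans hac)
  have hx : ‖P.2 - Q.2‖ < η := by
    simpa using key (d := ‖P.2 - Q.2‖) hη haη (by linarith) ha0.le
  have hPQ : ‖P - Q‖ < η := max_lt ht hx
  have h4 : V P - V Q < e := by
    have := huc P hP Q hQ (by rw [dist_eq_norm]; linarith)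
    exact (le_abs_self _).trans_lt this
  have hPε : ‖P - P₀‖ < ε / 2 := by
    refine lt_of_pow_lt_pow_left₀ 2 (by positivity) ?_
    have : κ * ‖P - P₀‖ ^ 2 < κ * (ε / 2) ^ 2 := by nlinarith
    exact lt_of_mul_lt_mul_left this hκ.le
  refine ⟨by linarith, ?_, htδ, ?_, fun P' hP' Q' hQ' => hmax (show (P', Q') ∈ _ from ⟨hP', hQ'⟩)⟩
  · have : Q - P₀ = (P - P₀) - (P - Q) := by abel
    rw [this]
    linarith [norm_sub_le (P - P₀) (P - Q)]
  · refine lt_of_pow_lt_pow_left₀ 2 hε.le ?_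
    linarith

/-- The linear map rescaling time by `c` and space by `a`. -/
def scaling (k : ℕ) (c a : ℝ) : ℝ × Euc k →L[ℝ] WithLp 2 (ℝ × Euc k) :=
  ((WithLp.prodContinuousLinearEquiv 2 ℝ ℝ (Euc k)).symm : (ℝ × Euc k) →L[ℝ] WithLp 2 (ℝ × Euc k)).comp
    ((c • ContinuousLinearMap.fst ℝ ℝ (Euc k)).prod (a • ContinuousLinearMap.snd ℝ ℝ (Euc k)))

theorem scaling_apply {k : ℕ} (c a : ℝ) (P : ℝ × Euc k) :
    scaling k c a P = WithLp.toLp 2 (c * P.1, a • P.2) := rfl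

theorem norm_scaling_sq {k : ℕ} (c a : ℝ) (P : ℝ × Euc k) :
    ‖scaling k c a P‖ ^ 2 = c ^ 2 * P.1 ^ 2 + a ^ 2 * ‖P.2‖ ^ 2 := by
  rw [scaling_apply, WithLp.prod_norm_sq_eq_of_L2]
  simp [norm_smul, mul_pow]

end Doubling

section Doubling

open Filter Topology

theorem norm_le_norm_scaling {k : ℕ} {c a : ℝ} (hc : 1 ≤ c) (ha : 1 ≤ a) (P : ℝ × Euc k) :
    ‖P‖ ≤ ‖scaling k c a P‖ ∧ c * |P.1| ≤ ‖scaling k c a P‖ ∧ a * ‖P.2‖ ≤ ‖scaling k c a P‖ := by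
  have h := norm_scaling_sq c a P
  have h1 : c * |P.1| ≤ ‖scaling k c a P‖ := by
    refine le_of_sq_le_sq ?_ (norm_nonneg _)
    rw [h, mul_pow, sq_abs]
    nlinarith [mul_nonneg (sq_nonneg a) (sq_nonneg ‖P.2‖)]
  have h2 : a * ‖P.2‖ ≤ ‖scaling k c a P‖ := by
    refine le_of_sq_le_sq ?_ (norm_nonneg _)
    rw [h, mul_pow]
    nlinarith [mul_nonneg (sq_nonneg c) (sq_nonneg P.1)]
  refine ⟨max_le ((le_mul_of_one_le_left (abs_nonneg _) hc).trans h1)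
    ((le_mul_of_one_le_left (norm_nonneg _) ha).trans h2), h1, h2⟩

/-- Parabolic theorem on sums: near a strict zero maximum of `W - V` there are `C²` functions
touching `W` from above and `V` from below, with almost equal first derivatives and ordered
second derivatives. -/
theorem exists_parabolicJets_of_strict_max {k : ℕ} {W V : ℝ × Euc k → ℝ}
    {P₀ : ℝ × Euc k} {r κ : ℝ} (hr : 0 < r) (hκ : 0 < κ)
    (hW : ContinuousOn W (Metric.closedBall P₀ r))
    (hV : ContinuousOn V (Metric.closedBall P₀ r)) (h₀ : W P₀ = V P₀)
    (hle : ∀ P ∈ Metric.closedBall P₀ r, W P - V P ≤ -(κ * ‖P - P₀‖ ^ 2)) {ε : ℝ} (hε : 0 < ε) :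
    ∃ a : ℝ, 1 ≤ a ∧ ∀ δ > 0, ∃ (P Q : ℝ × Euc k) (τ₁ τ₂ : ℝ) (p q : Euc k)
      (X Y : Euc k →L[ℝ] Euc k →L[ℝ] ℝ) (ψ φ : ℝ → Euc k → ℝ),
      ‖P - P₀‖ < ε ∧ ‖Q - P₀‖ < ε ∧ |P.1 - Q.1| < δ ∧ a * ‖P.2 - Q.2‖ < ε ∧ |τ₁ - τ₂| < δ ∧
      ‖p - a ^ 2 • (P.2 - Q.2)‖ < δ ∧ ‖q - a ^ 2 • (P.2 - Q.2)‖ < δ ∧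
      (∀ w w', X w w - Y w' w' ≤ a ^ 2 * ‖w - w'‖ ^ 2 + δ * (‖w‖ ^ 2 + ‖w'‖ ^ 2)) ∧
      HasParabolicJet ψ P.1 P.2 τ₁ (innerSL ℝ p) X ∧
      HasParabolicJet φ Q.1 Q.2 τ₂ (innerSL ℝ q) Y ∧
      W P = ψ P.1 P.2 ∧ V Q = φ Q.1 Q.2 ∧
      (∀ᶠ P' in 𝓝 P, W P' ≤ ψ P'.1 P'.2) ∧ ∀ᶠ Q' in 𝓝 Q, φ Q'.1 Q'.2 ≤ V Q' := by
  obtain ⟨e, he, heε, her⟩ : ∃ e > 0, e ≤ ε / 2 ∧ e ≤ r / 2 :=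
    ⟨min (ε / 2) (r / 2), by positivity, min_le_left _ _, min_le_right _ _⟩
  obtain ⟨a, ha, hdbl⟩ := exists_doubled_max hr hκ hW hV h₀ hle he
  refine ⟨a, ha, fun δ hδ => ?_⟩
  obtain ⟨c, hc, P, Q, hP, hQ, hPQ, haPQ, hmax⟩ := hdbl (δ / 2) (by positivity)
  have ha0 : 0 < a := by linarith
  have hc0 : 0 < c := by linarith
  set Z := scaling k c a with hZ
  set S : WithLp 2 (ℝ × Euc k) → ℝ × Euc k := fun ζ => (c⁻¹ * ζ.ofLp.1, a⁻¹ • ζ.ofLp.2) with hS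
  have hSc : Continuous S := by
    have h1 : Continuous fun ζ : WithLp 2 (ℝ × Euc k) => ζ.ofLp := WithLp.prod_continuous_ofLp 2 _ _
    simp only [hS]
    fun_prop
  have hZS : ∀ ζ, Z (S ζ) = ζ := fun ζ => by
    rw [hZ, scaling_apply]
    simp only [hS, mul_inv_cancel_left₀ hc0.ne', smul_inv_smul₀ ha0.ne']
  have hSZ : ∀ R, S (Z R) = R := fun R => by
    rw [hZ, scaling_apply]
    simp only [hS, inv_mul_cancel_left₀ hc0.ne', inv_smul_smul₀ ha0.ne']
  have hball : ∀ R : ℝ × Euc k, ‖R - P₀‖ < e → ∀ ζ ∈ Metric.closedBall (Z R) (r / 2),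
      S ζ ∈ Metric.closedBall P₀ r := fun R hR ζ hζ => by
    rw [mem_closedBall_iff_norm] at hζ ⊢
    have h1 := (norm_le_norm_scaling hc ha (S ζ - R)).1
    rw [← hZ, map_sub, hZS] at h1
    have : S ζ - P₀ = (S ζ - R) + (R - P₀) := by abel
    rw [this]
    linarith [norm_add_le (S ζ - R) (R - P₀)]
  obtain ⟨κ', hκ', hκε, hκδ⟩ : ∃ κ' > 0, κ' ≤ ε / 4 ∧ κ' * (a ^ 2 * c) ≤ δ / 8 :=
    ⟨min (ε / 4) (δ / 8 / (a ^ 2 * c)), by positivity, min_le_left _ _, by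
      rw [← le_div_iff₀ (by positivity)]; exact min_le_right _ _⟩
  have hκa2 : κ' * a ^ 2 ≤ δ / 8 := by
    refine le_trans ?_ hκδ
    gcongr; exact le_mul_of_one_le_right (by positivity) hc
  have hκa : κ' * a ≤ δ / 8 := by
    refine le_trans ?_ hκa2
    gcongr; nlinarith
  have hκc : κ' * c ≤ δ / 8 := by
    refine le_trans ?_ hκδ
    gcongr; exact le_mul_of_one_le_left (by positivity) (by nlinarith)
  have hκ1 : κ' ≤ δ / 8 := (le_mul_of_one_le_right hκ'.le ha).trans hκa
  obtain ⟨ζ, η, p, q, X, Y, hζ, hη, hp, hq, hXs, hYs, hXj, hYj, hXY⟩ :=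
    exists_jets_of_doubled_max (U := fun ζ => W (S ζ)) (V := fun ζ => V (S ζ)) (x₀ := Z P)
      (y₀ := Z Q) (half_pos hr) (hW.comp hSc.continuousOn (hball P hP))
      (hV.comp hSc.continuousOn (hball Q hQ)) (fun ζ hζ η hη => by
        have h := hmax (S ζ) (hball P hP ζ hζ) (S η) (hball Q hQ η hη)
        have h1 := norm_scaling_sq c a (S ζ - S η)
        have h2 := norm_scaling_sq c a (P - Q)
        rw [← hZ, map_sub] at h1 h2
        rw [hZS, hZS] at h1
        simp only [hSZ]
        rw [h1, h2]
        exact h) hκ'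
  set P' := S ζ with hP'
  set Q' := S η with hQ'
  have hZP' : Z P' = ζ := hZS ζ
  have hZQ' : Z Q' = η := hZS η
  obtain ⟨hP1, hP2, hP3⟩ := norm_le_norm_scaling hc ha (P' - P)
  obtain ⟨hQ1, hQ2, hQ3⟩ := norm_le_norm_scaling hc ha (Q' - Q)
  rw [← hZ, map_sub, hZP'] at hP1 hP2 hP3
  rw [← hZ, map_sub, hZQ'] at hQ1 hQ2 hQ3
  have hgrad : ∀ p : WithLp 2 (ℝ × Euc k),
      (innerSL ℝ p).comp (Z.comp (ContinuousLinearMap.inr ℝ ℝ (Euc k))) =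
        innerSL ℝ (a • p.ofLp.2) := fun p => by
    ext w
    simp [hZ, scaling_apply, WithLp.prod_inner_apply, real_inner_smul_right]
  have hjP := hasParabolicJet_quadratic Z (W P') p hXs P'.1 P'.2
  have hjQ := hasParabolicJet_quadratic Z (V Q') q hYs Q'.1 Q'.2
  rw [hgrad] at hjP hjQ
  have hfst : ∀ p : WithLp 2 (ℝ × Euc k), inner ℝ p (Z (1, 0)) = c * p.ofLp.1 := fun p => by
    simp [hZ, scaling_apply, WithLp.prod_inner_apply]
  have hgrad_le : ∀ p : WithLp 2 (ℝ × Euc k), ‖p - (Z P - Z Q)‖ ≤ κ' →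
      ‖a • p.ofLp.2 - a ^ 2 • (P'.2 - Q'.2)‖ < δ := fun p hp => by
    have h1 : a • p.ofLp.2 - a ^ 2 • (P'.2 - Q'.2) = a • ((p - (Z P - Z Q)).ofLp.2 +
        (a • (Q' - Q).2 - a • (P' - P).2)) := by
      simp only [hZ, scaling_apply, WithLp.ofLp_sub, Prod.snd_sub]
      module
    have h2 := norm_add_le (p - (Z P - Z Q)).ofLp.2 (a • (Q' - Q).2 - a • (P' - P).2)
    have h3 := norm_sub_le (a • (Q' - Q).2) (a • (P' - P).2)
    have h4 : ‖(p - (Z P - Z Q)).ofLp.2‖ ≤ _ := WithLp.norm_snd_le _ (p - (Z P - Z Q))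
    rw [norm_smul, norm_smul, Real.norm_eq_abs, abs_of_pos ha0] at h3
    rw [h1, norm_smul, Real.norm_eq_abs, abs_of_pos ha0]
    calc _ ≤ a * (3 * κ') := by
          gcongr
          linarith
      _ < δ := by linarith
  refine ⟨P', Q', _, _, a • p.ofLp.2, a • q.ofLp.2, _, _, _, _, ?_, ?_, ?_, ?_, ?_, ?_, ?_, ?_, hjP,
    hjQ, ?_, ?_, ?_, ?_⟩
  · have : P' - P₀ = (P' - P) + (P - P₀) := by abel
    rw [this]
    linarith [norm_add_le (P' - P) (P - P₀)]
  · have : Q' - P₀ = (Q' - Q) + (Q - P₀) := by abel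
    rw [this]
    linarith [norm_add_le (Q' - Q) (Q - P₀)]
  · have e1 := (norm_fst_le (P' - P)).trans (hP1.trans hζ)
    have e2 := (norm_fst_le (Q' - Q)).trans (hQ1.trans hη)
    rw [Real.norm_eq_abs, Prod.fst_sub, abs_le] at e1 e2
    rw [abs_lt] at hPQ ⊢
    constructor <;> linarith
  · have : P'.2 - Q'.2 = (P' - P).2 + (P.2 - Q.2) - (Q' - Q).2 := by
      simp only [Prod.snd_sub]; abel
    have h1 := (norm_sub_le ((P' - P).2 + (P.2 - Q.2)) (Q' - Q).2).trans
      (add_le_add_left (norm_add_le _ _) _)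
    rw [← this] at h1
    have := mul_le_mul_of_nonneg_left h1 ha0.le
    linarith
  · rw [hfst, hfst, ← mul_sub, abs_mul, abs_of_pos hc0]
    have h1 := (WithLp.norm_fst_le _ (p - (Z P - Z Q))).trans hp
    have h2 := (WithLp.norm_fst_le _ (q - (Z P - Z Q))).trans hq
    rw [Real.norm_eq_abs, WithLp.sub_fst, abs_le] at h1 h2
    have : |p.fst - q.fst| ≤ 2 * κ' := by
      rw [abs_le]
      constructor <;> linarith
    calc _ ≤ c * (2 * κ') := by gcongr; exact this
      _ < δ := by linarith
  · exact hgrad_le p hp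
  · exact hgrad_le q hq
  · intro w w'
    have h := hXY (Z (0, w)) (Z (0, w'))
    have h0 : Z (0, w) - Z (0, w') = Z (0, w - w') := by
      rw [← map_sub, Prod.mk_sub_mk, sub_zero]
    have hw : ∀ w, ‖Z (0, w)‖ ^ 2 = a ^ 2 * ‖w‖ ^ 2 := fun w => by
      rw [hZ, norm_scaling_sq]
      simp
    rw [h0, hw, hw, hw] at h
    refine h.trans ?_
    rw [← mul_add, ← mul_assoc]
    gcongr
    linarith
  · simp only [sub_self, Prod.mk_zero_zero, map_zero, inner_zero_right, add_zero, zero_div]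
  · simp only [sub_self, Prod.mk_zero_zero, map_zero, inner_zero_right, add_zero, zero_div]
  · have ht : Tendsto Z (𝓝 P') (𝓝 ζ) := by
      rw [← hZP']; exact Z.continuous.tendsto _
    filter_upwards [ht.eventually hXj] with R hR
    rw [hSZ] at hR
    have : Z (R.1 - P'.1, R.2 - P'.2) = Z R - ζ := by
      rw [← hZP', ← map_sub]; rfl
    rw [this]
    exact hR
  · have ht : Tendsto Z (𝓝 Q') (𝓝 η) := by
      rw [← hZQ']; exact Z.continuous.tendsto _
    filter_upwards [ht.eventually hYj] with R hR
    rw [hSZ] at hR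
    have : Z (R.1 - Q'.1, R.2 - Q'.2) = Z R - η := by
      rw [← hZQ', ← map_sub]; rfl
    rw [this]
    exact hR

end Doubling

section Comparison

open Filter Topology

variable {k d : ℕ}

theorem hasParabolicJet_sqDist (t₀ : ℝ) (x₀ : Euc k) (t : ℝ) (x : Euc k) :
    HasParabolicJet (fun s y => (s - t₀) ^ 2 + ‖y - x₀‖ ^ 2) t x (2 * (t - t₀))
      ((2 : ℝ) • innerSL ℝ (x - x₀)) ((2 : ℝ) • innerSL ℝ) := by
  have hg : ∀ y, fderiv ℝ (fun y => (t - t₀) ^ 2 + ‖y - x₀‖ ^ 2) y =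
      (2 : ℝ) • innerSL ℝ (y - x₀) := fun y => by
    have h : HasFDerivAt (fun y : Euc k => y - x₀) (.id ℝ (Euc k)) y :=
      (hasFDerivAt_id y).sub_const x₀
    refine ((h.norm_sq).const_add ((t - t₀) ^ 2)).congr_fderiv ?_ |>.fderiv
    ext w
    simp
  refine ⟨?_, ?_, hg x, ?_⟩
  · exact ((contDiff_fst.sub contDiff_const).pow 2).add
      ((contDiff_snd.sub contDiff_const).norm_sq ℝ)
  · have := (((hasDerivAt_id t).sub_const t₀).fun_pow 2).add_const (‖x - x₀‖ ^ 2)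
    refine (this.congr_deriv ?_).deriv
    simp
  · rw [funext hg]
    have h : HasFDerivAt (fun y : Euc k => y - x₀) (.id ℝ (Euc k)) x :=
      (hasFDerivAt_id x).sub_const x₀
    exact (((innerSL ℝ (E := Euc k)).hasFDerivAt.comp x h).const_smul (2 : ℝ)).fderiv

theorem abs_inner_sub_inner_le {E : Type*} [NormedAddCommGroup E] [InnerProductSpace ℝ E]
    {p q ξ v w : E} {a ε C M : ℝ} (ha : 1 ≤ a) (hε : 0 ≤ ε) (hε1 : ε ≤ 1) (hC : 0 ≤ C)
    (hp : ‖p - a ^ 2 • ξ‖ ≤ ε / a ^ 2) (hq : ‖q - a ^ 2 • ξ‖ ≤ ε / a ^ 2)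
    (hξ : a * ‖ξ‖ ≤ ε) (hv : ‖v‖ ≤ M) (hvw : ‖v - w‖ ≤ C * ‖ξ‖ + ε / a ^ 2) :
    |inner ℝ p v - inner ℝ q w| ≤ (2 * M + 2 * C + 2) * ε := by
  have ha0 : 0 < a := by linarith
  have ha2 : ε / a ^ 2 ≤ ε := div_le_self hε (one_le_pow₀ ha)
  have hM : 0 ≤ M := (norm_nonneg v).trans hv
  have hξε : ‖ξ‖ ≤ ε := (le_mul_of_one_le_left (norm_nonneg _) ha).trans hξ
  have hqn : ‖q‖ ≤ a ^ 2 * ‖ξ‖ + ε / a ^ 2 := by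
    have h := norm_add_le (q - a ^ 2 • ξ) (a ^ 2 • ξ)
    rw [sub_add_cancel, norm_smul, Real.norm_eq_abs, abs_of_nonneg (sq_nonneg a)] at h
    linarith
  have hpq : ‖p - q‖ ≤ 2 * ε := by
    have h := norm_sub_le (p - a ^ 2 • ξ) (q - a ^ 2 • ξ)
    rw [sub_sub_sub_cancel_right] at h
    linarith
  have e : inner ℝ p v - inner ℝ q w = inner ℝ (p - q) v + inner ℝ q (v - w) := by
    rw [inner_sub_left, inner_sub_right]; ring
  have h1 : |inner ℝ (p - q) v| ≤ 2 * ε * M :=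
    (abs_real_inner_le_norm _ _).trans (mul_le_mul hpq hv (norm_nonneg _) (by linarith))
  have h2 : |inner ℝ q (v - w)| ≤ (a ^ 2 * ‖ξ‖ + ε / a ^ 2) * (C * ‖ξ‖ + ε / a ^ 2) :=
    (abs_real_inner_le_norm _ _).trans (mul_le_mul hqn hvw (norm_nonneg _) (by positivity))
  have h3 : (a ^ 2 * ‖ξ‖ + ε / a ^ 2) * (C * ‖ξ‖ + ε / a ^ 2) =
      C * (a * ‖ξ‖) ^ 2 + ε * ‖ξ‖ + C * (ε / a ^ 2) * ‖ξ‖ + (ε / a ^ 2) ^ 2 := by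
    field_simp; ring
  have h4 : C * (a * ‖ξ‖) ^ 2 + ε * ‖ξ‖ + C * (ε / a ^ 2) * ‖ξ‖ + (ε / a ^ 2) ^ 2 ≤
      C * ε ^ 2 + ε * ε + C * ε * ε + ε ^ 2 := by gcongr
  rw [e]
  refine (abs_add_le _ _).trans ?_
  nlinarith [mul_nonneg hC hε, mul_nonneg hε (sub_nonneg.2 hε1), mul_nonneg (mul_nonneg hC hε) (sub_nonneg.2 hε1)]

theorem sq_penalty_le {E : Type*} [NormedAddCommGroup E]
    {ξ v w : E} {a ε C M : ℝ} (ha : 1 ≤ a) (hε : 0 ≤ ε) (hε1 : ε ≤ 1) (hC : 0 ≤ C)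
    (hξ : a * ‖ξ‖ ≤ ε) (hv : ‖v‖ ≤ M) (hw : ‖w‖ ≤ M) (hvw : ‖v - w‖ ≤ C * ‖ξ‖ + ε / a ^ 2) :
    a ^ 2 * ‖v - w‖ ^ 2 + ε / a ^ 2 * (‖v‖ ^ 2 + ‖w‖ ^ 2) ≤ ((C + 1) ^ 2 + 2 * M ^ 2) * ε := by
  have ha0 : 0 < a := by linarith
  have ha2 : ε / a ^ 2 ≤ ε := div_le_self hε (one_le_pow₀ ha)
  have h1 : a * ‖v - w‖ ≤ (C + 1) * ε := by
    calc a * ‖v - w‖ ≤ a * (C * ‖ξ‖ + ε / a ^ 2) := by gcongr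
      _ = C * (a * ‖ξ‖) + ε / a := by field_simp
      _ ≤ C * ε + ε := by gcongr; exact div_le_self hε ha
      _ = _ := by ring
  have h2 : a ^ 2 * ‖v - w‖ ^ 2 ≤ (C + 1) ^ 2 * ε := by
    calc a ^ 2 * ‖v - w‖ ^ 2 = (a * ‖v - w‖) ^ 2 := (mul_pow _ _ _).symm
      _ ≤ ((C + 1) * ε) ^ 2 := by gcongr
      _ = (C + 1) ^ 2 * (ε * ε) := by ring
      _ ≤ (C + 1) ^ 2 * ε := by gcongr; exact mul_le_of_le_one_left hε hε1
  have h3 : ε / a ^ 2 * (‖v‖ ^ 2 + ‖w‖ ^ 2) ≤ ε * (M ^ 2 + M ^ 2) := by gcongr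
  linarith

theorem norm_le_mul_of_forall_abs_le {v : Euc k} {c : ℝ} (h : ∀ i, |v i| ≤ c) : ‖v‖ ≤ k * c := by
  conv_lhs => rw [← (EuclideanSpace.basisFun (Fin k) ℝ).sum_repr v]
  exact (norm_sum_le _ _).trans ((Finset.sum_le_sum (g := fun _ => c) fun i _ => by
    simpa [norm_smul] using h i).trans_eq (by simp))

theorem H0.continuous_driftVec {T : ℝ} {b : ℝ → Euc k → Fin k → ℝ}
    {σm : ℝ → Euc k → Matrix (Fin k) (Fin d) ℝ} (h : H0 T b σm) :
    Continuous fun P : ℝ × Euc k => driftVec b P.1 P.2 :=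
  (PiLp.continuous_toLp 2 _).comp h.1

theorem H0.continuous_diffCol {T : ℝ} {b : ℝ → Euc k → Fin k → ℝ}
    {σm : ℝ → Euc k → Matrix (Fin k) (Fin d) ℝ} (h : H0 T b σm) (l : Fin d) :
    Continuous fun P : ℝ × Euc k => diffCol σm l P.1 P.2 :=
  (PiLp.continuous_toLp 2 _).comp (continuous_pi fun i => h.2.1.matrix_elem i l)

/-- Lipschitz and linear growth bounds in vector form. -/
theorem H0.exists_bounds {T : ℝ} {b : ℝ → Euc k → Fin k → ℝ}
    {σm : ℝ → Euc k → Matrix (Fin k) (Fin d) ℝ} (h : H0 T b σm) :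
    ∃ C : ℝ, 0 ≤ C ∧ ∀ t ∈ Icc (0 : ℝ) T, ∀ x x' : Euc k,
      (‖driftVec b t x - driftVec b t x'‖ ≤ C * ‖x - x'‖ ∧
        ∀ l, ‖diffCol σm l t x - diffCol σm l t x'‖ ≤ C * ‖x - x'‖) ∧
      ‖driftVec b t x‖ ≤ C * (1 + ‖x‖) ∧ ∀ l, ‖diffCol σm l t x‖ ≤ C * (1 + ‖x‖) := by
  obtain ⟨C, hC⟩ := h.2.2
  obtain ⟨C₁, hC₁⟩ := (isCompact_Icc (a := (0 : ℝ)) (b := T)).exists_bound_of_continuousOn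
    (f := fun t => driftVec b t 0)
    (h.continuous_driftVec.comp (continuous_id.prodMk continuous_const)).continuousOn
  choose C₂ hC₂ using fun l => (isCompact_Icc (a := (0 : ℝ)) (b := T)).exists_bound_of_continuousOn
    (f := fun t => diffCol σm l t 0)
    ((h.continuous_diffCol l).comp (continuous_id.prodMk continuous_const)).continuousOn
  have hlip : ∀ t ∈ Icc (0 : ℝ) T, ∀ x x' : Euc k,
      ‖driftVec b t x - driftVec b t x'‖ ≤ k * |C| * ‖x - x'‖ ∧
        ∀ l, ‖diffCol σm l t x - diffCol σm l t x'‖ ≤ k * |C| * ‖x - x'‖ := by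
    refine fun t ht x x' => ⟨?_, fun l => ?_⟩ <;> rw [mul_assoc]
    · exact norm_le_mul_of_forall_abs_le fun i => ((hC t ht x x').1 i).trans
        (mul_le_mul_of_nonneg_right (le_abs_self C) (norm_nonneg _))
    · exact norm_le_mul_of_forall_abs_le fun i => ((hC t ht x x').2 i l).trans
        (mul_le_mul_of_nonneg_right (le_abs_self C) (norm_nonneg _))
  have hS : 0 ≤ ∑ l, |C₂ l| := Finset.sum_nonneg fun l _ => abs_nonneg _
  have hkC : 0 ≤ k * |C| := by positivity
  have hle : k * |C| ≤ k * |C| + |C₁| + ∑ l, |C₂ l| := by linarith [abs_nonneg C₁]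
  have growth : ∀ {v w : Euc k} {x : Euc k} {c : ℝ}, ‖v - w‖ ≤ k * |C| * ‖x - 0‖ → ‖w‖ ≤ c →
      c ≤ |C₁| + ∑ l, |C₂ l| → ‖v‖ ≤ (k * |C| + |C₁| + ∑ l, |C₂ l|) * (1 + ‖x‖) := by
    intro v w x c hvw hw hc
    rw [sub_zero] at hvw
    have := norm_add_le (v - w) w
    rw [sub_add_cancel] at this
    nlinarith [norm_nonneg x, abs_nonneg C₁, mul_nonneg hS (norm_nonneg x),
      mul_nonneg (abs_nonneg C₁) (norm_nonneg x)]
  refine ⟨_, hkC.trans hle, fun t ht x x' => ⟨⟨?_, fun l => ?_⟩, ?_, fun l => ?_⟩⟩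
  · exact (hlip t ht x x').1.trans (mul_le_mul_of_nonneg_right hle (norm_nonneg _))
  · exact ((hlip t ht x x').2 l).trans (mul_le_mul_of_nonneg_right hle (norm_nonneg _))
  · exact growth (hlip t ht x 0).1 (hC₁ t ht) (by linarith [le_abs_self C₁])
  · refine growth ((hlip t ht x 0).2 l) (hC₂ l t ht) ?_
    have := Finset.single_le_sum (f := fun l => |C₂ l|) (fun l _ => abs_nonneg _)
      (Finset.mem_univ l)
    linarith [le_abs_self (C₂ l), abs_nonneg C₁]

theorem exists_time_modulus {X Y : Type*} [PseudoMetricSpace X] [PseudoMetricSpace Y]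
    {g : ℝ × X → Y} (hg : Continuous g) {K : Set X} (hK : IsCompact K) (T : ℝ) {ε : ℝ}
    (hε : 0 < ε) : ∃ δ > 0, ∀ t ∈ Icc 0 T, ∀ s ∈ Icc 0 T, |t - s| < δ → ∀ x ∈ K,
      dist (g (t, x)) (g (s, x)) < ε := by
  obtain ⟨δ, hδ, h⟩ := Metric.uniformContinuousOn_iff.1
    ((isCompact_Icc.prod hK).uniformContinuousOn_of_continuous hg.continuousOn) ε hε
  refine ⟨δ, hδ, fun t ht s hs hts x hx => h _ ⟨ht, hx⟩ _ ⟨hs, hx⟩ ?_⟩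
  rwa [Prod.dist_eq, dist_self, Real.dist_eq, max_eq_left (abs_nonneg _)]

end Comparison

section Contact

open Filter Topology

variable {k d : ℕ}

/-- The second order operator of a parabolic jet, including the time derivative. -/
def jetOp (b : ℝ → Euc k → Fin k → ℝ) (σm : ℝ → Euc k → Matrix (Fin k) (Fin d) ℝ)
    (t : ℝ) (x : Euc k) (τ : ℝ) (p : Euc k →L[ℝ] ℝ) (X : Euc k →L[ℝ] Euc k →L[ℝ] ℝ) : ℝ :=
  τ + (1 / 2) * ∑ l, X (diffCol σm l t x) (diffCol σm l t x) + p (driftVec b t x)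

section Jets

variable {T : ℝ} {b : ℝ → Euc k → Fin k → ℝ} {σm : ℝ → Euc k → Matrix (Fin k) (Fin d) ℝ}
  {g : Euc k → ℝ} {f : ℝ → Euc k → ℝ → (Fin d → ℝ) → ℝ} {Lf Hf u ψ : ℝ → Euc k → ℝ}
  {t : ℝ} {x : Euc k} {τ : ℝ} {p : Euc k →L[ℝ] ℝ} {X : Euc k →L[ℝ] Euc k →L[ℝ] ℝ}

theorem IsViscSubsol.jetOp_nonneg (hu : IsViscSubsol T b σm g (FMm f Lf Hf) u)
    (ht : t ∈ Ioo 0 T) (hψ : HasParabolicJet ψ t x τ p X) (he : u t x = ψ t x)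
    (hle : ∀ᶠ P : ℝ × Euc k in 𝓝 (t, x), u P.1 P.2 ≤ ψ P.1 P.2) :
    u t x ≤ Hf t x ∧ (u t x ≤ Lf t x ∨
      0 ≤ jetOp b σm t x τ p X + f t x (u t x) fun l => p (diffCol σm l t x)) := by
  have h := hu.2 t x ht ψ (isC12_of_contDiff hψ.contDiff)
    (hle.mono fun P hP => by simp only [he, sub_self]; linarith) he
  rw [FMm, hψ.time, hψ.genL_eq, hψ.sigGrad_eq, max_le_iff, min_le_iff] at h
  refine ⟨by linarith [h.1], h.2.imp (fun h => by linarith) fun h => ?_⟩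
  rw [jetOp]
  linarith

theorem IsViscSupersol.jetOp_nonpos (hu : IsViscSupersol T b σm g (FMm f Lf Hf) u)
    (ht : t ∈ Ioo 0 T) (hψ : HasParabolicJet ψ t x τ p X) (he : u t x = ψ t x)
    (hle : ∀ᶠ P : ℝ × Euc k in 𝓝 (t, x), ψ P.1 P.2 ≤ u P.1 P.2) :
    Hf t x ≤ u t x ∨ Lf t x ≤ u t x ∧
      jetOp b σm t x τ p X + f t x (u t x) (fun l => p (diffCol σm l t x)) ≤ 0 := by
  have h := hu.2 t x ht ψ (isC12_of_contDiff hψ.contDiff)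
    (hle.mono fun P hP => by simp only [he, sub_self]; linarith) he
  rw [FMm, hψ.time, hψ.genL_eq, hψ.sigGrad_eq, le_max_iff, le_min_iff] at h
  refine h.imp (fun h => by linarith) fun h => ⟨by linarith [h.1], ?_⟩
  rw [jetOp]
  linarith [h.2]

end Jets

/-- Difference of the operators along jets produced by doubling the time and space variables. -/
theorem jetOp_sub_jetOp_le {S S' : Fin d → Euc k} {B B' p q : Euc k} {τ₀ τ₁ τ₂ c r ε M D N A₁ A₂ : ℝ}
    {p₀ : Euc k →L[ℝ] ℝ} {X₀ X Y : Euc k →L[ℝ] Euc k →L[ℝ] ℝ}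
    (hτ₀ : τ₀ ≤ -(c * r) + 2 * ε) (hτ : |τ₁ - τ₂| ≤ ε)
    (hD : |inner ℝ p B - inner ℝ q B'| ≤ D * ε)
    (hN : ∀ l, X (S l) (S l) - Y (S' l) (S' l) ≤ N * ε)
    (hA₁ : |p₀ B| ≤ A₁ * r + 2 * M * ε) (hA₂ : ∀ l, X₀ (S l) (S l) ≤ A₂ * r + 2 * M ^ 2 * ε) :
    (τ₀ + τ₁ + (1 / 2) * ∑ l, (X₀ + X) (S l) (S l) + (p₀ + innerSL ℝ p) B) -
      (τ₂ + (1 / 2) * ∑ l, Y (S' l) (S' l) + innerSL ℝ q B') ≤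
      (d / 2 * A₂ + A₁ - c) * r + (3 + d / 2 * N + d * M ^ 2 + 2 * M + D) * ε := by
  have h1 : ∑ l, (X₀ + X) (S l) (S l) - ∑ l, Y (S' l) (S' l) ≤
      d * (A₂ * r + 2 * M ^ 2 * ε + N * ε) := by
    rw [← Finset.sum_sub_distrib]
    refine (Finset.sum_le_sum (g := fun _ => A₂ * r + 2 * M ^ 2 * ε + N * ε) fun l _ => ?_).trans_eq
      (by simp [mul_add])
    rw [_root_.add_apply, _root_.add_apply]
    linarith [hA₂ l, hN l]
  rw [_root_.add_apply, innerSL_apply_apply, innerSL_apply_apply]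
  linarith [le_of_abs_le hτ, le_of_abs_le hD, le_of_abs_le hA₁]

theorem norm_gradient_sub_le {S S' : Fin d → Euc k} {p q : Euc k} {ε D N : ℝ}
    {p₀ : Euc k →L[ℝ] ℝ} (h : 0 ≤ N + D * ε)
    (hD : ∀ l, |inner ℝ p (S l) - inner ℝ q (S' l)| ≤ D * ε) (hN : ∀ l, |p₀ (S l)| ≤ N) :
    ‖(fun l => (p₀ + innerSL ℝ p) (S l)) - fun l => innerSL ℝ q (S' l)‖ ≤ N + D * ε := by
  refine (pi_norm_le_iff_of_nonneg h).2 fun l => ?_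
  rw [Pi.sub_apply, _root_.add_apply, innerSL_apply_apply, innerSL_apply_apply, Real.norm_eq_abs,
    add_sub_assoc]
  exact (abs_add_le _ _).trans (add_le_add (hN l) (hD l))

/-- The test function `θ t⁻ᵐ ρ(x) + ε (|t - t₀|² + |x - x₀|²)` near a point of positive time. -/
theorem exists_parabolicJet_weight {θ ε C : ℝ} (hθ : 0 ≤ θ) (hε : 0 ≤ ε) (hC : 0 ≤ C) (q m : ℕ)
    (t₀ : ℝ) (x₀ : Euc k) {t : ℝ} {x : Euc k} (ht : 0 < t) (hx : ‖x - x₀‖ ≤ 1) :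
    ∃ χ p₀ X₀, HasParabolicJet χ t x (-(m / t) * (θ * ((t ^ m)⁻¹ * polyWeight (q + 2) x)) +
        ε * (2 * (t - t₀))) p₀ X₀ ∧
      (∀ᶠ P : ℝ × Euc k in 𝓝 (t, x), χ P.1 P.2 =
        θ * ((P.1 ^ m)⁻¹ * polyWeight (q + 2) P.2) +
          ε * ((P.1 - t₀) ^ 2 + ‖P.2 - x₀‖ ^ 2)) ∧
      ∀ w : Euc k, ‖w‖ ≤ C * (1 + ‖x‖) →
        |p₀ w| ≤ 4 * (q + 2) * C * (θ * ((t ^ m)⁻¹ * polyWeight (q + 2) x)) + 2 * ‖w‖ * ε ∧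
        X₀ w w ≤ (16 * (q + 2) ^ 2 + 4 * (q + 2)) * C ^ 2 *
          (θ * ((t ^ m)⁻¹ * polyWeight (q + 2) x)) + 2 * ‖w‖ ^ 2 * ε := by
  obtain ⟨h, hh, hht⟩ := exists_contDiff_eventuallyEq_inv_pow m ht
  have hv := hht.eq_of_nhds
  have hd := hht.deriv_eq.trans (deriv_inv_pow m ht)
  have hpos : 0 ≤ θ * (t ^ m)⁻¹ := by positivity
  have hj := ((hasParabolicJet_mul hh (contDiff_polyWeight (q + 2)) t x).const_mul θ).add
    ((hasParabolicJet_sqDist t₀ x₀ t x).const_mul ε)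
  have hτ : θ * (deriv h t * polyWeight (q + 2) x) =
      -(m / t) * (θ * ((t ^ m)⁻¹ * polyWeight (q + 2) x)) := by
    rw [hd]
    ring
  rw [hτ] at hj
  refine ⟨_, _, _, hj, ?_, fun w hw => ⟨?_, ?_⟩⟩
  · filter_upwards [continuous_fst.continuousAt.eventually hht] with P hP
    rw [hP]
  · have h1 := abs_fderiv_polyWeight_le (q := q + 2) hC hw
    have h2 : |ε * (2 * inner ℝ (x - x₀) w)| ≤ 2 * ‖w‖ * ε := by
      rw [abs_mul, abs_mul, abs_of_nonneg hε, abs_two]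
      have := (abs_real_inner_le_norm (x - x₀) w).trans
        (mul_le_mul_of_nonneg_right hx (norm_nonneg w))
      nlinarith
    have h3 : |θ * (h t * fderiv ℝ (polyWeight (q + 2)) x w)| ≤
        4 * (q + 2) * C * (θ * ((t ^ m)⁻¹ * polyWeight (q + 2) x)) := by
      rw [hv, ← mul_assoc, abs_mul, abs_of_nonneg hpos]
      push_cast at h1
      exact (mul_le_mul_of_nonneg_left h1 hpos).trans_eq (by ring)
    exact (abs_add_le _ _).trans (add_le_add h3 h2)
  · have h1 := mul_le_mul_of_nonneg_left (fderiv_fderiv_polyWeight_le (q := q) hC hw) hpos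
    have h2 : ε * (2 * inner ℝ w w) = 2 * ‖w‖ ^ 2 * ε := by
      rw [real_inner_self_eq_norm_sq]
      ring
    refine (add_le_add (b := (16 * (q + 2) ^ 2 + 4 * (q + 2)) * C ^ 2 *
      (θ * ((t ^ m)⁻¹ * polyWeight (q + 2) x))) ?_ h2.le)
    change θ * (h t * fderiv ℝ (fderiv ℝ (polyWeight (q + 2))) x w w) ≤ _
    rw [hv, ← mul_assoc]
    exact h1.trans_eq (by ring)

end Contact

section Doubling

open Filter Topology

variable {k d : ℕ}

theorem norm_gradient_le {S : Fin d → Euc k} {q ξ : Euc k} {a ε M : ℝ} (hM : 0 ≤ M)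
    (hε : 0 ≤ ε) (hq : ‖q - a ^ 2 • ξ‖ ≤ ε) (hS : ∀ l, ‖S l‖ ≤ M) :
    ‖fun l => innerSL ℝ q (S l)‖ ≤ (a ^ 2 * ‖ξ‖ + ε) * M := by
  have hqn : ‖q‖ ≤ a ^ 2 * ‖ξ‖ + ε := by
    have h := norm_add_le (q - a ^ 2 • ξ) (a ^ 2 • ξ)
    rw [sub_add_cancel, norm_smul, Real.norm_eq_abs, abs_of_nonneg (sq_nonneg a)] at h
    linarith
  refine (pi_norm_le_iff_of_nonneg (by positivity)).2 fun l => ?_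
  exact (norm_inner_le_norm _ _).trans (mul_le_mul hqn (hS l) (norm_nonneg _) (by positivity))

/-- Jets at a doubled contact point, with all structural errors of size `ε`. -/
theorem exists_doubled_contact {T : ℝ} {b : ℝ → Euc k → Fin k → ℝ}
    {σm : ℝ → Euc k → Matrix (Fin k) (Fin d) ℝ} {f : ℝ → Euc k → ℝ → (Fin d → ℝ) → ℝ}
    (h0 : H0 T b σm)
    (hf : Continuous fun q : (ℝ × Euc k) × ℝ × (Fin d → ℝ) => f q.1.1 q.1.2 q.2.1 q.2.2)
    (A2 : ∀ R > (0 : ℝ), ∃ Φ : ℝ → ℝ, (∀ s, 0 ≤ Φ s) ∧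
      (∀ ε > (0 : ℝ), ∃ δ > (0 : ℝ), ∀ s, 0 ≤ s → s < δ → Φ s < ε) ∧
      ∀ t ∈ Ioo (0 : ℝ) T, ∀ x x' : Euc k, ‖x‖ ≤ R → ‖x'‖ ≤ R → ∀ y : ℝ, |y| ≤ R →
        ∀ z : Fin d → ℝ, |f t x y z - f t x' y z| ≤ Φ ((1 + ‖z‖) * ‖x - x'‖))
    {C : ℝ} (hC : 0 ≤ C) (hb : ∀ t ∈ Icc (0 : ℝ) T, ∀ x x' : Euc k,
      (‖driftVec b t x - driftVec b t x'‖ ≤ C * ‖x - x'‖ ∧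
        ∀ l, ‖diffCol σm l t x - diffCol σm l t x'‖ ≤ C * ‖x - x'‖) ∧
      ‖driftVec b t x‖ ≤ C * (1 + ‖x‖) ∧ ∀ l, ‖diffCol σm l t x‖ ≤ C * (1 + ‖x‖))
    {W V : ℝ × Euc k → ℝ} {P₀ : ℝ × Euc k} {η ε : ℝ} (hη : 0 < η) (hη1 : η ≤ 1)
    (hηT : Metric.ball P₀.1 η ⊆ Ioo 0 T) (hε : 0 < ε) (hε1 : ε ≤ 1)
    (hW : ContinuousOn W (Metric.closedBall P₀ (η / 2))) (hV : Continuous V) (h₀ : W P₀ = V P₀)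
    (hle : ∀ P ∈ Metric.closedBall P₀ (η / 2), W P - V P ≤ -(ε * ‖P - P₀‖ ^ 2))
    {M D : ℝ} (hM : M = C * (2 + ‖P₀.2‖)) (hD : D = 2 * M + 2 * C + 2) :
    ∃ P Q τ₁ τ₂ p q X Y ψ φ, ‖P - P₀‖ < η ∧ ‖Q - P₀‖ < η ∧ |τ₁ - τ₂| ≤ ε ∧
      |inner ℝ p (driftVec b P.1 P.2) - inner ℝ q (driftVec b Q.1 Q.2)| ≤ D * ε ∧
      (∀ l, |inner ℝ p (diffCol σm l P.1 P.2) - inner ℝ q (diffCol σm l Q.1 Q.2)| ≤ D * ε) ∧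
      (∀ l, X (diffCol σm l P.1 P.2) (diffCol σm l P.1 P.2) -
        Y (diffCol σm l Q.1 Q.2) (diffCol σm l Q.1 Q.2) ≤ ((C + 1) ^ 2 + 2 * M ^ 2) * ε) ∧
      |f P.1 P.2 (V Q) (fun l => innerSL ℝ q (diffCol σm l Q.1 Q.2)) -
        f Q.1 Q.2 (V Q) (fun l => innerSL ℝ q (diffCol σm l Q.1 Q.2))| ≤ 2 * ε ∧
      HasParabolicJet ψ P.1 P.2 τ₁ (innerSL ℝ p) X ∧
      HasParabolicJet φ Q.1 Q.2 τ₂ (innerSL ℝ q) Y ∧ W P = ψ P.1 P.2 ∧ V Q = φ Q.1 Q.2 ∧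
      (∀ᶠ P' in 𝓝 P, W P' ≤ ψ P'.1 P'.2) ∧ ∀ᶠ Q' in 𝓝 Q, φ Q'.1 Q'.2 ≤ V Q' := by
  have hM0 : 0 ≤ M := by rw [hM]; positivity
  obtain ⟨Mv, hMv⟩ := (isCompact_closedBall P₀ 1).exists_bound_of_continuousOn hV.continuousOn
  set R := 1 + ‖P₀.2‖ with hR
  set R' := max R Mv with hR'
  have hR1 : 1 ≤ R' := (by simp [hR] : 1 ≤ R).trans (le_max_left _ _)
  obtain ⟨Φ, -, hΦ, hfΦ⟩ := A2 R' (by linarith)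
  obtain ⟨δA, hδA, hΦδ⟩ := hΦ ε hε
  set ε₁ := min (min ε η) (δA / (2 * (1 + 2 * M))) with hε₁
  have hε₁0 : 0 < ε₁ := by positivity
  have hε₁ε : ε₁ ≤ ε := (min_le_left _ _).trans (min_le_left _ _)
  have hε₁η : ε₁ ≤ η := (min_le_left _ _).trans (min_le_right _ _)
  have hε₁A : ε₁ * (1 + 2 * M) < δA := by
    have : ε₁ ≤ δA / (2 * (1 + 2 * M)) := min_le_right _ _
    rw [le_div_iff₀ (by positivity)] at this
    linarith
  obtain ⟨a, ha, hjets⟩ := exists_parabolicJets_of_strict_max (by positivity) hε hW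
    hV.continuousOn h₀ hle hε₁0
  have ha0 : 0 < a := by linarith
  have hεa : 0 < ε / a ^ 2 := by positivity
  have hεaε : ε / a ^ 2 ≤ ε := div_le_self hε.le (one_le_pow₀ ha)
  set Z := (a + 1) * M with hZ
  obtain ⟨δ₁, hδ₁, hmod₁⟩ := exists_time_modulus
    (g := fun p : ℝ × Euc k => (driftVec b p.1 p.2, fun l => diffCol σm l p.1 p.2))
    (h0.continuous_driftVec.prodMk (continuous_pi fun l => h0.continuous_diffCol l))
    (isCompact_closedBall (0 : Euc k) R) T hεa
  obtain ⟨δ₂, hδ₂, hmod₂⟩ := exists_time_modulus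
    (g := fun p : ℝ × (Euc k × ℝ × (Fin d → ℝ)) => f p.1 p.2.1 p.2.2.1 p.2.2.2)
    (hf.comp ((continuous_fst.prodMk continuous_snd.fst).prodMk continuous_snd.snd))
    ((isCompact_closedBall (0 : Euc k) R).prod ((isCompact_closedBall (0 : ℝ) R').prod
      (isCompact_closedBall (0 : Fin d → ℝ) Z))) T hε
  obtain ⟨P, Q, τ₁, τ₂, p, q, X, Y, ψ, φ, hP, hQ, hPQ, hξ, hτ, hp, hq, hXY, hψ, hφ, hWP, hVQ,
    hWψ, hVφ⟩ := hjets (min (ε / a ^ 2) (min δ₁ δ₂)) (by positivity)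
  have hPη := hP.trans_le hε₁η
  have hQη := hQ.trans_le hε₁η
  have mem : ∀ {P : ℝ × Euc k}, ‖P - P₀‖ < η → P.1 ∈ Ioo 0 T ∧ ‖P.2‖ ≤ R := fun {P} h => by
    constructor
    · refine hηT ?_
      rw [Metric.mem_ball, dist_eq_norm]
      exact (norm_fst_le (P - P₀)).trans_lt h
    · have h2 : ‖P.2 - P₀.2‖ ≤ ‖P - P₀‖ := norm_snd_le (P - P₀)
      have h3 := norm_sub_norm_le P.2 P₀.2
      linarith
  obtain ⟨hPT, hPR⟩ := mem hPη
  obtain ⟨hQT, hQR⟩ := mem hQη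
  have hPI := Ioo_subset_Icc_self hPT
  have hQI := Ioo_subset_Icc_self hQT
  replace hp := (hp.trans_le (min_le_left _ _)).le
  replace hq := (hq.trans_le (min_le_left _ _)).le
  replace hτ := (hτ.trans_le (min_le_left _ _)).le
  have hξε := hξ.le.trans hε₁ε
  have bd : ∀ {x : Euc k}, ‖x‖ ≤ R → C * (1 + ‖x‖) ≤ M := fun h => by
    rw [hM]
    exact mul_le_mul_of_nonneg_left (by linarith) hC
  have hSP := fun l => ((hb _ hPI P.2 Q.2).2.2 l).trans (bd hPR)
  have hSQ := fun l => ((hb _ hQI Q.2 Q.2).2.2 l).trans (bd hQR)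
  have hm₁ := hmod₁ _ hPI _ hQI (hPQ.trans_le ((min_le_right _ _).trans (min_le_left _ _))) Q.2
    (mem_closedBall_zero_iff.2 hQR)
  rw [Prod.dist_eq, max_lt_iff, dist_pi_lt_iff hεa] at hm₁
  have hBd : ‖driftVec b P.1 P.2 - driftVec b Q.1 Q.2‖ ≤ C * ‖P.2 - Q.2‖ + ε / a ^ 2 := by
    rw [← dist_eq_norm]
    refine (dist_triangle _ (driftVec b P.1 Q.2) _).trans (add_le_add ?_ hm₁.1.le)
    rw [dist_eq_norm]
    exact (hb _ hPI P.2 Q.2).1.1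
  have hSd : ∀ l, ‖diffCol σm l P.1 P.2 - diffCol σm l Q.1 Q.2‖ ≤
      C * ‖P.2 - Q.2‖ + ε / a ^ 2 := fun l => by
    rw [← dist_eq_norm]
    refine (dist_triangle _ (diffCol σm l P.1 Q.2) _).trans (add_le_add ?_ (hm₁.2 l).le)
    rw [dist_eq_norm]
    exact (hb _ hPI P.2 Q.2).1.2 l
  have hz := norm_gradient_le hM0 hεa.le hq hSQ
  set z : Fin d → ℝ := fun l => innerSL ℝ q (diffCol σm l Q.1 Q.2)
  have hVR : |V Q| ≤ R' := (hMv Q (by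
    rw [Metric.mem_closedBall, dist_eq_norm]; linarith)).trans (le_max_right _ _)
  have hξ1 : ‖P.2 - Q.2‖ ≤ ε₁ := (le_mul_of_one_le_left (norm_nonneg _) ha).trans hξ.le
  have hzξ : (1 + ‖z‖) * ‖P.2 - Q.2‖ < δA := by
    refine lt_of_le_of_lt ?_ hε₁A
    have e1 : a ^ 2 * ‖P.2 - Q.2‖ ^ 2 ≤ ε₁ * 1 := by
      rw [← mul_pow, sq]
      exact mul_le_mul hξ.le (by linarith) (by positivity) hε₁0.le
    have e2 : ε / a ^ 2 * ‖P.2 - Q.2‖ ≤ 1 * ε₁ :=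
      mul_le_mul (by linarith) hξ1 (norm_nonneg _) zero_le_one
    calc (1 + ‖z‖) * ‖P.2 - Q.2‖
        ≤ (1 + (a ^ 2 * ‖P.2 - Q.2‖ + ε / a ^ 2) * M) * ‖P.2 - Q.2‖ := by gcongr
      _ = ‖P.2 - Q.2‖ + (a ^ 2 * ‖P.2 - Q.2‖ ^ 2 + ε / a ^ 2 * ‖P.2 - Q.2‖) * M := by ring
      _ ≤ ε₁ + (ε₁ * 1 + 1 * ε₁) * M := by gcongr
      _ = _ := by ring
  have hzZ : ‖z‖ ≤ Z := by
    refine hz.trans (mul_le_mul_of_nonneg_right ?_ hM0)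
    have : a * (a * ‖P.2 - Q.2‖) ≤ a * 1 :=
      mul_le_mul_of_nonneg_left (by linarith) ha0.le
    nlinarith
  refine ⟨P, Q, τ₁, τ₂, p, q, X, Y, ψ, φ, hPη, hQη, hτ.trans hεaε, ?_, fun l => ?_, fun l => ?_, ?_,
    hψ, hφ, hWP, hVQ, hWψ, hVφ⟩
  · rw [hD]
    exact abs_inner_sub_inner_le ha hε.le hε1 hC hp hq hξε
      ((hb _ hPI P.2 Q.2).2.1.trans (bd hPR)) hBd
  · rw [hD]
    exact abs_inner_sub_inner_le ha hε.le hε1 hC hp hq hξε (hSP l) (hSd l)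
  · refine (hXY _ _).trans (le_trans ?_
      (sq_penalty_le ha hε.le hε1 hC hξε (hSP l) (hSQ l) (hSd l)))
    gcongr
    exact min_le_left _ _
  · have e1 := (hfΦ P.1 hPT P.2 Q.2 (hPR.trans (le_max_left _ _)) (hQR.trans (le_max_left _ _))
      (V Q) hVR z).trans (hΦδ _ (by positivity) hzξ).le
    have e2 := (hmod₂ _ hPI _ hQI (hPQ.trans_le ((min_le_right _ _).trans (min_le_right _ _)))
      (Q.2, V Q, z) ⟨mem_closedBall_zero_iff.2 hQR, mem_closedBall_zero_iff.2 hVR,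
        mem_closedBall_zero_iff.2 hzZ⟩).le
    rw [Real.dist_eq] at e2
    have := (abs_sub_le _ _ _).trans (add_le_add e1 e2)
    linarith

end Doubling

section ContactAbsurd

open Filter Topology

variable {k d : ℕ}

/-- At nearby doubled points with `u - v` bounded below, the obstacles are inactive. -/
theorem jetOp_ineq_of_obstacles {u v Lu Lv Hu Hv E E' ω : ℝ} (huv : ω / 2 < u - v)
    (hL : |Lu - Lv| < ω / 2) (hH : |Hu - Hv| < ω / 2)
    (hu : u ≤ Hu ∧ (u ≤ Lu ∨ 0 ≤ E)) (hv : Hv ≤ v ∨ Lv ≤ v ∧ E' ≤ 0) : E' ≤ E := by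
  have h1 := le_of_abs_le hL.le
  have h2 := le_of_abs_le hH.le
  rcases hv with hv | ⟨hv, hE'⟩
  · linarith [hu.1]
  · rcases hu.2 with hu | hE
    · linarith
    · exact hE'.trans hE

set_option maxHeartbeats 1000000 in
theorem weighted_contact_absurd {T : ℝ} {b : ℝ → Euc k → Fin k → ℝ}
    {σm : ℝ → Euc k → Matrix (Fin k) (Fin d) ℝ} {g g' : Euc k → ℝ}
    {f : ℝ → Euc k → ℝ → (Fin d → ℝ) → ℝ} {Hf Lf u v : ℝ → Euc k → ℝ}
    (h0 : H0 T b σm)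
    (hf : Continuous fun q : (ℝ × Euc k) × ℝ × (Fin d → ℝ) => f q.1.1 q.1.2 q.2.1 q.2.2)
    (hH : Continuous fun p : ℝ × Euc k => Hf p.1 p.2)
    (hL : Continuous fun p : ℝ × Euc k => Lf p.1 p.2)
    {K : ℝ} (hK : 0 ≤ K)
    (hfK : ∀ (t : ℝ) (x : Euc k) (y y' : ℝ) (z z' : Fin d → ℝ),
      |f t x y z - f t x y' z'| ≤ K * (|y - y'| + ‖z - z'‖))
    (A2 : ∀ R > (0 : ℝ), ∃ Φ : ℝ → ℝ, (∀ s, 0 ≤ Φ s) ∧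
      (∀ ε > (0 : ℝ), ∃ δ > (0 : ℝ), ∀ s, 0 ≤ s → s < δ → Φ s < ε) ∧
      ∀ t ∈ Ioo (0 : ℝ) T, ∀ x x' : Euc k, ‖x‖ ≤ R → ‖x'‖ ≤ R → ∀ y : ℝ, |y| ≤ R →
        ∀ z : Fin d → ℝ, |f t x y z - f t x' y z| ≤ Φ ((1 + ‖z‖) * ‖x - x'‖))
    (huc : Continuous fun p : ℝ × Euc k => u p.1 p.2)
    (hvc : Continuous fun p : ℝ × Euc k => v p.1 p.2)
    (hu : IsViscSubsol T b σm g (FMm f Lf Hf) u) (hv : IsViscSupersol T b σm g' (FMm f Lf Hf) v)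
    {C : ℝ} (hC : 0 ≤ C) (hb : ∀ t ∈ Icc (0 : ℝ) T, ∀ x x' : Euc k,
      (‖driftVec b t x - driftVec b t x'‖ ≤ C * ‖x - x'‖ ∧
        ∀ l, ‖diffCol σm l t x - diffCol σm l t x'‖ ≤ C * ‖x - x'‖) ∧
      ‖driftVec b t x‖ ≤ C * (1 + ‖x‖) ∧ ∀ l, ‖diffCol σm l t x‖ ≤ C * (1 + ‖x‖))
    {A₁ A₂ θ : ℝ} {q m : ℕ} (hA₁ : A₁ = 4 * (q + 2) * C)
    (hA₂ : A₂ = (16 * (q + 2) ^ 2 + 4 * (q + 2)) * C ^ 2)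
    (hm : T * (1 + K + d / 2 * A₂ + A₁ + K * A₁) ≤ m) (hθ : 0 < θ)
    {t₀ : ℝ} {x₀ : Euc k} (ht₀ : t₀ ∈ Ioo 0 T)
    (h₀ : u t₀ x₀ - v t₀ x₀ = θ * ((t₀ ^ m)⁻¹ * polyWeight (q + 2) x₀))
    (hle : ∀ t ∈ Ioo 0 T, ∀ x,
      u t x - v t x ≤ θ * ((t ^ m)⁻¹ * polyWeight (q + 2) x)) : False := by
  set χ : ℝ × Euc k → ℝ := fun P => θ * ((P.1 ^ m)⁻¹ * polyWeight (q + 2) P.2) with hχ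
  set P₀ : ℝ × Euc k := (t₀, x₀) with hP₀
  set ω := χ P₀ with hω
  have hρ : ∀ x : Euc k, 0 < polyWeight (q + 2) x := fun x =>
    zero_lt_one.trans_le (one_le_polyWeight _ x)
  have hω0 : 0 < ω := mul_pos hθ (mul_pos (inv_pos.2 (pow_pos ht₀.1 m)) (hρ x₀))
  set ω' := ω / (4 * (1 + 2 * K)) with hω'
  have hω'0 : 0 < ω' := by positivity
  have hω'4 : (1 + 2 * K) * ω' = ω / 4 := by rw [hω']; field_simp
  have hχc : ContinuousAt χ P₀ := by
    refine ContinuousAt.mul continuousAt_const (ContinuousAt.mul ?_ ?_)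
    · exact (continuousAt_fst.pow m).inv₀ (pow_pos ht₀.1 m).ne'
    · exact ((contDiff_polyWeight _).continuous.comp continuous_snd).continuousAt
  -- a common radius of continuity
  have hev : ∀ᶠ S : (ℝ × Euc k) × (ℝ × Euc k) in 𝓝 (P₀, P₀),
      |u S.1.1 S.1.2 - v S.2.1 S.2.2 - ω| < ω' ∧ ω - ω' < χ S.1 ∧
      |Lf S.1.1 S.1.2 - Lf S.2.1 S.2.2| < ω / 2 ∧ |Hf S.1.1 S.1.2 - Hf S.2.1 S.2.2| < ω / 2 := by
    have e1 : Continuous fun S : (ℝ × Euc k) × (ℝ × Euc k) =>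
        |u S.1.1 S.1.2 - v S.2.1 S.2.2 - ω| :=
      (((huc.comp continuous_fst).sub (hvc.comp continuous_snd)).sub continuous_const).abs
    have e2 : Continuous fun S : (ℝ × Euc k) × (ℝ × Euc k) =>
        |Lf S.1.1 S.1.2 - Lf S.2.1 S.2.2| :=
      ((hL.comp continuous_fst).sub (hL.comp continuous_snd)).abs
    have e3 : Continuous fun S : (ℝ × Euc k) × (ℝ × Euc k) =>
        |Hf S.1.1 S.1.2 - Hf S.2.1 S.2.2| :=
      ((hH.comp continuous_fst).sub (hH.comp continuous_snd)).abs
    have e4 : ContinuousAt (fun S : (ℝ × Euc k) × (ℝ × Euc k) => χ S.1) (P₀, P₀) :=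
      ContinuousAt.comp (x := ((P₀, P₀) : (ℝ × Euc k) × (ℝ × Euc k))) (f := Prod.fst) (g := χ) hχc
        continuousAt_fst
    refine (e1.continuousAt.eventually_lt_const ?_).and ((e4.eventually_const_lt ?_).and
      ((e2.continuousAt.eventually_lt_const ?_).and (e3.continuousAt.eventually_lt_const ?_)))
    · simpa [hP₀, h₀, hω, hχ] using hω'0
    · exact sub_lt_self _ hω'0
    · simpa using hω0
    · simpa using hω0
  obtain ⟨η₀, hη₀, hball⟩ := Metric.eventually_nhds_iff.1 hev
  obtain ⟨η₁, hη₁, hT⟩ := Metric.isOpen_iff.1 (isOpen_Ioo (a := (0 : ℝ)) (b := T)) t₀ ht₀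
  set η := min (min η₀ η₁) 1 with hη
  have hη0 : 0 < η := by positivity
  have hη1 : η ≤ 1 := min_le_right _ _
  have hηη₀ : η ≤ η₀ := (min_le_left _ _).trans (min_le_left _ _)
  have hηT : Metric.ball P₀.1 η ⊆ Ioo 0 T :=
    (Metric.ball_subset_ball ((min_le_left _ _).trans (min_le_right _ _))).trans hT
  have mem : ∀ {P : ℝ × Euc k}, ‖P - P₀‖ < η → P.1 ∈ Ioo 0 T := fun {P} h => hηT <| by
    rw [Metric.mem_ball, dist_eq_norm]
    exact (norm_fst_le (P - P₀)).trans_lt h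
  obtain ⟨M, hM⟩ : ∃ M, M = C * (2 + ‖P₀.2‖) := ⟨_, rfl⟩
  obtain ⟨D, hD⟩ : ∃ D, D = 2 * M + 2 * C + 2 := ⟨_, rfl⟩
  have hM0 : 0 ≤ M := by rw [hM]; positivity
  have hD0 : 0 ≤ D := by rw [hD]; positivity
  obtain ⟨N, hN⟩ : ∃ N, N = (3 + d / 2 * ((C + 1) ^ 2 + 2 * M ^ 2) + d * M ^ 2 + 2 * M + D) +
      K * (2 * M + D) + 2 := ⟨_, rfl⟩
  have hN0 : 0 < N := by rw [hN]; positivity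
  obtain ⟨ε, hεd⟩ : ∃ ε, ε = min (ω / (4 * N)) 1 := ⟨_, rfl⟩
  have hε : 0 < ε := by rw [hεd]; positivity
  have hε1 : ε ≤ 1 := hεd ▸ min_le_right _ _
  have hεN : N * ε ≤ ω / 4 := by
    have : ε ≤ ω / (4 * N) := hεd ▸ min_le_left _ _
    rw [le_div_iff₀ (by positivity)] at this
    linarith
  have hχon : ContinuousOn χ (Metric.closedBall P₀ (η / 2)) := by
    refine ContinuousOn.mul continuousOn_const (ContinuousOn.mul ?_ ?_)
    · refine ((continuous_fst.pow m).continuousOn).inv₀ fun P hP => (pow_pos ?_ m).ne'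
      rw [Metric.mem_closedBall, dist_eq_norm] at hP
      exact (mem (by linarith)).1
    · exact ((contDiff_polyWeight _).continuous.comp continuous_snd).continuousOn
  obtain ⟨P, Q, τ₁, τ₂, p, p', X, Y, ψ, φ, hP, hQ, hτ, hDB, hDS, hXY, hfPQ, hψ, hφ, hWP, hVQ,
      hWψ, hVφ⟩ := exists_doubled_contact (f := f) h0 hf A2 hC hb
    (W := fun P => u P.1 P.2 - χ P - ε * ((P.1 - t₀) ^ 2 + ‖P.2 - x₀‖ ^ 2))
    (V := fun P => v P.1 P.2) (P₀ := P₀) hη0 hη1 hηT hε hε1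
    ((huc.continuousOn.sub hχon).sub (Continuous.continuousOn (by fun_prop))) hvc
    (by simp only [hP₀, sub_self, norm_zero]; linarith [h₀, hω]) (by
      intro P hP
      rw [Metric.mem_closedBall, dist_eq_norm] at hP
      have e1 := hle P.1 (mem (by linarith)) P.2
      have e2 : ‖P - P₀‖ ^ 2 ≤ (P.1 - t₀) ^ 2 + ‖P.2 - x₀‖ ^ 2 := by
        rw [Prod.norm_def]
        rcases max_choice ‖(P - P₀).1‖ ‖(P - P₀).2‖ with h | h <;> rw [h]
        · rw [Real.norm_eq_abs, sq_abs]
          exact le_add_of_nonneg_right (sq_nonneg _)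
        · exact le_add_of_nonneg_left (sq_nonneg _)
      have e3 := mul_le_mul_of_nonneg_left e2 hε.le
      change u P.1 P.2 - χ P - ε * ((P.1 - t₀) ^ 2 + ‖P.2 - x₀‖ ^ 2) - v P.1 P.2 ≤ _
      have e4 : u P.1 P.2 - v P.1 P.2 ≤ χ P := e1
      clear_value χ
      clear * - e3 e4
      linarith) hM hD
  have hPT := mem hP
  have hQT := mem hQ
  have hPI := Ioo_subset_Icc_self hPT
  have hxη : ‖P.2 - x₀‖ ≤ 1 := (norm_snd_le (P - P₀)).trans (by linarith)
  have htη : |P.1 - t₀| ≤ 1 := (norm_fst_le (P - P₀)).trans (by linarith)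
  obtain ⟨huv, hχP, hLPQ, hHPQ⟩ := hball (y := (P, Q)) (by
    rw [Prod.dist_eq, dist_eq_norm, dist_eq_norm]
    exact (max_lt hP hQ).trans_le hηη₀)
  simp only at huv hLPQ hHPQ hχP
  obtain ⟨ζ, p₀, X₀, hζ, hζe, hζb⟩ := exists_parabolicJet_weight hθ.le hε.le hC q m t₀ x₀ hPT.1 hxη
  have hζP := hζe.self_of_nhds
  have hsub := hu.jetOp_nonneg hPT (hζ.add hψ)
    (by simp only at hWP hζP; simp only [hχ] at hWP; linarith)
    (by
      filter_upwards [hζe, hWψ] with P' e1 e2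
      simp only [hχ] at e2
      linarith)
  have hsup := hv.jetOp_nonpos hQT hφ hVQ hVφ
  have hω'ω : ω' ≤ ω / 4 := by
    rw [← hω'4]
    exact le_mul_of_one_le_left hω'0.le (by linarith)
  have hmain := jetOp_ineq_of_obstacles (ω := ω) (by linarith [(abs_lt.1 huv).1]) hLPQ hHPQ
    hsub hsup
  have hxR : ‖P.2‖ ≤ 1 + ‖x₀‖ := by linarith [norm_sub_norm_le P.2 x₀]
  have bd : C * (1 + ‖P.2‖) ≤ M := by
    rw [hM]
    exact mul_le_mul_of_nonneg_left (by linarith) hC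
  have hB := (hb _ hPI P.2 P.2).2.1
  have hS := (hb _ hPI P.2 P.2).2.2
  set r := θ * ((P.1 ^ m)⁻¹ * polyWeight (q + 2) P.2) with hr
  rw [← hA₁, ← hA₂] at hζb
  have hgr : ∀ w : Euc k, ‖w‖ ≤ C * (1 + ‖P.2‖) → |p₀ w| ≤ A₁ * r + 2 * M * ε ∧
      X₀ w w ≤ A₂ * r + 2 * M ^ 2 * ε := fun w hw => by
    have hwM := hw.trans bd
    exact ⟨(hζb w hw).1.trans (by gcongr), (hζb w hw).2.trans (by gcongr)⟩
  have hr0 : 0 < r := by linarith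
  have hA₁0 : 0 ≤ A₁ := by rw [hA₁]; positivity
  have hJ := jetOp_sub_jetOp_le (c := m / P.1) (r := r) (ε := ε)
    (τ₀ := -(m / P.1) * r + ε * (2 * (P.1 - t₀)))
    (by linarith [mul_le_mul_of_nonneg_left (le_of_abs_le htη) hε.le]) hτ hDB hXY (hgr _ hB).1 fun l => (hgr _ (hS l)).2
  have hz := norm_gradient_sub_le (N := A₁ * r + 2 * M * ε) (by positivity) hDS
    fun l => (hgr _ (hS l)).1
  have hfu := le_of_abs_le (hfK P.1 P.2 (u P.1 P.2) (v Q.1 Q.2)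
    (fun l => (p₀ + innerSL ℝ p) (diffCol σm l P.1 P.2))
    fun l => innerSL ℝ p' (diffCol σm l Q.1 Q.2))
  have hfv := le_of_abs_le hfPQ
  have hmt : 1 + K + d / 2 * A₂ + A₁ + K * A₁ ≤ m / P.1 := by
    have hA₂0 : 0 ≤ A₂ := by rw [hA₂]; positivity
    rw [le_div_iff₀ hPT.1]
    refine le_trans ?_ hm
    rw [mul_comm]
    exact mul_le_mul_of_nonneg_right hPT.2.le (by positivity)
  have habs : |u P.1 P.2 - v Q.1 Q.2| ≤ ω + ω' := by
    have := abs_lt.1 huv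
    exact abs_le.2 ⟨by linarith, by linarith⟩
  have hK1 := mul_le_mul_of_nonneg_left (add_le_add habs hz) hK
  have hmr := mul_le_mul_of_nonneg_right hmt hr0.le
  have hKr := mul_le_mul_of_nonneg_left hχP.le (by linarith : (0 : ℝ) ≤ 1 + K)
  simp only [jetOp] at hmain
  rw [hN] at hεN
  clear * - hmain hJ hfu hfv hK1 hmr hKr hεN hω'4 hω0
  linarith

end ContactAbsurd

section ComparisonPrinciple

open Filter Topology

variable {k d : ℕ}

theorem PolyGrowth.exists_polyWeight {T : ℝ} {u : ℝ → Euc k → ℝ} (h : PolyGrowth T u) :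
    ∃ C n, 0 ≤ C ∧ ∀ m ≥ n, ∀ t ∈ Icc (0 : ℝ) T, ∀ x, |u t x| ≤ C * polyWeight m x := by
  obtain ⟨C, γ, hC, hγ, hu⟩ := h
  refine ⟨2 * C, ⌈γ⌉₊, by positivity, fun m hm t ht x => (hu t ht x).trans ?_⟩
  have h1 := one_le_polyWeight m x
  have h2 : ‖x‖ ^ γ ≤ polyWeight m x := by
    have hx : ‖x‖ ≤ 1 + ‖x‖ ^ 2 := by nlinarith [sq_nonneg (‖x‖ - 1)]
    calc ‖x‖ ^ γ ≤ (1 + ‖x‖ ^ 2) ^ γ := Real.rpow_le_rpow (norm_nonneg _) hx hγ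
      _ ≤ (1 + ‖x‖ ^ 2) ^ (m : ℝ) := Real.rpow_le_rpow_of_exponent_le
          (le_add_of_nonneg_right (sq_nonneg _)) ((Nat.le_ceil γ).trans (by exact_mod_cast hm))
      _ = _ := Real.rpow_natCast _ _
  nlinarith

/-- A function of polynomial growth that is positive somewhere touches a multiple of the weight
`t⁻ᵐ (1 + |x|²)ⁿ⁺²` from below at an interior time. -/
theorem exists_weighted_max {w : ℝ → Euc k → ℝ} (hw : Continuous fun P : ℝ × Euc k => w P.1 P.2)
    {T C : ℝ} {n m : ℕ} (hm : m ≠ 0) (hC : 0 ≤ C)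
    (hg : ∀ t ∈ Icc (0 : ℝ) T, ∀ x, |w t x| ≤ C * polyWeight n x) (hwT : ∀ x, w T x ≤ 0)
    {t₁ : ℝ} {x₁ : Euc k} (ht₁ : t₁ ∈ Ioc 0 T) (hpos : 0 < w t₁ x₁) :
    ∃ θ > 0, ∃ t₀ ∈ Ioo 0 T, ∃ x₀ : Euc k,
      w t₀ x₀ = θ * ((t₀ ^ m)⁻¹ * polyWeight (n + 2) x₀) ∧
      ∀ t ∈ Ioo 0 T, ∀ x, w t x ≤ θ * ((t ^ m)⁻¹ * polyWeight (n + 2) x) := by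
  have hρ : ∀ x : Euc k, 0 < polyWeight (n + 2) x := fun x =>
    zero_lt_one.trans_le (one_le_polyWeight _ x)
  set Ψ : ℝ × Euc k → ℝ := fun P => w P.1 P.2 * P.1 ^ m / polyWeight (n + 2) P.2 with hΨ
  have hΨc : Continuous Ψ := (hw.mul (continuous_fst.pow m)).div
    ((contDiff_polyWeight _).continuous.comp continuous_snd) fun P => (hρ _).ne'
  set c := Ψ (t₁, x₁) with hc
  have hT : 0 ≤ T := ht₁.1.le.trans ht₁.2
  have hc0 : 0 < c := div_pos (mul_pos hpos (pow_pos ht₁.1 m)) (hρ _)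
  set R := max (max 1 (T ^ m * C / c)) ‖x₁‖ with hR
  have hfar : ∀ t ∈ Icc 0 T, ∀ x : Euc k, R < ‖x‖ → Ψ (t, x) < c := by
    intro t ht x hx
    have h1 : 1 < ‖x‖ := ((le_max_left _ _).trans (le_max_left _ _)).trans_lt hx
    have h2 : T ^ m * C / c < ‖x‖ := ((le_max_right _ _).trans (le_max_left _ _)).trans_lt hx
    rw [div_lt_iff₀ hc0] at h2
    simp only [hΨ]
    rw [div_lt_iff₀ (hρ x)]
    have h3 : polyWeight (n + 2) x = polyWeight n x * (1 + ‖x‖ ^ 2) ^ 2 := pow_add _ _ _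
    have h4 := one_le_polyWeight n x
    have h5 : ‖x‖ ≤ (1 + ‖x‖ ^ 2) ^ 2 := by nlinarith [sq_nonneg (‖x‖ ^ 2)]
    calc w t x * t ^ m ≤ C * polyWeight n x * T ^ m := by
          refine mul_le_mul ((le_abs_self _).trans (hg t ht x))
            (pow_le_pow_left₀ ht.1 ht.2 m) (pow_nonneg ht.1 m) (by positivity)
      _ = polyWeight n x * (T ^ m * C) := by ring
      _ < polyWeight n x * (‖x‖ * c) := by gcongr
      _ ≤ polyWeight n x * ((1 + ‖x‖ ^ 2) ^ 2 * c) := by gcongr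
      _ = _ := by rw [h3]; ring
  have hmem : (t₁, x₁) ∈ Icc 0 T ×ˢ Metric.closedBall (0 : Euc k) R :=
    ⟨Ioc_subset_Icc_self ht₁, mem_closedBall_zero_iff.2 (le_max_right _ _)⟩
  obtain ⟨⟨t₀, x₀⟩, ⟨ht₀, -⟩, hmax⟩ := (isCompact_Icc.prod
    (isCompact_closedBall (0 : Euc k) R)).exists_isMaxOn ⟨_, hmem⟩ hΨc.continuousOn
  have hcθ : c ≤ Ψ (t₀, x₀) := hmax hmem
  have hglob : ∀ t ∈ Icc 0 T, ∀ x, Ψ (t, x) ≤ Ψ (t₀, x₀) := fun t ht x => by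
    rcases le_or_gt ‖x‖ R with hx | hx
    · exact hmax (show (t, x) ∈ _ from ⟨ht, mem_closedBall_zero_iff.2 hx⟩)
    · exact (hfar t ht x hx).le.trans hcθ
  have hθ := hc0.trans_le hcθ
  have ht0 : t₀ ≠ 0 := by
    rintro rfl
    simp [hΨ, hm] at hθ
  have htT : t₀ ≠ T := by
    rintro rfl
    exact hθ.not_ge (div_nonpos_of_nonpos_of_nonneg
      (mul_nonpos_of_nonpos_of_nonneg (hwT x₀) (pow_nonneg ht₀.1 m)) (hρ _).le)
  have hrec : ∀ t, 0 < t → ∀ x, w t x = Ψ (t, x) * ((t ^ m)⁻¹ * polyWeight (n + 2) x) :=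
    fun t ht x => by
      have := (pow_pos ht m).ne'
      have := (hρ x).ne'
      simp only [hΨ]
      field_simp
  have ht0' := lt_of_le_of_ne ht₀.1 (Ne.symm ht0)
  refine ⟨_, hθ, t₀, ⟨ht0', lt_of_le_of_ne ht₀.2 htT⟩, x₀, hrec t₀ ht0' x₀, fun t ht x => ?_⟩
  rw [hrec t ht.1 x]
  exact mul_le_mul_of_nonneg_right (hglob t (Ioo_subset_Icc_self ht) x)
    (mul_nonneg (inv_nonneg.2 (pow_nonneg ht.1.le m)) (hρ x).le)

/-- Comparison principle for the max-min problem in the class of polynomial growth. -/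
theorem IsViscSubsol.le_supersol {T : ℝ} {b : ℝ → Euc k → Fin k → ℝ}
    {σm : ℝ → Euc k → Matrix (Fin k) (Fin d) ℝ} {g : Euc k → ℝ}
    {f : ℝ → Euc k → ℝ → (Fin d → ℝ) → ℝ} {Hf Lf u v : ℝ → Euc k → ℝ}
    (hT : 0 < T) (h0 : H0 T b σm)
    (hf : Continuous fun q : (ℝ × Euc k) × ℝ × (Fin d → ℝ) => f q.1.1 q.1.2 q.2.1 q.2.2)
    (hH : Continuous fun p : ℝ × Euc k => Hf p.1 p.2)
    (hL : Continuous fun p : ℝ × Euc k => Lf p.1 p.2)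
    (hfK : ∃ C : ℝ, ∀ (t : ℝ) (x : Euc k) (y y' : ℝ) (z z' : Fin d → ℝ),
      |f t x y z - f t x y' z'| ≤ C * (|y - y'| + ‖z - z'‖))
    (A2 : ∀ R > (0 : ℝ), ∃ Φ : ℝ → ℝ, (∀ s, 0 ≤ Φ s) ∧
      (∀ ε > (0 : ℝ), ∃ δ > (0 : ℝ), ∀ s, 0 ≤ s → s < δ → Φ s < ε) ∧
      ∀ t ∈ Ioo (0 : ℝ) T, ∀ x x' : Euc k, ‖x‖ ≤ R → ‖x'‖ ≤ R → ∀ y : ℝ, |y| ≤ R →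
        ∀ z : Fin d → ℝ, |f t x y z - f t x' y z| ≤ Φ ((1 + ‖z‖) * ‖x - x'‖))
    (huc : Continuous fun p : ℝ × Euc k => u p.1 p.2) (hug : PolyGrowth T u)
    (hvc : Continuous fun p : ℝ × Euc k => v p.1 p.2) (hvg : PolyGrowth T v)
    (hu : IsViscSubsol T b σm g (FMm f Lf Hf) u) (hv : IsViscSupersol T b σm g (FMm f Lf Hf) v) :
    ∀ t ∈ Icc (0 : ℝ) T, ∀ x, u t x ≤ v t x := by
  obtain ⟨K, hK⟩ := hfK
  obtain ⟨C, hC, hb⟩ := h0.exists_bounds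
  obtain ⟨Cu, n₁, hCu, hun⟩ := hug.exists_polyWeight
  obtain ⟨Cv, n₂, hCv, hvn⟩ := hvg.exists_polyWeight
  set n := max n₁ n₂
  obtain ⟨m, hm⟩ := exists_nat_ge (T * (1 + |K| +
    d / 2 * ((16 * ((n : ℝ) + 2) ^ 2 + 4 * (n + 2)) * C ^ 2) + 4 * (n + 2) * C +
    |K| * (4 * (n + 2) * C)))
  have hpos : ∀ t ∈ Ioc (0 : ℝ) T, ∀ x, u t x ≤ v t x := by
    intro t ht x
    by_contra! hlt
    obtain ⟨θ, hθ, t₀, ht₀, x₀, heq, hle⟩ := exists_weighted_max (w := fun t x => u t x - v t x)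
      (huc.sub hvc) (Nat.succ_ne_zero m) (add_nonneg hCu hCv)
      (fun t ht x => by
        rw [add_mul]
        exact (abs_sub _ _).trans (add_le_add (hun n (le_max_left _ _) t ht x)
          (hvn n (le_max_right _ _) t ht x)))
      (fun x => sub_nonpos.2 ((hu.1 x).trans (hv.1 x))) ht (sub_pos.2 hlt)
    exact weighted_contact_absurd h0 hf hH hL (abs_nonneg K)
      (fun t x y y' z z' => (hK t x y y' z z').trans
        (mul_le_mul_of_nonneg_right (le_abs_self K) (by positivity)))
      A2 huc hvc hu hv hC hb rfl rfl (hm.trans (by simp)) hθ ht₀ heq hle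
  intro t ht x
  have hcl : IsClosed {s | u s x ≤ v s x} := isClosed_le
    (huc.comp (continuous_id.prodMk continuous_const))
    (hvc.comp (continuous_id.prodMk continuous_const))
  rw [← closure_Ioc hT.ne] at ht
  exact hcl.closure_subset_iff.2 (fun s hs => hpos s hs x) ht

/-- For ordered obstacles, the min-max and max-min expressions coincide. -/
theorem Fmm_eq_FMm {f : ℝ → Euc k → ℝ → (Fin d → ℝ) → ℝ} {Lf Hf : ℝ → Euc k → ℝ} {t : ℝ}
    {x : Euc k} (h : Lf t x ≤ Hf t x) : Fmm f Lf Hf t x = FMm f Lf Hf t x := by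
  funext y τ l z
  rw [Fmm, FMm, max_min_distrib_left, max_eq_right (sub_le_sub_left h y)]

end ComparisonPrinciple

/-- **Theorem 5.2(ii)**: under (H0), (A1) and (A2), the (unique) continuous
polynomial-growth viscosity solution of the min-max two obstacle problem is also the
unique continuous polynomial-growth viscosity solution of the max-min problem. -/
theorem scalar_minmax_eq_maxmin
    {k d : ℕ} (hk : 1 ≤ k) (hd : 1 ≤ d) (T : ℝ) (hT : 0 < T)
    (b : ℝ → Euc k → Fin k → ℝ) (σm : ℝ → Euc k → Matrix (Fin k) (Fin d) ℝ)
    (g : Euc k → ℝ) (f : ℝ → Euc k → ℝ → (Fin d → ℝ) → ℝ) (Hf Lf : ℝ → Euc k → ℝ)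
    (h0 : H0 T b σm)
    (hg : Continuous g)
    (hf : Continuous fun q : (ℝ × Euc k) × ℝ × (Fin d → ℝ) => f q.1.1 q.1.2 q.2.1 q.2.2)
    (hH : Continuous fun p : ℝ × Euc k => Hf p.1 p.2)
    (hL : Continuous fun p : ℝ × Euc k => Lf p.1 p.2)
    (A1i : ∃ C p : ℝ, 0 ≤ C ∧ 0 ≤ p ∧ ∀ t ∈ Icc (0 : ℝ) T, ∀ x : Euc k,
      |g x| + |f t x 0 0| + |Hf t x| + |Lf t x| ≤ C * (1 + ‖x‖ ^ p))
    (A1ii : ∃ C : ℝ, ∀ (t : ℝ) (x : Euc k) (y y' : ℝ) (z z' : Fin d → ℝ),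
      |f t x y z - f t x y' z'| ≤ C * (|y - y'| + ‖z - z'‖))
    (A1iii : (∀ t ∈ Icc (0 : ℝ) T, ∀ x : Euc k, Lf t x ≤ Hf t x) ∧
      ∀ x : Euc k, Lf T x ≤ g x ∧ g x ≤ Hf T x)
    (A2 : ∀ R > (0 : ℝ), ∃ Φ : ℝ → ℝ, (∀ s, 0 ≤ Φ s) ∧
      (∀ ε > (0 : ℝ), ∃ δ > (0 : ℝ), ∀ s, 0 ≤ s → s < δ → Φ s < ε) ∧
      ∀ t ∈ Ioo (0 : ℝ) T, ∀ x x' : Euc k, ‖x‖ ≤ R → ‖x'‖ ≤ R → ∀ y : ℝ, |y| ≤ R →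
        ∀ z : Fin d → ℝ, |f t x y z - f t x' y z| ≤ Φ ((1 + ‖z‖) * ‖x - x'‖)) :
    ∀ u : ℝ → Euc k → ℝ,
      (Continuous (fun p : ℝ × Euc k => u p.1 p.2) ∧ PolyGrowth T u ∧
        IsViscSol T b σm g (Fmm f Lf Hf) u) →
      (IsViscSol T b σm g (FMm f Lf Hf) u ∧
        ∀ u' : ℝ → Euc k → ℝ,
          (Continuous (fun p : ℝ × Euc k => u' p.1 p.2) ∧ PolyGrowth T u' ∧
            IsViscSol T b σm g (FMm f Lf Hf) u') →
          ∀ t ∈ Icc (0 : ℝ) T, ∀ x : Euc k, u' t x = u t x) := by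
  rintro u ⟨huc, hug, hsub, hsup⟩
  have hF : ∀ t ∈ Ioo 0 T, ∀ x, Fmm f Lf Hf t x = FMm f Lf Hf t x := fun t ht x =>
    Fmm_eq_FMm (A1iii.1 t (Ioo_subset_Icc_self ht) x)
  have hu : IsViscSol T b σm g (FMm f Lf Hf) u :=
    ⟨⟨hsub.1, fun t x ht φ hφ hm he => hF t ht x ▸ hsub.2 t x ht φ hφ hm he⟩,
      ⟨hsup.1, fun t x ht φ hφ hm he => hF t ht x ▸ hsup.2 t x ht φ hφ hm he⟩⟩
  refine ⟨hu, fun u' ⟨huc', hug', hu'⟩ t ht x => le_antisymm ?_ ?_⟩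
  · exact hu'.1.le_supersol hT h0 hf hH hL A1ii A2 huc' hug' huc hug hu.2 t ht x
  · exact hu.1.le_supersol hT h0 hf hH hL A1ii A2 huc hug huc' hug' hu'.2 t ht x

end
end
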